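/- (Riebesehl–Schulz interior third order estimate) Let Ω be a domain in ℂⁿ and let u be plurisubharmonic of class C⁴ on Ω satisfying det(u_{i j̄}) = f in Ω, where f is of class C² and inf_Ω f > 0. Then for every subdomain Ω′ compactly contained in Ω one has the interior third order estimate sup_{Ω′} |∇Δu| ≤ C for a constant C depending only on n, sup_Ω |∇u|, sup_Ω |Δu|, inf_Ω f, sup_Ω |Df|, sup_Ω |D²f|, and the distance from Ω′ to ∂Ω. -/

import Mathlib

open MeasureTheory Metric Set
open scoped ComplexOrder

noncomputable section

/-- `ℂⁿ` with its Euclidean (Hermitian) structure. -/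
abbrev Cn (n : ℕ) := EuclideanSpace ℂ (Fin n)

instance {n : ℕ} : MeasurableSpace (Cn n) := borel _
instance {n : ℕ} : BorelSpace (Cn n) := ⟨rfl⟩
/-- Lebesgue (Haar) measure on `ℂⁿ`. -/
instance {n : ℕ} : MeasureSpace (Cn n) := ⟨Measure.addHaar⟩

/-- Second derivative of `u` at `z` in the (real) directions `v, w`. -/
def D2 {n : ℕ} (u : Cn n → ℝ) (z v w : Cn n) : ℝ := fderiv ℝ (fderiv ℝ u) z v w

/-- The complex Hessian matrix `(u_{i j̄})` of a real valued function on `ℂⁿ`: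
`u_{i j̄} = (1/4)(u_{x_i x_j} + u_{y_i y_j}) + (i/4)(u_{x_i y_j} - u_{y_i x_j})`. -/
def complexHessian {n : ℕ} (u : Cn n → ℝ) (z : Cn n) : Matrix (Fin n) (Fin n) ℂ := fun i j =>
  (1/4 : ℂ) * ( ((D2 u z (EuclideanSpace.single i 1) (EuclideanSpace.single j 1)
      + D2 u z (EuclideanSpace.single i Complex.I) (EuclideanSpace.single j Complex.I) : ℝ) : ℂ)
    + Complex.I * ((D2 u z (EuclideanSpace.single i 1) (EuclideanSpace.single j Complex.I)
      - D2 u z (EuclideanSpace.single i Complex.I) (EuclideanSpace.single j 1) : ℝ) : ℂ) )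

/-- `u` is of class `C^{1,1}` on the open set `Ω`: continuously differentiable with
locally Lipschitz gradient. -/
def C11On {n : ℕ} (u : Cn n → ℝ) (Ω : Set (Cn n)) : Prop :=
  ContDiffOn ℝ 1 u Ω ∧
    ∀ z ∈ Ω, ∃ ε > 0, ∃ K : NNReal, ball z ε ⊆ Ω ∧ LipschitzOnWith K (fderiv ℝ u) (ball z ε)

/-- The second order derivatives of `u` exist almost everywhere in `Ω`
(automatic for `C^{1,1}` functions, by Rademacher's theorem). -/
def AESecondDiff {n : ℕ} (u : Cn n → ℝ) (Ω : Set (Cn n)) : Prop :=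
  ∀ᵐ z, z ∈ Ω → DifferentiableAt ℝ (fderiv ℝ u) z

/-- A `C^{1,1}` function is plurisubharmonic iff its complex Hessian is positive
semidefinite almost everywhere. -/
def PshAE {n : ℕ} (u : Cn n → ℝ) (Ω : Set (Cn n)) : Prop :=
  ∀ᵐ z, z ∈ Ω → (complexHessian u z).PosSemidef

/-- The real Laplacian of `u : ℂⁿ → ℝ`, viewing `ℂⁿ ≅ ℝ^{2n}`. -/
def lap {n : ℕ} (u : Cn n → ℝ) (z : Cn n) : ℝ :=
  ∑ k : Fin n,
    (D2 u z (EuclideanSpace.single k 1) (EuclideanSpace.single k 1)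
      + D2 u z (EuclideanSpace.single k Complex.I) (EuclideanSpace.single k Complex.I))

section CutoffFunctions

variable {E : Type*} [NormedAddCommGroup E] [InnerProductSpace ℂ E] [NormedSpace ℝ E]

lemma exists_bound_deriv_smoothTransition :
    ∃ D : ℝ, 0 < D ∧ ∀ t, ‖fderiv ℝ Real.smoothTransition t‖ ≤ D := by
  have hc : Continuous fun t => ‖fderiv ℝ Real.smoothTransition t‖ :=
    ((Real.smoothTransition.contDiff (n := 1)).continuous_fderiv (by norm_num)).norm
  obtain ⟨D, hD⟩ := (isCompact_Icc (a := (0 : ℝ)) (b := 1)).bddAbove_image hc.continuousOn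
  refine ⟨max D 1, by positivity, fun t => ?_⟩
  by_cases ht : t ∈ Icc (0 : ℝ) 1
  · exact (hD (mem_image_of_mem _ ht)).trans (le_max_left _ _)
  · have h0 : fderiv ℝ Real.smoothTransition t = 0 := by
      rw [mem_Icc, not_and_or, not_le, not_le] at ht
      rcases ht with ht | ht
      · have : Real.smoothTransition =ᶠ[nhds t] fun _ => 0 := by
          filter_upwards [Iio_mem_nhds ht] with y hy
          exact Real.smoothTransition.zero_of_nonpos (le_of_lt hy)
        rw [this.fderiv_eq, fderiv_fun_const]; rfl
      · have : Real.smoothTransition =ᶠ[nhds t] fun _ => 1 := by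
          filter_upwards [Ioi_mem_nhds ht] with y hy
          exact Real.smoothTransition.one_of_one_le (le_of_lt hy)
        rw [this.fderiv_eq, fderiv_fun_const]; rfl
    rw [h0, norm_zero]; positivity

/-- Cutoff functions between concentric balls, with the natural gradient bound. -/
lemma exists_cutoff : ∃ C : ℝ, 1 ≤ C ∧ ∀ r ρ : ℝ, 0 < r → r < ρ →
    ∃ η : E → ℝ, ContDiff ℝ 1 η ∧ (∀ x, 0 ≤ η x) ∧ (∀ x, η x ≤ 1) ∧
      (∀ x ∈ closedBall (0 : E) r, η x = 1) ∧ tsupport η ⊆ closedBall (0 : E) ρ ∧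
      ∀ x, ‖fderiv ℝ η x‖ ≤ C / (ρ - r) := by
  obtain ⟨D, hD, hDb⟩ := exists_bound_deriv_smoothTransition
  have hlip : ∀ s t, |Real.smoothTransition s - Real.smoothTransition t| ≤ D * |s - t| := by
    intro s t
    exact Convex.norm_image_sub_le_of_norm_fderiv_le (𝕜 := ℝ) (s := univ)
      (fun x _ => (Real.smoothTransition.contDiff (n := 1)).differentiable (by norm_num) x)
      (fun x _ => hDb x) convex_univ (mem_univ t) (mem_univ s)
  refine ⟨3 * D + 1, by linarith, fun r ρ hr hrρ => ?_⟩
  have hden : 0 < ρ ^ 2 - r ^ 2 := by nlinarith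
  have hns : ContDiff ℝ 1 fun x : E => ‖x‖ ^ 2 := contDiff_norm_sq ℂ
  have hin : ContDiff ℝ 1 fun x : E => (ρ ^ 2 - ‖x‖ ^ 2) / (ρ ^ 2 - r ^ 2) :=
    (contDiff_const.sub hns).div_const _
  set η : E → ℝ := fun x => Real.smoothTransition ((ρ ^ 2 - ‖x‖ ^ 2) / (ρ ^ 2 - r ^ 2)) with hη
  have hout : ∀ x : E, ρ ≤ ‖x‖ → η x = 0 := fun x hx =>
    Real.smoothTransition.zero_of_nonpos (div_nonpos_of_nonpos_of_nonneg (by nlinarith) hden.le)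
  refine ⟨η, Real.smoothTransition.contDiff.comp hin,
    fun x => Real.smoothTransition.nonneg _, fun x => Real.smoothTransition.le_one _,
    fun x hx => Real.smoothTransition.one_of_one_le ?_, ?_, fun x => ?_⟩
  · rw [mem_closedBall_zero_iff] at hx
    rw [one_le_div hden]
    nlinarith [norm_nonneg x]
  · refine closure_minimal (fun x hx => ?_) isClosed_closedBall
    rw [mem_closedBall_zero_iff]
    by_contra h
    exact hx (hout x (not_le.1 h).le)
  · have hpos : 0 < ρ - r := by linarith
    refine norm_fderiv_le_of_lip' ℝ (by positivity) ?_
    have key : ∀ y : E, ‖x‖ + ‖y‖ ≤ 3 * ρ →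
        ‖η y - η x‖ ≤ (3 * D + 1) / (ρ - r) * ‖y - x‖ := by
      intro y hy
      have h1 := hlip ((ρ ^ 2 - ‖y‖ ^ 2) / (ρ ^ 2 - r ^ 2)) ((ρ ^ 2 - ‖x‖ ^ 2) / (ρ ^ 2 - r ^ 2))
      have h2 : |(ρ ^ 2 - ‖y‖ ^ 2) / (ρ ^ 2 - r ^ 2) - (ρ ^ 2 - ‖x‖ ^ 2) / (ρ ^ 2 - r ^ 2)|
          ≤ 3 / (ρ - r) * ‖y - x‖ := by
        rw [← sub_div, abs_div, abs_of_pos hden, div_le_iff₀ hden]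
        have h3 : |ρ ^ 2 - ‖y‖ ^ 2 - (ρ ^ 2 - ‖x‖ ^ 2)| = (‖x‖ + ‖y‖) * |‖y‖ - ‖x‖| := by
          rw [show ρ ^ 2 - ‖y‖ ^ 2 - (ρ ^ 2 - ‖x‖ ^ 2) = -((‖x‖ + ‖y‖) * (‖y‖ - ‖x‖)) by ring,
            abs_neg, abs_mul, abs_of_nonneg (by positivity : 0 ≤ ‖x‖ + ‖y‖)]
        have h4 : 3 / (ρ - r) * ‖y - x‖ * (ρ ^ 2 - r ^ 2) = 3 * (ρ + r) * ‖y - x‖ := by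
          field_simp; ring
        rw [h3, h4]
        exact mul_le_mul (by linarith) (abs_norm_sub_norm_le y x) (abs_nonneg _) (by linarith)
      calc ‖η y - η x‖ ≤ D * (3 / (ρ - r) * ‖y - x‖) := h1.trans (by gcongr)
        _ = (3 * D) / (ρ - r) * ‖y - x‖ := by ring
        _ ≤ _ := by gcongr; linarith
    by_cases hx : ‖x‖ ≤ ρ
    · have : ∀ᶠ y : E in nhds x, ‖y‖ < 2 * ρ :=
        continuous_norm.continuousAt.eventually_lt continuousAt_const (by linarith)
      filter_upwards [this] with y hy using key y (by linarith)
    · have : ∀ᶠ y : E in nhds x, ρ < ‖y‖ :=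
        continuousAt_const.eventually_lt continuous_norm.continuousAt (not_le.1 hx)
      filter_upwards [this] with y hy
      rw [hout x (not_le.1 hx).le, hout y hy.le, sub_zero, norm_zero]
      positivity

end CutoffFunctions

section WeakSupersolutions

lemma integrable_of_continuousOn_of_eq_zero {X : Type*} [TopologicalSpace X] [T2Space X]
    [MeasurableSpace X] [BorelSpace X] (μ : Measure X) [IsFiniteMeasureOnCompacts μ]
    {F : X → ℝ} {K : Set X} (hK : IsCompact K) (hF : ContinuousOn F K)
    (h0 : ∀ x, x ∉ K → F x = 0) : Integrable F μ := by
  rw [← integrableOn_iff_integrable_of_support_subset (s := K)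
    (fun x hx => by by_contra h; exact hx (h0 x h))]
  exact hF.integrableOn_compact hK

variable {E : Type*} [NormedAddCommGroup E] [NormedSpace ℝ E]

/-- A continuous field of uniformly elliptic bilinear forms on covectors over the unit ball. -/
structure EllipticField (B : E → (E →L[ℝ] ℝ) →ₗ[ℝ] (E →L[ℝ] ℝ) →ₗ[ℝ] ℝ) (lam Lam : ℝ) : Prop where
  continuousOn : ∀ P Q : E → (E →L[ℝ] ℝ), Continuous P → Continuous Q →
    ContinuousOn (fun x => B x (P x) (Q x)) (ball 0 1)
  lower : ∀ x ∈ ball (0 : E) 1, ∀ p, lam * ‖p‖ ^ 2 ≤ B x p p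
  upper : ∀ x ∈ ball (0 : E) 1, ∀ p q, |B x p q| ≤ Lam * ‖p‖ * ‖q‖

lemma fderiv_eq_zero_of_notMem_tsupport {η : E → ℝ} {x : E} (hx : x ∉ tsupport η) :
    fderiv ℝ η x = 0 := by
  by_contra h
  exact hx (support_fderiv_subset ℝ h)

lemma EllipticField.continuousOn_apply {B : E → (E →L[ℝ] ℝ) →ₗ[ℝ] (E →L[ℝ] ℝ) →ₗ[ℝ] ℝ} {lam Lam : ℝ}
    (hB : EllipticField B lam Lam) {K : Set E}
    (hK : K ⊆ ball 0 1) {P Q : E → (E →L[ℝ] ℝ)} (hP : Continuous P) (hQ : Continuous Q) :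
    ContinuousOn (fun x => B x (P x) (Q x)) K :=
  (hB.continuousOn P Q hP hQ).mono hK

variable [MeasurableSpace E] [BorelSpace E]

/-- `s` is a weak supersolution of `div (B ∇ s) = 0` in the unit ball. -/
def IsWeakSupersolution (μ : Measure E) (B : E → (E →L[ℝ] ℝ) →ₗ[ℝ] (E →L[ℝ] ℝ) →ₗ[ℝ] ℝ)
    (s : E → ℝ) : Prop :=
  ∀ ψ : E → ℝ, ContDiff ℝ 1 ψ → HasCompactSupport ψ → tsupport ψ ⊆ ball 0 1 → (∀ x, 0 ≤ ψ x) →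
    0 ≤ ∫ x, B x (fderiv ℝ s x) (fderiv ℝ ψ x) ∂μ

/-- `div (B ∇ v) ≥ B(∇ v, ∇ v)` weakly in the unit ball. -/
def IsLogSubsolution (μ : Measure E) (B : E → (E →L[ℝ] ℝ) →ₗ[ℝ] (E →L[ℝ] ℝ) →ₗ[ℝ] ℝ)
    (v : E → ℝ) : Prop :=
  ∀ ψ : E → ℝ, ContDiff ℝ 1 ψ → HasCompactSupport ψ → tsupport ψ ⊆ ball 0 1 → (∀ x, 0 ≤ ψ x) →
    ∫ x, (B x (fderiv ℝ v x) (fderiv ℝ ψ x) + ψ x * B x (fderiv ℝ v x) (fderiv ℝ v x)) ∂μ ≤ 0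

variable {μ : Measure E} [IsFiniteMeasureOnCompacts μ]
  {B : E → (E →L[ℝ] ℝ) →ₗ[ℝ] (E →L[ℝ] ℝ) →ₗ[ℝ] ℝ} {lam Lam : ℝ}

lemma isLogSubsolution_log (hB : EllipticField B lam Lam) (hlam : 0 ≤ lam) {s : E → ℝ}
    (hs : ContDiff ℝ 1 s) (hpos : ∀ x, 0 < s x) (hsuper : IsWeakSupersolution μ B s) :
    IsLogSubsolution μ B (fun x => Real.log (1 + s x) - Real.log (s x)) := by
  intro ψ hψ hψc hψs hψ0
  set h : E → ℝ := fun x => (s x * (1 + s x))⁻¹ with hh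
  have hne : ∀ x, s x * (1 + s x) ≠ 0 := fun x => by have := hpos x; positivity
  have hhC : ContDiff ℝ 1 h := (hs.mul (contDiff_const.add hs)).inv hne
  have hsd : ∀ x, HasFDerivAt s (fderiv ℝ s x) x := fun x =>
    (hs.differentiable (by norm_num) x).hasFDerivAt
  have hψd : ∀ x, HasFDerivAt ψ (fderiv ℝ ψ x) x := fun x =>
    (hψ.differentiable (by norm_num) x).hasFDerivAt
  have hv : ∀ x, fderiv ℝ (fun x => Real.log (1 + s x) - Real.log (s x)) x
      = (-h x) • fderiv ℝ s x := by
    intro x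
    have hp := hpos x
    have h1 := ((hsd x).const_add 1).log (by positivity)
    have h2 := (hsd x).log hp.ne'
    have h3 : HasFDerivAt (fun x => Real.log (1 + s x) - Real.log (s x)) _ x := h1.sub h2
    rw [h3.fderiv, ← sub_smul]
    congr 1
    simp only [hh]
    field_simp
    ring
  have hhψ : ∀ x, fderiv ℝ (fun x => h x * ψ x) x
      = h x • fderiv ℝ ψ x - (ψ x * (1 + 2 * s x) * h x ^ 2) • fderiv ℝ s x := by
    intro x
    have hp := hpos x
    have h1 := (hsd x).mul ((hsd x).const_add 1)
    have h2 := (hasDerivAt_inv (hne x)).comp_hasFDerivAt x h1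
    have h3 : HasFDerivAt (fun x => h x * ψ x) _ x := h2.mul (hψd x)
    rw [h3.fderiv]
    ext y
    simp only [Function.comp, add_apply, sub_apply,
      smul_apply, smul_eq_mul, hh, Pi.mul_apply]
    field_simp
    ring
  have key := hsuper (fun x => h x * ψ x) (hhC.mul hψ) hψc.mul_left
    ((closure_mono (Function.support_mul_subset_right _ _)).trans hψs)
    (fun x => mul_nonneg (by have := hpos x; simp only [hh]; positivity) (hψ0 x))
  have hsc := hs.continuous_fderiv (by norm_num)
  have hψc' := hψ.continuous_fderiv (by norm_num)
  have I1 : Integrable (fun x => B x (fderiv ℝ s x) (fderiv ℝ (fun x => h x * ψ x) x)) μ := by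
    refine integrable_of_continuousOn_of_eq_zero μ hψc.isCompact
      (hB.continuousOn_apply hψs hsc ((hhC.mul hψ).continuous_fderiv (by norm_num)))
      fun x hx => ?_
    rw [hhψ, fderiv_eq_zero_of_notMem_tsupport hx, image_eq_zero_of_notMem_tsupport hx]
    simp
  have I2 : Integrable (fun x => h x * B x (fderiv ℝ s x) (fderiv ℝ ψ x)
      - ψ x * h x ^ 2 * B x (fderiv ℝ s x) (fderiv ℝ s x)) μ := by
    refine integrable_of_continuousOn_of_eq_zero μ hψc.isCompact
      ((hhC.continuous.continuousOn.mul (hB.continuousOn_apply hψs hsc hψc')).sub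
        ((hψ.continuous.mul (hhC.continuous.pow 2)).continuousOn.mul
          (hB.continuousOn_apply hψs hsc hsc)))
      fun x hx => ?_
    rw [fderiv_eq_zero_of_notMem_tsupport hx, image_eq_zero_of_notMem_tsupport hx]
    simp
  have hle := integral_mono I1 I2 fun x => by
    simp only [hhψ, map_sub, map_smul, smul_eq_mul]
    by_cases hx : x ∈ tsupport ψ
    · have hb : 0 ≤ B x (fderiv ℝ s x) (fderiv ℝ s x) :=
        le_trans (by positivity) (hB.lower x (hψs hx) _)
      have : 0 ≤ ψ x * (2 * s x) * h x ^ 2 * B x (fderiv ℝ s x) (fderiv ℝ s x) := by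
        have := hψ0 x
        have := (hpos x).le
        positivity
      linarith
    · rw [image_eq_zero_of_notMem_tsupport hx]
      simp
  have hfin : ∫ x, (B x (fderiv ℝ (fun x => Real.log (1 + s x) - Real.log (s x)) x) (fderiv ℝ ψ x)
      + ψ x * B x (fderiv ℝ (fun x => Real.log (1 + s x) - Real.log (s x)) x)
        (fderiv ℝ (fun x => Real.log (1 + s x) - Real.log (s x)) x)) ∂μ
      = -∫ x, (h x * B x (fderiv ℝ s x) (fderiv ℝ ψ x)
      - ψ x * h x ^ 2 * B x (fderiv ℝ s x) (fderiv ℝ s x)) ∂μ := by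
    rw [← integral_neg]
    congr 1
    ext x
    simp only [hv, map_smul, LinearMap.smul_apply, smul_eq_mul]
    ring
  rw [hfin]
  linarith

/-- The energy inequality obtained by testing with `η² φ(v)`. -/
lemma IsLogSubsolution.energy (hB : EllipticField B lam Lam) (hlam : 0 < lam) {v : E → ℝ}
    (hv : ContDiff ℝ 1 v) (hpos : ∀ x, 0 < v x) (hsub : IsLogSubsolution μ B v)
    {φ φ' : ℝ → ℝ} (hφd : ∀ t, 0 < t → HasDerivAt φ (φ' t) t) (hφ'c : ContinuousOn φ' (Ioi 0))
    (hφ0 : ∀ t, 0 < t → 0 ≤ φ t) (hφ'0 : ∀ t, 0 < t → 0 ≤ φ' t) {θ : ℝ → ℝ}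
    (hθc : ContinuousOn θ (Ioi 0)) (hθ0 : ∀ t, 0 < t → 0 ≤ θ t)
    (hθ : ∀ t, 0 < t → φ t ^ 2 ≤ θ t * (φ' t + φ t))
    {η : E → ℝ} (hη : ContDiff ℝ 1 η) (hηc : HasCompactSupport η) (hηs : tsupport η ⊆ ball 0 1) :
    ∫ x, η x ^ 2 * (φ' (v x) + φ (v x)) * ‖fderiv ℝ v x‖ ^ 2 ∂μ
      ≤ 4 * Lam ^ 2 / lam ^ 2 * ∫ x, θ (v x) * ‖fderiv ℝ η x‖ ^ 2 ∂μ := by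
  have hφC : ContDiffOn ℝ 1 φ (Ioi 0) := by
    rw [contDiffOn_one_iff_derivWithin (uniqueDiffOn_Ioi _)]
    refine ⟨fun t ht => (hφd t ht).differentiableAt.differentiableWithinAt, hφ'c.congr fun t ht => ?_⟩
    exact (hφd t ht).hasDerivWithinAt.derivWithin (uniqueDiffOn_Ioi _ t ht)
  have hφv : ContDiff ℝ 1 fun x => φ (v x) := by
    rw [← contDiffOn_univ]
    exact hφC.comp hv.contDiffOn fun x _ => hpos x
  have hφ'v : Continuous fun x => φ' (v x) := by
    rw [← continuousOn_univ]
    exact hφ'c.comp hv.continuous.continuousOn fun x _ => hpos x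
  have hθv : Continuous fun x => θ (v x) := by
    rw [← continuousOn_univ]
    exact hθc.comp hv.continuous.continuousOn fun x _ => hpos x
  have hηv := hη.continuous
  have hvc := hv.continuous_fderiv (by norm_num)
  have hηc' := hη.continuous_fderiv (by norm_num)
  have hd : ∀ x, fderiv ℝ (fun x => η x ^ 2 * φ (v x)) x
      = (2 * η x * φ (v x)) • fderiv ℝ η x + (η x ^ 2 * φ' (v x)) • fderiv ℝ v x := by
    intro x
    have h1 := (hη.differentiable (by norm_num) x).hasFDerivAt
    have h2 := (hφd _ (hpos x)).comp_hasFDerivAt x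
      (hv.differentiable (by norm_num) x).hasFDerivAt
    have h3 : HasFDerivAt (fun x => η x ^ 2 * φ (v x)) _ x := (h1.pow 2).mul h2
    rw [h3.fderiv]
    ext y
    simp
    ring
  have hsupp : tsupport (fun x => η x ^ 2 * φ (v x)) ⊆ tsupport η := by
    refine closure_mono fun x hx h0 => hx ?_
    simp [h0]
  have key := hsub (fun x => η x ^ 2 * φ (v x)) ((hη.pow 2).mul hφv)
    (hηc.mono' (subset_closure.trans hsupp)) (hsupp.trans hηs)
    (fun x => mul_nonneg (sq_nonneg _) (hφ0 _ (hpos x)))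
  have hz : ∀ x, x ∉ tsupport η → η x = 0 ∧ fderiv ℝ η x = 0 := fun x hx =>
    ⟨image_eq_zero_of_notMem_tsupport hx, fderiv_eq_zero_of_notMem_tsupport hx⟩
  have I0 : Integrable (fun x => η x ^ 2 * (φ' (v x) + φ (v x)) * ‖fderiv ℝ v x‖ ^ 2) μ := by
    refine integrable_of_continuousOn_of_eq_zero μ hηc.isCompact (Continuous.continuousOn ?_)
      fun x hx => ?_
    · exact ((hηv.pow 2).mul (hφ'v.add hφv.continuous)).mul (hvc.norm.pow 2)
    · simp [(hz x hx).1]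
  have I1 : Integrable (fun x => θ (v x) * ‖fderiv ℝ η x‖ ^ 2) μ := by
    refine integrable_of_continuousOn_of_eq_zero μ hηc.isCompact (Continuous.continuousOn ?_)
      fun x hx => ?_
    · exact hθv.mul (hηc'.norm.pow 2)
    · simp [(hz x hx).2]
  have I2 : Integrable (fun x => B x (fderiv ℝ v x) (fderiv ℝ (fun x => η x ^ 2 * φ (v x)) x)
      + η x ^ 2 * φ (v x) * B x (fderiv ℝ v x) (fderiv ℝ v x)) μ := by
    refine integrable_of_continuousOn_of_eq_zero μ hηc.isCompact
      ((hB.continuousOn_apply hηs hvc (((hη.pow 2).mul hφv).continuous_fderiv (by norm_num))).add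
        (((hηv.pow 2).mul hφv.continuous).continuousOn.mul (hB.continuousOn_apply hηs hvc hvc)))
      fun x hx => ?_
    rw [hd, (hz x hx).1, (hz x hx).2]
    simp
  have hle := integral_mono ((I0.const_mul (lam / 2)).sub (I1.const_mul (2 * Lam ^ 2 / lam))) I2
    fun x => by
      simp only [hd, Pi.sub_apply, map_add, map_smul, smul_eq_mul]
      by_cases hx : x ∈ tsupport η
      · have hb := hB.lower x (hηs hx) (fderiv ℝ v x)
        have hb' := hB.upper x (hηs hx) (fderiv ℝ v x) (fderiv ℝ η x)
        have hφ := hφ0 _ (hpos x)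
        have hφ' := hφ'0 _ (hpos x)
        have hθ' := hθ _ (hpos x)
        have ht := hθ0 _ (hpos x)
        generalize B x (fderiv ℝ v x) (fderiv ℝ v x) = b at *
        generalize B x (fderiv ℝ v x) (fderiv ℝ η x) = c at *
        generalize ‖fderiv ℝ v x‖ = P at *
        generalize ‖fderiv ℝ η x‖ = Q at *
        generalize φ (v x) = f at *
        generalize φ' (v x) = f' at *
        generalize θ (v x) = t at *
        generalize η x = e at *
        have hff : 0 ≤ f' + f := add_nonneg hφ' hφ
        have e1 : lam * (e ^ 2 * (f' + f)) * P ^ 2 ≤ e ^ 2 * (f' + f) * b := by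
          nlinarith [mul_le_mul_of_nonneg_left hb (mul_nonneg (sq_nonneg e) hff)]
        have e2 : |2 * e * f * c| ≤ 2 * (|e| * f * (Lam * P * Q)) := by
          rw [abs_mul, abs_mul, abs_mul, abs_two, abs_of_nonneg hφ]
          nlinarith [mul_le_mul_of_nonneg_left hb' (mul_nonneg (abs_nonneg e) hφ)]
        have e3 := neg_le_of_abs_le e2
        have e4 : 2 * (|e| * f * (Lam * P * Q))
            ≤ lam / 2 * (e ^ 2 * (f' + f) * P ^ 2) + 2 * Lam ^ 2 / lam * (t * Q ^ 2) := by
          set X := lam / 2 * (e ^ 2 * (f' + f) * P ^ 2) with hX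
          set Y := 2 * Lam ^ 2 / lam * (t * Q ^ 2) with hY
          have hX0 : 0 ≤ X := by positivity
          have hY0 : 0 ≤ Y := by positivity
          have hXY : (2 * (|e| * f * (Lam * P * Q))) ^ 2 ≤ 4 * (X * Y) := by
            have : 4 * (X * Y) = 4 * Lam ^ 2 * e ^ 2 * P ^ 2 * Q ^ 2 * (t * (f' + f)) := by
              rw [hX, hY]; field_simp
            rw [this]
            calc (2 * (|e| * f * (Lam * P * Q))) ^ 2
                = 4 * Lam ^ 2 * |e| ^ 2 * P ^ 2 * Q ^ 2 * f ^ 2 := by ring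
              _ = 4 * Lam ^ 2 * e ^ 2 * P ^ 2 * Q ^ 2 * f ^ 2 := by rw [sq_abs]
              _ ≤ _ := by gcongr
          refine (le_abs_self _).trans (abs_le_of_sq_le_sq ?_ (by positivity))
          nlinarith [sq_nonneg (X - Y)]
        linarith
      · simp [(hz x hx).1, (hz x hx).2]
  have h3 : (lam / 2) * (∫ x, η x ^ 2 * (φ' (v x) + φ (v x)) * ‖fderiv ℝ v x‖ ^ 2 ∂μ)
      - (2 * Lam ^ 2 / lam) * (∫ x, θ (v x) * ‖fderiv ℝ η x‖ ^ 2 ∂μ) ≤ 0 := by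
    rw [← integral_const_mul, ← integral_const_mul, ← integral_sub (I0.const_mul _) (I1.const_mul _)]
    exact hle.trans key
  have h4 : 4 * Lam ^ 2 / lam ^ 2 * (∫ x, θ (v x) * ‖fderiv ℝ η x‖ ^ 2 ∂μ)
      = (2 / lam) * ((2 * Lam ^ 2 / lam) * ∫ x, θ (v x) * ‖fderiv ℝ η x‖ ^ 2 ∂μ) := by
    field_simp; ring
  rw [h4]
  have h5 : (∫ x, η x ^ 2 * (φ' (v x) + φ (v x)) * ‖fderiv ℝ v x‖ ^ 2 ∂μ) = (2 / lam) *
      ((lam / 2) * (∫ x, η x ^ 2 * (φ' (v x) + φ (v x)) * ‖fderiv ℝ v x‖ ^ 2 ∂μ)) := by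
    field_simp
  rw [h5]
  exact mul_le_mul_of_nonneg_left (by linarith) (by positivity)

end WeakSupersolutions

section MoserIteration

variable {E : Type*} [NormedAddCommGroup E] [NormedSpace ℝ E] [FiniteDimensional ℝ E]
  [MeasurableSpace E] [BorelSpace E]

/-- The Gagliardo–Nirenberg–Sobolev inequality in terms of Bochner integrals. -/
lemma exists_integral_rpow_le (μ : Measure E) [μ.IsAddHaarMeasure] {κ : ℝ}
    (hκ : Real.HolderConjugate (Module.finrank ℝ E) κ) :
    ∃ K : ℝ, 0 < K ∧ ∀ F : E → ℝ, ContDiff ℝ 1 F → HasCompactSupport F →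
      ∫ x, |F x| ^ κ ∂μ ≤ K * (∫ x, ‖fderiv ℝ F x‖ ∂μ) ^ κ := by
  refine ⟨lintegralPowLePowLIntegralFDerivConst μ κ + 1, by positivity, fun F hF hFc => ?_⟩
  have hκ0 : 0 < κ := hκ.symm.pos
  have h := lintegral_pow_le_pow_lintegral_fderiv μ hF hFc hκ
  have hI : Integrable (fderiv ℝ F) μ :=
    (hF.continuous_fderiv (by norm_num)).integrable_of_hasCompactSupport (hFc.fderiv ℝ)
  have hn : 0 ≤ ∫ x, ‖fderiv ℝ F x‖ ∂μ := integral_nonneg fun _ => norm_nonneg _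
  rw [← ofReal_integral_norm_eq_lintegral_enorm hI, ENNReal.ofReal_rpow_of_nonneg hn hκ0.le] at h
  rw [integral_eq_lintegral_of_nonneg_ae (Filter.Eventually.of_forall fun x => by positivity)
    (hF.continuous.abs.rpow_const fun _ => Or.inr hκ0.le).aestronglyMeasurable]
  have h2 : (∫⁻ x, ENNReal.ofReal (|F x| ^ κ) ∂μ) = ∫⁻ x, ‖F x‖ₑ ^ κ ∂μ := by
    congr 1
    ext x
    rw [← ENNReal.ofReal_rpow_of_nonneg (abs_nonneg _) hκ0.le, Real.enorm_eq_ofReal_abs]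
  rw [h2]
  refine (ENNReal.toReal_mono (by finiteness) h).trans ?_
  rw [ENNReal.toReal_mul, ENNReal.toReal_ofReal (by positivity), ENNReal.coe_toReal]
  gcongr
  linarith

variable [InnerProductSpace ℂ E]

/-- One step of Moser's iteration. -/
lemma exists_moser_step (μ : Measure E) [μ.IsAddHaarMeasure] {κ : ℝ}
    (hκ : Real.HolderConjugate (Module.finrank ℝ E) κ) {lam : ℝ} (hlam : 0 < lam) (Lam : ℝ) :
    ∃ K : ℝ, 0 < K ∧ ∀ (B : E → (E →L[ℝ] ℝ) →ₗ[ℝ] (E →L[ℝ] ℝ) →ₗ[ℝ] ℝ),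
      EllipticField B lam Lam → ∀ v : E → ℝ, ContDiff ℝ 1 v → (∀ x, 0 < v x) →
      IsLogSubsolution μ B v → ∀ q r ρ : ℝ, 2 ≤ q → 0 < r → r < ρ → ρ < 1 →
      ∫ x in closedBall 0 r, v x ^ (q * κ) ∂μ
        ≤ (K * (q / (ρ - r) ^ 2) * ∫ x in closedBall 0 ρ, v x ^ q ∂μ) ^ κ := by
  obtain ⟨K, hK, hgns⟩ := exists_integral_rpow_le μ hκ
  obtain ⟨C, hC, hcut⟩ := exists_cutoff (E := E)
  have hκ1 : 1 < κ := hκ.symm.lt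
  have hκ0 : 0 < κ := hκ.symm.pos
  set A0 := 4 * Lam ^ 2 / lam ^ 2 with hA0
  have hA0' : 0 ≤ A0 := by positivity
  refine ⟨K ^ κ⁻¹ * (C ^ 2 * (2 + A0)), by positivity, ?_⟩
  intro B hB v hv hpos hsub q r ρ hq hr hrρ hρ
  obtain ⟨η, hη, hη0, hη1, hηr, hηs, hηd⟩ := hcut r ρ hr hrρ
  set A := C / (ρ - r) with hA
  have hρr : 0 < ρ - r := by linarith
  have hA1 : 1 ≤ A := by rw [hA, le_div_iff₀ hρr]; linarith
  have hηc : HasCompactSupport η := (isCompact_closedBall (0 : E) ρ).of_isClosed_subset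
    (isClosed_tsupport _) hηs
  have hen := hsub.energy hB hlam hv hpos (φ := fun t => t ^ (q - 1))
    (φ' := fun t => (q - 1) * t ^ (q - 2)) (θ := fun t => t ^ q)
    (fun t ht => by
      convert Real.hasDerivAt_rpow_const (x := t) (p := q - 1) (Or.inl ht.ne') using 1
      ring_nf)
    (continuousOn_const.mul fun t ht =>
      (Real.continuousAt_rpow_const _ _ (Or.inl ht.ne')).continuousWithinAt)
    (fun t ht => by positivity)
    (fun t ht => mul_nonneg (by linarith) (by positivity))
    (fun t ht => (Real.continuousAt_rpow_const _ _ (Or.inl ht.ne')).continuousWithinAt)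
    (fun t ht => by positivity)
    (fun t ht => by
      have e1 : (t ^ (q - 1)) ^ 2 = t ^ q * t ^ (q - 2) := by
        rw [← Real.rpow_natCast, ← Real.rpow_mul ht.le, ← Real.rpow_add ht]
        congr 1; push_cast; ring
      rw [e1]
      have : 0 < t ^ (q - 2) := by positivity
      have : 0 < t ^ (q - 1) := by positivity
      gcongr
      nlinarith)
    hη hηc (hηs.trans (closedBall_subset_ball hρ))
  have hvr : ∀ s : ℝ, Continuous fun x => v x ^ s := fun s =>
    hv.continuous.rpow_const fun x => Or.inl (hpos x).ne'
  have hvc := hv.continuous_fderiv (by norm_num)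
  have hηc' := hη.continuous_fderiv (by norm_num)
  have hz : ∀ x, x ∉ closedBall (0 : E) ρ → η x = 0 ∧ fderiv ℝ η x = 0 := fun x hx =>
    ⟨image_eq_zero_of_notMem_tsupport fun h => hx (hηs h),
      fderiv_eq_zero_of_notMem_tsupport fun h => hx (hηs h)⟩
  set Y := ∫ x in closedBall 0 ρ, v x ^ q ∂μ with hY
  have hYI : IntegrableOn (fun x => v x ^ q) (closedBall 0 ρ) μ :=
    (hvr q).continuousOn.integrableOn_compact (isCompact_closedBall _ _)
  have hintg : ∀ G : E → ℝ, Continuous G → (∀ x, x ∉ closedBall (0 : E) ρ → G x = 0) →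
      Integrable G μ := fun G hG h0 =>
    integrable_of_continuousOn_of_eq_zero μ (isCompact_closedBall (0 : E) ρ) hG.continuousOn h0
  have hset : ∀ G : E → ℝ, (∀ x, x ∉ closedBall (0 : E) ρ → G x = 0) →
      ∫ x, G x ∂μ = ∫ x in closedBall 0 ρ, G x ∂μ := fun G h0 =>
    (setIntegral_eq_integral_of_forall_compl_eq_zero h0).symm
  have hY0 : 0 ≤ Y := integral_nonneg fun x => by have := hpos x; positivity
  -- the right-hand side of the energy inequality
  have hR : ∫ x, v x ^ q * ‖fderiv ℝ η x‖ ^ 2 ∂μ ≤ A ^ 2 * Y := by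
    rw [hset _ fun x hx => by simp [(hz x hx).2], hY, ← integral_const_mul]
    refine setIntegral_mono (hintg _ ((hvr q).mul (hηc'.norm.pow 2))
      fun x hx => by simp [(hz x hx).2]).integrableOn (hYI.const_mul _) fun x => ?_
    have := hpos x
    have := hηd x
    dsimp only
    rw [mul_comm]
    gcongr
  have hL : ∫ x, η x ^ 2 * (v x ^ (q - 2) * ‖fderiv ℝ v x‖ ^ 2) ∂μ ≤ A0 * (A ^ 2 * Y) := by
    refine le_trans ?_ (hen.trans (mul_le_mul_of_nonneg_left hR hA0'))
    refine integral_mono (hintg _ ((hη.continuous.pow 2).mul ((hvr _).mul (hvc.norm.pow 2)))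
      fun x hx => by simp [(hz x hx).1]) (hintg _ (((hη.continuous.pow 2).mul
        ((continuous_const.mul (hvr _)).add (hvr _))).mul (hvc.norm.pow 2))
        fun x hx => by simp [(hz x hx).1]) fun x => ?_
    dsimp only
    have hp := hpos x
    have : 0 < v x ^ (q - 2) := by positivity
    have : 0 < v x ^ (q - 1) := by positivity
    rw [← mul_assoc]
    gcongr
    nlinarith
  -- the Sobolev inequality
  set F : E → ℝ := fun x => η x ^ 2 * v x ^ q with hF
  have hFC : ContDiff ℝ 1 F := (hη.pow 2).mul (hv.rpow_const_of_ne fun x => (hpos x).ne')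
  have hFd : ∀ x, fderiv ℝ F x = (2 * η x * v x ^ q) • fderiv ℝ η x
      + (q * η x ^ 2 * v x ^ (q - 1)) • fderiv ℝ v x := by
    intro x
    have h1 := (hη.differentiable (by norm_num) x).hasFDerivAt
    have h2 := (Real.hasDerivAt_rpow_const (p := q) (Or.inl (hpos x).ne')).comp_hasFDerivAt x
      (hv.differentiable (by norm_num) x).hasFDerivAt
    have h3 : HasFDerivAt F _ x := (h1.pow 2).mul h2
    rw [h3.fderiv]
    ext y
    simp
    ring
  have hFn : ∀ x, ‖fderiv ℝ F x‖ ≤ (2 * A + q / 2) * (closedBall (0 : E) ρ).indicator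
      (fun x => v x ^ q) x + q / 2 * (η x ^ 2 * (v x ^ (q - 2) * ‖fderiv ℝ v x‖ ^ 2)) := by
    intro x
    rw [hFd]
    by_cases hx : x ∈ closedBall (0 : E) ρ
    · rw [indicator_of_mem hx]
      have hp := hpos x
      have hvq : 0 < v x ^ q := by positivity
      have e1 : v x ^ (q - 1) * ‖fderiv ℝ v x‖
          ≤ 1 / 2 * (v x ^ q + v x ^ (q - 2) * ‖fderiv ℝ v x‖ ^ 2) := by
        have a1 : v x ^ q = v x ^ (q - 2) * v x ^ 2 := by
          rw [← Real.rpow_natCast, ← Real.rpow_add hp]; congr 1; push_cast; ring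
        have a2 : v x ^ (q - 1) = v x ^ (q - 2) * v x := by
          rw [← Real.rpow_add_one hp.ne']; congr 1; ring
        have a3 : 0 < v x ^ (q - 2) := by positivity
        rw [a1, a2]
        nlinarith [mul_nonneg a3.le (sq_nonneg (v x - ‖fderiv ℝ v x‖))]
      have e2 := hηd x
      have e3 := hη0 x
      have e4 := hη1 x
      calc _ ≤ 2 * η x * v x ^ q * ‖fderiv ℝ η x‖
            + q * η x ^ 2 * v x ^ (q - 1) * ‖fderiv ℝ v x‖ := by
            refine (norm_add_le _ _).trans (add_le_add ?_ ?_) <;>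
            rw [norm_smul, Real.norm_of_nonneg (by positivity)]
        _ = 2 * η x * v x ^ q * ‖fderiv ℝ η x‖
            + q * η x ^ 2 * (v x ^ (q - 1) * ‖fderiv ℝ v x‖) := by ring
        _ ≤ 2 * 1 * v x ^ q * A + q * η x ^ 2 *
            (1 / 2 * (v x ^ q + v x ^ (q - 2) * ‖fderiv ℝ v x‖ ^ 2)) := by gcongr
        _ = 2 * A * v x ^ q + q / 2 * (η x ^ 2 * v x ^ q)
            + q / 2 * (η x ^ 2 * (v x ^ (q - 2) * ‖fderiv ℝ v x‖ ^ 2)) := by ring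
        _ ≤ 2 * A * v x ^ q + q / 2 * (1 ^ 2 * v x ^ q)
            + q / 2 * (η x ^ 2 * (v x ^ (q - 2) * ‖fderiv ℝ v x‖ ^ 2)) := by gcongr
        _ = _ := by ring
    · simp [(hz x hx).1, hx]
  have hFI : ∫ x, ‖fderiv ℝ F x‖ ∂μ ≤ q * A ^ 2 * (2 + A0) * Y := by
    have hi1 : Integrable ((closedBall (0 : E) ρ).indicator (fun x => v x ^ q)) μ :=
      hYI.integrable_indicator measurableSet_closedBall
    have hi2 : Integrable (fun x => η x ^ 2 * (v x ^ (q - 2) * ‖fderiv ℝ v x‖ ^ 2)) μ :=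
      hintg _ ((hη.continuous.pow 2).mul ((hvr _).mul (hvc.norm.pow 2)))
        fun x hx => by simp [(hz x hx).1]
    have hi3 : Integrable (fun x => ‖fderiv ℝ F x‖) μ :=
      hintg _ (hFC.continuous_fderiv (by norm_num)).norm fun x hx => by
        rw [hFd]; simp [(hz x hx).1]
    calc _ ≤ _ := integral_mono hi3 ((hi1.const_mul (2 * A + q / 2)).add (hi2.const_mul (q / 2)))
            fun x => hFn x
      _ = (2 * A + q / 2) * Y
          + q / 2 * ∫ x, η x ^ 2 * (v x ^ (q - 2) * ‖fderiv ℝ v x‖ ^ 2) ∂μ := by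
          rw [integral_add' (hi1.const_mul _) (hi2.const_mul _), integral_const_mul,
            integral_const_mul, integral_indicator measurableSet_closedBall]
      _ ≤ (2 * A + q / 2) * Y + q / 2 * (A0 * (A ^ 2 * Y)) := by gcongr
      _ = (2 * A + q / 2 + q / 2 * A0 * A ^ 2) * Y := by ring
      _ ≤ q * A ^ 2 * (2 + A0) * Y := by
          gcongr
          have h1 : A ≤ A ^ 2 := by nlinarith
          have h2 : 2 * A ≤ q * A ^ 2 := by nlinarith
          have h3 : q / 2 ≤ q * A ^ 2 := by nlinarith
          have h4 : 0 ≤ q * A ^ 2 * A0 := by positivity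
          nlinarith
  have hFc : HasCompactSupport F :=
    HasCompactSupport.of_support_subset_isCompact (isCompact_closedBall (0 : E) ρ) fun x hx => by
      by_contra h
      exact hx (by simp [hF, (hz x h).1])
  have hfin := (hgns F hFC hFc).trans (mul_le_mul_of_nonneg_left
    (Real.rpow_le_rpow (integral_nonneg fun _ => norm_nonneg _) hFI hκ0.le) hK.le)
  have hF0 : ∀ x, 0 ≤ F x := fun x => by have := hpos x; positivity
  have hFr : ∫ x in closedBall 0 r, v x ^ (q * κ) ∂μ ≤ ∫ x, |F x| ^ κ ∂μ := by
    have hI : Integrable (fun x => |F x| ^ κ) μ :=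
      hintg _ (hFC.continuous.abs.rpow_const fun _ => Or.inr hκ0.le) fun x hx => by
        simp [hF, (hz x hx).1, hκ0.ne']
    refine le_trans (le_of_eq ?_) (setIntegral_le_integral (s := closedBall 0 r) hI
      (Filter.Eventually.of_forall fun x => by positivity))
    refine setIntegral_congr_fun measurableSet_closedBall fun x hx => ?_
    simp only [hF, hηr x hx]
    rw [one_pow, one_mul, abs_of_pos (by have := hpos x; positivity), ← Real.rpow_mul (hpos x).le]
  refine (hFr.trans hfin).trans (le_of_eq ?_)
  have : K = (K ^ κ⁻¹) ^ κ := by rw [← Real.rpow_mul hK.le, inv_mul_cancel₀ hκ0.ne', Real.rpow_one]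
  nth_rewrite 1 [this]
  rw [← Real.mul_rpow (by positivity) (by positivity)]
  congr 1
  rw [hA]
  field_simp

/-- The nonlinear recursion behind Moser's iteration. -/
lemma exists_recursion_bound {κ N D b : ℝ} (hκ : 1 < κ) (hN : (κ - 1) * N = κ) (hD : 0 < D)
    (hb : 1 ≤ b) : ∃ β : ℝ, 0 < β ∧ ∀ Y : ℕ → ℝ, (∀ j, 0 ≤ Y j) →
      (∀ j, Y (j + 1) ≤ (D * b ^ j * Y j) ^ κ) → ∀ j : ℕ, Y j ≤ β * (Y 0 / β) ^ (κ ^ j) := by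
  have hκ1 : 0 < κ - 1 := by linarith
  have hN0 : 0 < N := by
    by_contra h
    nlinarith
  have hb0 : 0 < b := by linarith
  set β : ℝ := (b ^ (-N) * D ^ (-κ)) ^ (κ - 1)⁻¹ with hβ
  have hβ0 : 0 < β := by positivity
  have hβκ : D ^ κ * β ^ κ = β * b ^ (-N) := by
    have h1 : β ^ (κ - 1) = b ^ (-N) * D ^ (-κ) := by
      rw [hβ, ← Real.rpow_mul (by positivity), inv_mul_cancel₀ hκ1.ne', Real.rpow_one]
    have h2 : β ^ κ = β * β ^ (κ - 1) := by
      rw [mul_comm, ← Real.rpow_add_one hβ0.ne']; congr 1; ring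
    rw [h2, h1, Real.rpow_neg hD.le]
    field_simp
  refine ⟨β, hβ0, fun Y hY hrec j => ?_⟩
  set H := Y 0 / β with hH
  have hH0 : 0 ≤ H := div_nonneg (hY 0) hβ0.le
  have key : ∀ j : ℕ, Y j ≤ β * b ^ (-(N * j)) * H ^ (κ ^ j) := by
    intro j
    induction j with
    | zero => simp [hH]; field_simp; rfl
    | succ j ih =>
      refine (hrec j).trans ?_
      calc (D * b ^ j * Y j) ^ κ
          ≤ (D * b ^ j * (β * b ^ (-(N * j)) * H ^ (κ ^ j))) ^ κ := by
            have := hY j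
            gcongr
        _ = D ^ κ * β ^ κ * (b ^ ((j : ℝ) * κ) * b ^ (-(N * j) * κ)) * H ^ (κ ^ j * κ) := by
            rw [Real.mul_rpow (by positivity) (by positivity),
              Real.mul_rpow (by positivity) (by positivity),
              Real.mul_rpow (by positivity) (by positivity),
              Real.mul_rpow (by positivity) (by positivity),
              ← Real.rpow_natCast, ← Real.rpow_mul hb0.le, ← Real.rpow_mul hb0.le,
              ← Real.rpow_mul hH0]
            ring
        _ = β * b ^ (-(N * ((j + 1 : ℕ) : ℝ))) * H ^ (κ ^ (j + 1)) := by
            rw [hβκ, ← Real.rpow_add hb0, mul_assoc β, ← Real.rpow_add hb0, pow_succ]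
            congr 3
            push_cast
            linear_combination -(j : ℝ) * hN
  refine (key j).trans ?_
  have : b ^ (-(N * j)) ≤ 1 := Real.rpow_le_one_of_one_le_of_nonpos hb (by
    have : 0 ≤ N * j := by positivity
    linarith)
  calc _ ≤ β * 1 * H ^ (κ ^ j) := by gcongr
    _ = _ := by ring

/-- Local boundedness of logarithmic subsolutions. -/
lemma exists_sq_le_integral (μ : Measure E) [μ.IsAddHaarMeasure]
    (hdim : 1 < Module.finrank ℝ E) {lam : ℝ} (hlam : 0 < lam) (Lam : ℝ) :
    ∃ C : ℝ, 0 < C ∧ ∀ (B : E → (E →L[ℝ] ℝ) →ₗ[ℝ] (E →L[ℝ] ℝ) →ₗ[ℝ] ℝ),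
      EllipticField B lam Lam → ∀ v : E → ℝ, ContDiff ℝ 1 v → (∀ x, 0 < v x) →
      IsLogSubsolution μ B v → ∀ x ∈ ball (0 : E) (1 / 2),
      v x ^ 2 ≤ C * ∫ y in closedBall 0 (3 / 4), v y ^ 2 ∂μ := by
  have hdim' : (1 : ℝ) < Module.finrank ℝ E := by exact_mod_cast hdim
  set κ : ℝ := Real.conjExponent (Module.finrank ℝ E) with hκdef
  have hκ : Real.HolderConjugate (Module.finrank ℝ E) κ := Real.HolderConjugate.conjExponent hdim'
  have hκ1 : 1 < κ := hκ.symm.lt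
  obtain ⟨K, hK, hstep⟩ := exists_moser_step μ hκ hlam Lam
  obtain ⟨β, hβ, hrec⟩ := exists_recursion_bound (N := Module.finrank ℝ E) (D := K * 128)
    (b := 4 * κ) hκ1 (by
      have := hκ.symm.sub_one_mul_conj
      linarith) (by positivity) (by linarith)
  refine ⟨1 / β, by positivity, fun B hB v hv hpos hsub x hx => ?_⟩
  set ρ : ℕ → ℝ := fun j => 1 / 2 + (1 / 2) ^ j / 4 with hρ
  set Y : ℕ → ℝ := fun j => ∫ y in closedBall 0 (ρ j), v y ^ (2 * κ ^ j) ∂μ with hY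
  have hY0 : ∀ j, 0 ≤ Y j := fun j => integral_nonneg fun y => by have := hpos y; positivity
  have hYrec : ∀ j, Y (j + 1) ≤ (K * 128 * (4 * κ) ^ j * Y j) ^ κ := by
    intro j
    have hp : (0 : ℝ) < (1 / 2) ^ j := by positivity
    have hp1 : ((1 : ℝ) / 2) ^ j ≤ 1 := pow_le_one₀ (by norm_num) (by norm_num)
    have hdiff : ρ j - ρ (j + 1) = (1 / 2) ^ j / 8 := by simp only [hρ, pow_succ]; ring
    have h := hstep B hB v hv hpos hsub (2 * κ ^ j) (ρ (j + 1)) (ρ j)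
      (by have := one_le_pow₀ hκ1.le (n := j); linarith)
      (by simp only [hρ]; positivity) (by linarith) (by simp only [hρ]; linarith)
    rw [hdiff] at h
    have e1 : 2 * κ ^ (j + 1) = 2 * κ ^ j * κ := by ring
    simp only [hY, e1]
    refine h.trans (le_of_eq ?_)
    congr 1
    have e2 : ((1 : ℝ) / 2) ^ j = (2 ^ j)⁻¹ := by simp
    have e3 : (4 : ℝ) ^ j = 2 ^ j * 2 ^ j := by rw [← mul_pow]; norm_num
    rw [e2, mul_pow, e3]
    field_simp
    ring
  have hbd := hrec Y hY0 hYrec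
  have hYzero : Y 0 = ∫ y in closedBall 0 (3 / 4), v y ^ 2 ∂μ := by
    simp only [hY, hρ, pow_zero, mul_one]
    norm_num
  rw [← hYzero]
  by_contra! hcon
  set H := Y 0 / β with hH
  have hH0 : 0 ≤ H := div_nonneg (hY0 0) hβ.le
  have hlt : H < v x ^ 2 := by rw [hH, div_eq_inv_mul, ← one_div]; exact hcon
  obtain ⟨L, hHL, hLv⟩ := exists_between hlt
  have hL0 : 0 < L := by linarith
  set S := {y | L < v y ^ 2} ∩ ball (0 : E) (1 / 2) with hS
  have hSo : IsOpen S := (isOpen_lt continuous_const (hv.continuous.pow 2)).inter isOpen_ball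
  have hSpos : 0 < μ S := hSo.measure_pos μ ⟨x, hLv, hx⟩
  have hSfin : μ S < ⊤ := (measure_mono inter_subset_right).trans_lt measure_ball_lt_top
  have hm : 0 < μ.real S := ENNReal.toReal_pos hSpos.ne' hSfin.ne
  have hlow : ∀ j : ℕ, μ.real S * L ^ (κ ^ j) ≤ β * H ^ (κ ^ j) := by
    intro j
    refine le_trans ?_ (hbd j)
    have hintg : IntegrableOn (fun y => v y ^ (2 * κ ^ j)) (closedBall 0 (ρ j)) μ :=
      (hv.continuous.rpow_const fun y => Or.inl (hpos y).ne').continuousOn.integrableOn_compact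
        (isCompact_closedBall _ _)
    have hsub' : S ⊆ closedBall 0 (ρ j) := inter_subset_right.trans
      ((ball_subset_ball (by simp only [hρ]; have : (0 : ℝ) < (1 / 2) ^ j := by positivity
                             linarith)).trans ball_subset_closedBall)
    calc μ.real S * L ^ (κ ^ j) = ∫ _ in S, L ^ (κ ^ j) ∂μ := by simp
      _ ≤ ∫ y in S, v y ^ (2 * κ ^ j) ∂μ := by
          refine setIntegral_mono_on (integrableOn_const hSfin.ne) (hintg.mono_set hsub')
            hSo.measurableSet fun y hy => ?_
          rw [Real.rpow_mul (hpos y).le]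
          have : L < v y ^ (2 : ℝ) := by exact_mod_cast hy.1
          gcongr
      _ ≤ Y j := setIntegral_mono_set hintg
          (Filter.Eventually.of_forall fun y => by have := hpos y; positivity)
          (Filter.Eventually.of_forall hsub')
  have hlim : Filter.Tendsto (fun j : ℕ => β * (H / L) ^ (κ ^ j)) Filter.atTop (nhds (β * 0)) := by
    refine Filter.Tendsto.const_mul _ ?_
    exact (tendsto_rpow_atTop_of_base_lt_one (H / L) (by have : 0 ≤ H / L := by positivity
                                                         linarith)
      ((div_lt_one hL0).2 hHL)).comp (tendsto_pow_atTop_atTop_of_one_lt hκ1)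
  have hle : μ.real S ≤ β * 0 := ge_of_tendsto' hlim fun j => by
    rw [Real.div_rpow hH0 hL0.le, ← mul_div_assoc, le_div_iff₀ (by positivity)]
    exact hlow j
  linarith

end MoserIteration

section PoincareInequality

variable {E : Type*} [NormedAddCommGroup E] [NormedSpace ℝ E] [FiniteDimensional ℝ E]
  [MeasurableSpace E] [BorelSpace E] (μ : Measure E) [μ.IsAddHaarMeasure]

lemma lintegral_comp_add_smul {g : E → ENNReal} (hg : Measurable g) (w : E) {t : ℝ} (ht : t ≠ 0) :
    ∫⁻ y, g (w + t • y) ∂μ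
      = ENNReal.ofReal |(t ^ Module.finrank ℝ E)⁻¹| * ∫⁻ y, g y ∂μ := by
  have h1 : ∫⁻ y, g (w + t • y) ∂μ = ∫⁻ y, g (w + y) ∂(Measure.map (t • ·) μ) :=
    (lintegral_map (f := fun y => g (w + y)) (hg.comp (measurable_const_add w))
      (measurable_const_smul t)).symm
  rw [h1, Measure.map_addHaar_smul μ ht, lintegral_smul_measure, smul_eq_mul,
    lintegral_add_left_eq_self]

lemma lintegral_lintegral_segment_le {g : E → ENNReal} (hg : Measurable g) (S : Set E) (t : ℝ) :
    ∫⁻ x in S, ∫⁻ y in S, g ((1 - t) • x + t • y) ∂μ ∂μ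
      ≤ ENNReal.ofReal (2 ^ Module.finrank ℝ E) * μ S * ∫⁻ y, g y ∂μ := by
  have hb : ∀ s : ℝ, 1 / 2 ≤ s → ENNReal.ofReal |(s ^ Module.finrank ℝ E)⁻¹|
      ≤ ENNReal.ofReal (2 ^ Module.finrank ℝ E) := fun s hs => by
    have hs0 : 0 < s := by linarith
    refine ENNReal.ofReal_le_ofReal ?_
    rw [abs_of_pos (by positivity), ← inv_pow]
    refine pow_le_pow_left₀ (by positivity) ?_ _
    rw [inv_le_comm₀ hs0 (by norm_num)]
    linarith
  have main : ∀ s : ℝ, 1 / 2 ≤ s → ∀ r : ℝ, ∫⁻ x in S, ∫⁻ y in S, g (r • x + s • y) ∂μ ∂μ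
      ≤ ENNReal.ofReal (2 ^ Module.finrank ℝ E) * μ S * ∫⁻ y, g y ∂μ := fun s hs r =>
    calc ∫⁻ x in S, ∫⁻ y in S, g (r • x + s • y) ∂μ ∂μ
        ≤ ∫⁻ _ in S, ENNReal.ofReal (2 ^ Module.finrank ℝ E) * ∫⁻ y, g y ∂μ ∂μ := by
          refine lintegral_mono fun x => (setLIntegral_le_lintegral _ _).trans ?_
          rw [lintegral_comp_add_smul μ hg _ (by linarith : s ≠ 0)]
          exact mul_le_mul_left (hb s hs) _
      _ = _ := by
          rw [lintegral_const, Measure.restrict_apply_univ]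
          ring
  rcases le_total (1 / 2) t with h | h
  · exact main t h _
  · have hm : Measurable (Function.uncurry fun x y : E => g ((1 - t) • x + t • y)) := by
      refine hg.comp ?_
      exact (measurable_fst.const_smul (1 - t)).add (measurable_snd.const_smul t)
    rw [lintegral_lintegral_swap hm.aemeasurable]
    simp_rw [add_comm ((1 - t) • _)]
    exact main (1 - t) (by linarith) _

/-- A Poincaré inequality on bounded convex sets. -/
lemma lintegral_lintegral_enorm_sub_le {S : Set E} (hS : Convex ℝ S) (hSm : MeasurableSet S)
    {R : ℝ} (hR : ∀ x ∈ S, ∀ y ∈ S, ‖y - x‖ ≤ R) {F : E → ℝ} (hF : ContDiff ℝ 1 F) :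
    ∫⁻ x in S, ∫⁻ y in S, ‖F y - F x‖ₑ ∂μ ∂μ ≤ ENNReal.ofReal R *
      (ENNReal.ofReal (2 ^ Module.finrank ℝ E) * μ S * ∫⁻ x in S, ‖fderiv ℝ F x‖ₑ ∂μ) := by
  set g : E → ENNReal := S.indicator fun x => ‖fderiv ℝ F x‖ₑ with hg
  have hF' := hF.continuous_fderiv (by norm_num)
  have hgm : Measurable g := (hF'.enorm.measurable).indicator hSm
  have hpt : ∀ x ∈ S, ∀ y ∈ S, ‖F y - F x‖ₑ
      ≤ ENNReal.ofReal R * ∫⁻ t in Ioc (0 : ℝ) 1, g ((1 - t) • x + t • y) := by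
    intro x hx y hy
    have hd : ∀ t : ℝ, HasDerivAt (fun t : ℝ => F (x + t • (y - x)))
        (fderiv ℝ F (x + t • (y - x)) (y - x)) t := fun t => by
      have h1 : HasDerivAt (fun t : ℝ => x + t • (y - x)) (y - x) t := by
        simpa using ((hasDerivAt_id t).smul_const (y - x)).const_add x
      exact (hF.differentiable (by norm_num) _).hasFDerivAt.comp_hasDerivAt t h1
    have hc : Continuous fun t : ℝ => fderiv ℝ F (x + t • (y - x)) (y - x) :=
      (hF'.comp (by fun_prop)).clm_apply continuous_const
    have hftc := intervalIntegral.integral_eq_sub_of_hasDerivAt (a := 0) (b := 1)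
      (fun t _ => hd t) (hc.intervalIntegrable _ _)
    have e1 : F y - F x = ∫ t in Ioc (0 : ℝ) 1, fderiv ℝ F (x + t • (y - x)) (y - x) := by
      rw [← intervalIntegral.integral_of_le zero_le_one, hftc]
      simp
    rw [e1]
    refine (enorm_integral_le_lintegral_enorm _).trans ?_
    rw [← lintegral_const_mul' _ _ ENNReal.ofReal_ne_top]
    refine setLIntegral_mono' measurableSet_Ioc fun t ht => ?_
    have e2 : x + t • (y - x) = (1 - t) • x + t • y := by module
    have hmem : (1 - t) • x + t • y ∈ S := hS hx hy (by linarith [ht.2]) ht.1.le (by ring)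
    rw [e2, hg, indicator_of_mem hmem, mul_comm]
    refine (ContinuousLinearMap.le_opENorm _ _).trans ?_
    gcongr
    rw [← ofReal_norm]
    exact ENNReal.ofReal_le_ofReal (hR x hx y hy)
  have hm3 : Measurable fun p : (E × E) × ℝ => g ((1 - p.2) • p.1.1 + p.2 • p.1.2) := by
    refine hgm.comp (Measurable.add ?_ ?_)
    · exact (measurable_const.sub measurable_snd).smul (measurable_fst.comp measurable_fst)
    · exact measurable_snd.smul (measurable_snd.comp measurable_fst)
  calc ∫⁻ x in S, ∫⁻ y in S, ‖F y - F x‖ₑ ∂μ ∂μ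
      ≤ ∫⁻ x in S, ∫⁻ y in S,
          (ENNReal.ofReal R * ∫⁻ t in Ioc (0 : ℝ) 1, g ((1 - t) • x + t • y)) ∂μ ∂μ :=
        setLIntegral_mono' hSm fun x hx => setLIntegral_mono' hSm fun y hy => hpt x hx y hy
    _ = ENNReal.ofReal R * ∫⁻ x in S, ∫⁻ y in S,
          (∫⁻ t in Ioc (0 : ℝ) 1, g ((1 - t) • x + t • y)) ∂μ ∂μ := by
        rw [← lintegral_const_mul' _ _ ENNReal.ofReal_ne_top]
        congr 1
        ext x
        rw [← lintegral_const_mul' _ _ ENNReal.ofReal_ne_top]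
    _ = ENNReal.ofReal R * ∫⁻ t in Ioc (0 : ℝ) 1,
          (∫⁻ x in S, ∫⁻ y in S, g ((1 - t) • x + t • y) ∂μ ∂μ) := by
        congr 1
        have hsw : ∀ x : E, ∫⁻ y in S, (∫⁻ t in Ioc (0 : ℝ) 1, g ((1 - t) • x + t • y)) ∂μ
            = ∫⁻ t in Ioc (0 : ℝ) 1, (∫⁻ y in S, g ((1 - t) • x + t • y) ∂μ) := fun x =>
          lintegral_lintegral_swap (hm3.comp (by fun_prop :
            Measurable fun p : E × ℝ => ((x, p.1), p.2))).aemeasurable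
        simp_rw [hsw]
        refine lintegral_lintegral_swap (Measurable.aemeasurable ?_)
        have h4 : Measurable fun q : (E × ℝ) × E => g ((1 - q.1.2) • q.1.1 + q.1.2 • q.2) :=
          hm3.comp (by fun_prop : Measurable fun q : (E × ℝ) × E => ((q.1.1, q.2), q.1.2))
        exact h4.lintegral_prod_right'
    _ ≤ ENNReal.ofReal R * ∫⁻ _ in Ioc (0 : ℝ) 1,
          (ENNReal.ofReal (2 ^ Module.finrank ℝ E) * μ S * ∫⁻ y, g y ∂μ) := by
        exact mul_le_mul_right (lintegral_mono fun t => lintegral_lintegral_segment_le μ hgm S t) _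
    _ = _ := by
        rw [lintegral_const, Measure.restrict_apply_univ, Real.volume_Ioc, hg,
          lintegral_indicator hSm]
        simp

/-- An `L²` bound for a function with square integrable gradient which is bounded on a set of
positive measure. -/
lemma exists_integral_sq_le_of_le_on {r μ₀ : ℝ} (hμ₀ : 0 < μ₀) (hr : 0 < r) (a C₁ : ℝ) :
    ∃ C : ℝ, ∀ v : E → ℝ, ContDiff ℝ 1 v → (∀ x, 0 ≤ v x) → ∀ Z : Set E, MeasurableSet Z →
      Z ⊆ closedBall 0 r → (∀ x ∈ Z, v x ≤ a) → μ₀ ≤ μ.real Z →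
      ∫ x in closedBall 0 r, ‖fderiv ℝ v x‖ ^ 2 ∂μ ≤ C₁ →
      ∫ x in closedBall 0 r, v x ^ 2 ∂μ ≤ C := by
  set S := closedBall (0 : E) r with hS
  have hSfin : μ S ≠ ⊤ := measure_closedBall_lt_top.ne
  set P : ℝ := 2 * r * (2 ^ Module.finrank ℝ E * μ.real S) with hP
  have hP0 : 0 ≤ P := by positivity
  refine ⟨2 * (a ^ 2 * μ.real S + 2 * P ^ 2 / μ₀ * C₁ / μ₀), fun v hv hv0 Z hZ hZS hZa hZμ hC₁ => ?_⟩
  set F : E → ℝ := fun x => v x ^ 2 with hFdef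
  have hF : ContDiff ℝ 1 F := hv.pow 2
  have hFd : ∀ x, fderiv ℝ F x = (2 * v x) • fderiv ℝ v x := fun x => by
    have h3 : HasFDerivAt F _ x := (hv.differentiable (by norm_num) x).hasFDerivAt.pow 2
    rw [h3.fderiv]
    ext y
    simp
  have hvc := hv.continuous_fderiv (by norm_num)
  have hcomp : IsCompact S := isCompact_closedBall _ _
  have hIF : IntegrableOn F S μ := hF.continuous.continuousOn.integrableOn_compact hcomp
  have hIF' : IntegrableOn (fun x => ‖fderiv ℝ F x‖) S μ :=
    (hF.continuous_fderiv (by norm_num)).norm.continuousOn.integrableOn_compact hcomp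
  have hIv' : IntegrableOn (fun x => ‖fderiv ℝ v x‖ ^ 2) S μ :=
    (hvc.norm.pow 2).continuousOn.integrableOn_compact hcomp
  have hP' := lintegral_lintegral_enorm_sub_le μ (S := S) (convex_closedBall (0 : E) r)
    measurableSet_closedBall (R := 2 * r) (fun x hx y hy => by
      rw [mem_closedBall_zero_iff] at hx hy
      linarith [norm_sub_le y x]) hF
  have hZfin : μ Z ≠ ⊤ := ((measure_mono hZS).trans_lt measure_closedBall_lt_top).ne
  have e1 : μ Z * ∫⁻ x in S, ‖F x‖ₑ ∂μ ≤ ENNReal.ofReal (a ^ 2) * μ Z * μ S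
      + ∫⁻ x in S, ∫⁻ y in S, ‖F y - F x‖ₑ ∂μ ∂μ := by
    have hmeas : Measurable fun y => ‖F y‖ₑ := hF.continuous.enorm.measurable
    calc μ Z * ∫⁻ y in S, ‖F y‖ₑ ∂μ = ∫⁻ x in Z, ∫⁻ y in S, ‖F y‖ₑ ∂μ ∂μ := by
          rw [lintegral_const, Measure.restrict_apply_univ, mul_comm]
      _ ≤ ∫⁻ x in Z, ∫⁻ y in S, (ENNReal.ofReal (a ^ 2) + ‖F y - F x‖ₑ) ∂μ ∂μ := by
          refine setLIntegral_mono' hZ fun x hx => lintegral_mono fun y => ?_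
          have h1 : ‖F y‖ₑ ≤ ‖F x‖ₑ + ‖F y - F x‖ₑ := by
            simpa using enorm_add_le (F x) (F y - F x)
          refine h1.trans (add_le_add_left ?_ _)
          rw [← ofReal_norm, Real.norm_of_nonneg (sq_nonneg _)]
          refine ENNReal.ofReal_le_ofReal ?_
          have := hZa x hx
          have := hv0 x
          gcongr
      _ = ∫⁻ x in Z, (ENNReal.ofReal (a ^ 2) * μ S + ∫⁻ y in S, ‖F y - F x‖ₑ ∂μ) ∂μ := by
          congr 1
          ext x
          rw [lintegral_add_left measurable_const, lintegral_const, Measure.restrict_apply_univ]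
      _ = ENNReal.ofReal (a ^ 2) * μ Z * μ S + ∫⁻ x in Z, ∫⁻ y in S, ‖F y - F x‖ₑ ∂μ ∂μ := by
          rw [lintegral_add_left measurable_const, lintegral_const, Measure.restrict_apply_univ]
          ring
      _ ≤ _ := by
          gcongr
  have hIFd : IntegrableOn (fderiv ℝ F) S μ :=
    (hF.continuous_fderiv (by norm_num)).continuousOn.integrableOn_compact hcomp
  rw [← ofReal_integral_norm_eq_lintegral_enorm hIF] at e1
  rw [← ofReal_integral_norm_eq_lintegral_enorm hIFd] at hP'
  have e2 := e1.trans (add_le_add_right hP' _)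
  have hn1 : 0 ≤ ∫ x in S, ‖fderiv ℝ F x‖ ∂μ := integral_nonneg fun _ => norm_nonneg _
  have hn2 : 0 ≤ ∫ x in S, ‖F x‖ ∂μ := integral_nonneg fun _ => norm_nonneg _
  have e3 := ENNReal.toReal_mono (by finiteness) e2
  rw [ENNReal.toReal_add (by finiteness) (by finiteness)] at e3
  simp only [ENNReal.toReal_mul, ENNReal.toReal_ofReal hn1, ENNReal.toReal_ofReal hn2,
    ENNReal.toReal_ofReal (sq_nonneg a), ENNReal.toReal_ofReal (by positivity : 0 ≤ 2 * r),
    ENNReal.toReal_ofReal (by positivity : (0 : ℝ) ≤ 2 ^ Module.finrank ℝ E)] at e3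
  set J := ∫ x in S, v x ^ 2 ∂μ with hJ
  have hJ0 : 0 ≤ J := integral_nonneg fun _ => sq_nonneg _
  have e4 : ∫ x in S, ‖F x‖ ∂μ = J := by
    congr 1
    ext x
    exact Real.norm_of_nonneg (sq_nonneg _)
  rw [e4] at e3
  have hm0 : 0 < μ.real Z := hμ₀.trans_le hZμ
  have e5 : P * ∫ x in S, ‖fderiv ℝ F x‖ ∂μ
      ≤ μ.real Z / 2 * J + 2 * P ^ 2 / μ.real Z * C₁ := by
    have h1 : P * ∫ x in S, ‖fderiv ℝ F x‖ ∂μ ≤ ∫ x in S, (μ.real Z / 2 * v x ^ 2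
        + 2 * P ^ 2 / μ.real Z * ‖fderiv ℝ v x‖ ^ 2) ∂μ := by
      rw [← integral_const_mul]
      refine setIntegral_mono (hIF'.const_mul P) ((hIF.const_mul _).add (hIv'.const_mul _))
        fun x => ?_
      dsimp only
      rw [hFd, norm_smul, Real.norm_of_nonneg (by have := hv0 x; positivity)]
      have h2 : μ.real Z / 2 * v x ^ 2 + 2 * P ^ 2 / μ.real Z * ‖fderiv ℝ v x‖ ^ 2
          - P * (2 * v x * ‖fderiv ℝ v x‖)
          = (μ.real Z * v x - 2 * P * ‖fderiv ℝ v x‖) ^ 2 / (2 * μ.real Z) := by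
        field_simp
        ring
      have : 0 ≤ (μ.real Z * v x - 2 * P * ‖fderiv ℝ v x‖) ^ 2 / (2 * μ.real Z) := by positivity
      linarith
    refine h1.trans ?_
    rw [integral_add (hIF.const_mul _) (hIv'.const_mul _), integral_const_mul, integral_const_mul]
    gcongr
  have e6 : μ.real Z * J ≤ a ^ 2 * μ.real Z * μ.real S
      + (μ.real Z / 2 * J + 2 * P ^ 2 / μ.real Z * C₁) := by
    refine e3.trans (add_le_add (le_refl _) (le_trans (le_of_eq ?_) e5))
    rw [hP, Measure.real]
    ring
  have hC₁0 : 0 ≤ C₁ := le_trans (integral_nonneg fun _ => sq_nonneg _) hC₁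
  have e7 : J ≤ 2 * (a ^ 2 * μ.real S + 2 * P ^ 2 / μ.real Z * C₁ / μ.real Z) := by
    have h1 : 2 * P ^ 2 / μ.real Z * C₁
        = μ.real Z * (2 * P ^ 2 / μ.real Z * C₁ / μ.real Z) := by field_simp
    rw [h1] at e6
    by_contra! hcon
    nlinarith
  refine e7.trans ?_
  gcongr

end PoincareInequality

section GrowthLemma

variable {E : Type*} [NormedAddCommGroup E] [InnerProductSpace ℂ E] [NormedSpace ℝ E]
  [FiniteDimensional ℝ E] [MeasurableSpace E] [BorelSpace E]

lemma exists_gradient_integral_le (μ : Measure E) [μ.IsAddHaarMeasure] {lam : ℝ} (hlam : 0 < lam)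
    (Lam : ℝ) : ∃ C : ℝ, ∀ (B : E → (E →L[ℝ] ℝ) →ₗ[ℝ] (E →L[ℝ] ℝ) →ₗ[ℝ] ℝ),
      EllipticField B lam Lam → ∀ v : E → ℝ, ContDiff ℝ 1 v → (∀ x, 0 < v x) →
      IsLogSubsolution μ B v → ∫ x in closedBall 0 (3 / 4), ‖fderiv ℝ v x‖ ^ 2 ∂μ ≤ C := by
  obtain ⟨C, hC, hcut⟩ := exists_cutoff (E := E)
  obtain ⟨η, hη, hη0, hη1, hηr, hηs, hηd⟩ := hcut (3 / 4) (7 / 8) (by norm_num) (by norm_num)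
  have hηc : HasCompactSupport η := (isCompact_closedBall (0 : E) (7 / 8)).of_isClosed_subset
    (isClosed_tsupport _) hηs
  refine ⟨4 * Lam ^ 2 / lam ^ 2 * ∫ x, 1 * ‖fderiv ℝ η x‖ ^ 2 ∂μ,
    fun B hB v hv hpos hsub => ?_⟩
  have hen := hsub.energy hB hlam hv hpos (φ := fun _ => 1) (φ' := fun _ => 0) (θ := fun _ => 1)
    (fun t _ => hasDerivAt_const t 1) continuousOn_const (fun _ _ => zero_le_one)
    (fun _ _ => le_rfl) continuousOn_const (fun _ _ => zero_le_one) (fun _ _ => by norm_num)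
    hη hηc (hηs.trans (closedBall_subset_ball (by norm_num)))
  refine le_trans ?_ hen
  have hvc := hv.continuous_fderiv (by norm_num)
  have hI : Integrable (fun x => η x ^ 2 * (0 + 1) * ‖fderiv ℝ v x‖ ^ 2) μ :=
    integrable_of_continuousOn_of_eq_zero μ hηc.isCompact
      (((hη.continuous.pow 2).mul continuous_const).mul (hvc.norm.pow 2)).continuousOn
      fun x hx => by simp [image_eq_zero_of_notMem_tsupport hx]
  refine le_trans (le_of_eq ?_) (setIntegral_le_integral (s := closedBall 0 (3 / 4)) hI
    (Filter.Eventually.of_forall fun x => by positivity))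
  refine setIntegral_congr_fun measurableSet_closedBall fun x hx => ?_
  simp [hηr x hx]

/-- The growth lemma: a subsolution which is well below its upper bound on a substantial part
of a ball is strictly below it on a smaller ball. -/
lemma exists_growth_constant (μ : Measure E) [μ.IsAddHaarMeasure]
    (hdim : 1 < Module.finrank ℝ E) {lam μ₀ : ℝ} (hlam : 0 < lam) (Lam : ℝ) (hμ₀ : 0 < μ₀) :
    ∃ c : ℝ, 0 < c ∧ ∀ (B : E → (E →L[ℝ] ℝ) →ₗ[ℝ] (E →L[ℝ] ℝ) →ₗ[ℝ] ℝ),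
      EllipticField B lam Lam → ∀ w : E → ℝ, ContDiffOn ℝ 1 w (ball 0 2) →
      (∀ ψ : E → ℝ, ContDiff ℝ 1 ψ → HasCompactSupport ψ → tsupport ψ ⊆ ball 0 1 →
        (∀ x, 0 ≤ ψ x) → ∫ x, B x (fderiv ℝ w x) (fderiv ℝ ψ x) ∂μ ≤ 0) →
      ∀ m δ : ℝ, 0 < δ → (∀ x ∈ ball (0 : E) 2, w x ≤ m) →
      μ₀ ≤ μ.real {x | x ∈ closedBall (0 : E) (3 / 4) ∧ w x ≤ m - δ} →
      ∀ x ∈ ball (0 : E) (1 / 2), w x ≤ m - c * δ := by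
  obtain ⟨C₁, hC₁⟩ := exists_gradient_integral_le (E := E) μ hlam Lam
  obtain ⟨C₂, hC₂⟩ := exists_integral_sq_le_of_le_on μ (r := 3 / 4) hμ₀ (by norm_num)
    (Real.log 2) C₁
  obtain ⟨C₃, hC₃, hmoser⟩ := exists_sq_le_integral μ hdim hlam Lam
  obtain ⟨Cη, hCη, hcut⟩ := exists_cutoff (E := E)
  obtain ⟨χ, hχ, hχ0, hχ1, hχr, hχs, -⟩ := hcut 1 (3 / 2) (by norm_num) (by norm_num)
  set L := |C₃ * C₂| + 1 with hL
  have hL1 : 1 ≤ L := by have := abs_nonneg (C₃ * C₂); linarith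
  set ε := Real.exp (-L) / 2 with hε
  have hε0 : 0 < ε := by positivity
  refine ⟨ε, hε0, fun B hB w hw hsub m δ hδ hm hZ x hx => ?_⟩
  set s : E → ℝ := fun y => χ y * ((m - w y) / δ) + (1 - χ y) + ε with hs
  have hχ2 : ∀ y, y ∉ ball (0 : E) 2 → y ∉ tsupport χ := fun y hy h =>
    hy (closedBall_subset_ball (by norm_num) (hχs h))
  have hs1 : ContDiff ℝ 1 s := by
    rw [contDiff_iff_contDiffAt]
    intro y
    by_cases hy : y ∈ ball (0 : E) 2
    · have hwy : ContDiffAt ℝ 1 w y := hw.contDiffAt (isOpen_ball.mem_nhds hy)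
      exact ((hχ.contDiffAt.mul ((contDiffAt_const.sub hwy).div_const δ)).add
        (contDiffAt_const.sub hχ.contDiffAt)).add contDiffAt_const
    · have hev : s =ᶠ[nhds y] fun _ => 1 + ε := by
        filter_upwards [(isClosed_tsupport χ).isOpen_compl.mem_nhds (hχ2 y hy)] with z hz
        simp [hs, image_eq_zero_of_notMem_tsupport hz]
      exact contDiffAt_const.congr_of_eventuallyEq hev
  have hspos : ∀ y, 0 < s y := by
    intro y
    have h1 := hχ0 y
    have h2 := hχ1 y
    by_cases hy : y ∈ ball (0 : E) 2
    · have h3 := hm y hy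
      have h4 : 0 ≤ (m - w y) / δ := div_nonneg (by linarith) hδ.le
      have h5 : 0 ≤ χ y * ((m - w y) / δ) := mul_nonneg h1 h4
      simp only [hs]
      linarith
    · simp only [hs, image_eq_zero_of_notMem_tsupport (hχ2 y hy)]
      linarith
  have hsin : ∀ y ∈ closedBall (0 : E) 1, s y = (m - w y) / δ + ε := fun y hy => by
    simp [hs, hχr y hy]
  have hsd : ∀ y ∈ ball (0 : E) 1, fderiv ℝ s y = (-δ⁻¹) • fderiv ℝ w y := by
    intro y hy
    have hev : s =ᶠ[nhds y] fun z => (m - w z) * δ⁻¹ + ε := by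
      filter_upwards [isOpen_ball.mem_nhds hy] with z hz
      rw [hsin z (ball_subset_closedBall hz), div_eq_mul_inv]
    have hwd : HasFDerivAt w (fderiv ℝ w y) y :=
      ((hw.contDiffAt (isOpen_ball.mem_nhds (ball_subset_ball (by norm_num) hy))).differentiableAt
        (by norm_num)).hasFDerivAt
    have h3 : HasFDerivAt (fun z => (m - w z) * δ⁻¹ + ε) _ y :=
      ((hwd.const_sub m).mul_const δ⁻¹).add_const ε
    rw [hev.fderiv_eq, h3.fderiv]
    ext z
    simp
  have hsuper : IsWeakSupersolution μ B s := by
    intro ψ hψ hψc hψs hψ0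
    have h1 : ∫ y, B y (fderiv ℝ s y) (fderiv ℝ ψ y) ∂μ
        = (-δ⁻¹) * ∫ y, B y (fderiv ℝ w y) (fderiv ℝ ψ y) ∂μ := by
      rw [← integral_const_mul]
      congr 1
      ext y
      by_cases hy : y ∈ tsupport ψ
      · rw [hsd y (hψs hy), map_smul, LinearMap.smul_apply, smul_eq_mul]
      · simp [fderiv_eq_zero_of_notMem_tsupport hy]
    rw [h1]
    have h2 := hsub ψ hψ hψc hψs hψ0
    have h3 : 0 < δ⁻¹ := by positivity
    nlinarith
  set v : E → ℝ := fun y => Real.log (1 + s y) - Real.log (s y) with hv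
  have hvlog := isLogSubsolution_log hB hlam.le hs1 hspos hsuper
  have hv1 : ContDiff ℝ 1 v :=
    ((contDiff_const.add hs1).log fun y => by have := hspos y; positivity).sub
      (hs1.log fun y => (hspos y).ne')
  have hvpos : ∀ y, 0 < v y := fun y => by
    have := hspos y
    exact sub_pos.2 (Real.log_lt_log this (by linarith))
  set Z := {x | x ∈ closedBall (0 : E) (3 / 4) ∧ w x ≤ m - δ} with hZdef
  have hZm : MeasurableSet Z := by
    have : IsClosed Z := (hw.continuousOn.mono (closedBall_subset_ball (by norm_num)))
      |>.preimage_isClosed_of_isClosed isClosed_closedBall isClosed_Iic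
    exact this.measurableSet
  have hvZ : ∀ y ∈ Z, v y ≤ Real.log 2 := by
    intro y hy
    have h1 : 1 ≤ s y := by
      rw [hsin y (closedBall_subset_closedBall (by norm_num) hy.1)]
      have : 1 ≤ (m - w y) / δ := by rw [le_div_iff₀ hδ]; linarith [hy.2]
      linarith
    have h2 := hspos y
    rw [hv, sub_le_iff_le_add, ← Real.log_mul (by norm_num) h2.ne']
    exact Real.log_le_log (by linarith) (by linarith)
  have hI := hC₂ v hv1 (fun y => (hvpos y).le) Z hZm (fun y hy => hy.1) hvZ hZ
    (hC₁ B hB v hv1 hvpos hvlog)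
  have hvx : v x ^ 2 ≤ C₃ * C₂ := (hmoser B hB v hv1 hvpos hvlog x hx).trans (by gcongr)
  have hvL : v x ≤ L := by
    have h1 := le_abs_self (C₃ * C₂)
    have h2 := hvpos x
    nlinarith
  have hsx : Real.exp (-L) ≤ s x := by
    have h1 : -Real.log (s x) ≤ L := by
      have : 0 ≤ Real.log (1 + s x) := Real.log_nonneg (by linarith [hspos x])
      have h2 : v x = Real.log (1 + s x) - Real.log (s x) := rfl
      linarith
    rw [← Real.le_log_iff_exp_le (hspos x)]
    linarith
  rw [hsin x (ball_subset_closedBall (ball_subset_ball (by norm_num) hx))] at hsx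
  have h1 : ε ≤ (m - w x) / δ := by
    have : Real.exp (-L) = ε + ε := by rw [hε]; ring
    linarith
  rw [le_div_iff₀ hδ] at h1
  linarith

end GrowthLemma

section MatrixCoefficients

open Complex Matrix
open scoped ComplexConjugate

attribute [local instance] Matrix.normedAddCommGroup Matrix.normedSpace

variable {n : ℕ}

/-- The complex number attached to the real direction `∂_x` (index `0`) or `∂_y` (index `1`). -/
def unitC : Fin 2 → ℂ := ![1, I]

/-- The standard real basis of `ℂⁿ`. -/
def realDir (α : Fin n × Fin 2) : Cn n := EuclideanSpace.single α.1 (unitC α.2)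

/-- The real coefficient matrix of the operator `v ↦ Re ∑ b_{ji} v_{i j̄}`. -/
def realCoef (b : Matrix (Fin n) (Fin n) ℂ) : Matrix (Fin n × Fin 2) (Fin n × Fin 2) ℝ :=
  fun α β => (1/4) * (b β.1 α.1 * (conj (unitC α.2) * unitC β.2)).re

/-- The complex Hessian matrix attached to a real `2n × 2n` matrix. -/
def hessC (S : Matrix (Fin n × Fin 2) (Fin n × Fin 2) ℝ) : Matrix (Fin n) (Fin n) ℂ :=
  fun i j => (1/4) * ∑ s, ∑ t, conj (unitC s) * unitC t * (S (i, s) (j, t) : ℂ)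

lemma complexHessian_eq_hessC (u : Cn n → ℝ) (z : Cn n) :
    complexHessian u z = hessC (fun α β => D2 u z (realDir α) (realDir β)) := by
  ext i j
  simp [complexHessian, hessC, realDir, unitC, Fin.sum_univ_two]
  ring_nf

lemma sum_realCoef_mul (b : Matrix (Fin n) (Fin n) ℂ)
    (S : Matrix (Fin n × Fin 2) (Fin n × Fin 2) ℝ) :
    ∑ α, ∑ β, realCoef b α β * S α β = (∑ i, ∑ j, b j i * hessC S i j).re := by
  simp only [realCoef, hessC, re_sum, Fintype.sum_prod_type, Finset.mul_sum]
  refine Finset.sum_congr rfl fun i _ => ?_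
  rw [Finset.sum_comm]
  refine Finset.sum_congr rfl fun j _ => Finset.sum_congr rfl fun s _ =>
    Finset.sum_congr rfl fun t _ => ?_
  rw [show b j i * (1 / 4 * (conj (unitC s) * unitC t * (S (i, s) (j, t) : ℂ)))
    = ((1 / 4 * S (i, s) (j, t) : ℝ) : ℂ) * (b j i * (conj (unitC s) * unitC t)) by
      push_cast; ring, re_ofReal_mul]
  ring

lemma realCoef_form (b : Matrix (Fin n) (Fin n) ℂ) (X : Fin n × Fin 2 → ℝ) :
    ∑ α, ∑ β, realCoef b α β * (X α * X β)
      = (star (fun i => ∑ s, (1/2 : ℂ) * conj (unitC s) * X (i, s)) ⬝ᵥ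
          (b *ᵥ fun i => ∑ s, (1/2 : ℂ) * conj (unitC s) * X (i, s))).re := by
  rw [sum_realCoef_mul b (fun α β => X α * X β)]
  congr 1
  simp only [hessC, dotProduct, mulVec, Finset.mul_sum, Pi.star_apply, star_sum,
    Finset.sum_mul, ofReal_mul]
  rw [Finset.sum_comm]
  refine Finset.sum_congr rfl fun i _ => ?_
  refine Finset.sum_congr rfl fun j _ => ?_
  refine Finset.sum_congr rfl fun s _ => Finset.sum_congr rfl fun t _ => ?_
  simp
  ring

lemma realCoef_symm {b : Matrix (Fin n) (Fin n) ℂ} (hb : b.IsHermitian)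
    (α β : Fin n × Fin 2) : realCoef b α β = realCoef b β α := by
  have h : b α.1 β.1 = conj (b β.1 α.1) := (hb.apply α.1 β.1).symm
  simp only [realCoef, h]
  rw [← conj_re]
  simp only [map_mul, conj_conj]
  rw [mul_comm (unitC α.2)]

/-- Positive semidefinite matrices with trace at most `T` and determinant at least `lam`. -/
def admissible (n : ℕ) (lam T : ℝ) : Set (Matrix (Fin n) (Fin n) ℂ) :=
  {A | A.PosSemidef ∧ A.trace.re ≤ T ∧ lam ≤ A.det.re}

lemma norm_apply_le_trace {A : Matrix (Fin n) (Fin n) ℂ} (hA : A.PosSemidef) (i j : Fin n) :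
    ‖A i j‖ ≤ A.trace.re := by
  have hd : ∀ k, 0 ≤ (A k k).re := fun k => (Complex.le_def.1 (hA.diag_nonneg (i := k))).1
  have ht : ∀ k, (A k k).re ≤ A.trace.re := fun k => by
    rw [Matrix.trace, re_sum]
    exact Finset.single_le_sum (f := fun i => (A.diag i).re) (fun i _ => hd i) (Finset.mem_univ k)
  obtain ⟨c, hc1, hc2⟩ : ∃ c : ℂ, ‖c‖ = 1 ∧ (c * A i j) = -(‖A i j‖ : ℂ) := by
    by_cases h : A i j = 0
    · exact ⟨1, by simp, by simp [h]⟩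
    · have h' : (‖A i j‖ : ℂ) ≠ 0 := by simpa using h
      refine ⟨-(conj (A i j)) / ‖A i j‖, by simp [h], ?_⟩
      field_simp
      rw [← Complex.conj_mul']
      try ring
  have h1 := hA.re_dotProduct_nonneg (Pi.single i 1 + Pi.single j c)
  have hs : A j i = conj (A i j) := (hA.1.apply j i).symm
  have hcc : conj c * c = 1 := by rw [Complex.conj_mul', hc1]; simp
  have h2 : star (Pi.single i 1 + Pi.single j c) ⬝ᵥ (A *ᵥ (Pi.single i 1 + Pi.single j c))
      = A i i + A j j + (c * A i j + conj (c * A i j)) := by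
    rw [star_add, Matrix.mulVec_add, add_dotProduct, dotProduct_add, dotProduct_add]
    simp only [Pi.star_single, Matrix.mulVec_single, single_dotProduct]
    simp [hs]
    linear_combination (A j j) * hcc
  rw [h2, hc2] at h1
  simp at h1
  linarith [ht i, ht j]

lemma isClosed_setOf_posSemidef : IsClosed {A : Matrix (Fin n) (Fin n) ℂ | A.PosSemidef} := by
  have : {A : Matrix (Fin n) (Fin n) ℂ | A.PosSemidef}
      = {A | Aᴴ = A} ∩ ⋂ x : Fin n → ℂ, {A | 0 ≤ star x ⬝ᵥ (A *ᵥ x)} := by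
    ext A
    simp [Matrix.posSemidef_iff_dotProduct_mulVec, Matrix.IsHermitian]
  rw [this]
  refine (isClosed_eq (by fun_prop) (by fun_prop)).inter (isClosed_iInter fun x => ?_)
  exact isClosed_le (by fun_prop) (by fun_prop)

lemma isCompact_admissible (n : ℕ) (lam T : ℝ) : IsCompact (admissible n lam T) := by
  refine Metric.isCompact_of_isClosed_isBounded ?_ ?_
  · refine isClosed_setOf_posSemidef.inter (IsClosed.inter ?_ ?_)
    · exact isClosed_le (f := fun A : Matrix (Fin n) (Fin n) ℂ => A.trace.re)
        (g := fun _ => T) (by fun_prop) (by fun_prop)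
    · exact isClosed_le (f := fun _ => lam)
        (g := fun A : Matrix (Fin n) (Fin n) ℂ => A.det.re) (by fun_prop) (by fun_prop)
  · refine (isBounded_iff_forall_norm_le).2 ⟨max T 0, fun A hA => ?_⟩
    refine (Matrix.norm_le_iff (le_max_right _ _)).2 fun i j => ?_
    exact (norm_apply_le_trace hA.1 i j).trans (hA.2.1.trans (le_max_left _ _))

lemma posDef_of_mem_admissible {lam T : ℝ} (hlam : 0 < lam) {A : Matrix (Fin n) (Fin n) ℂ}
    (hA : A ∈ admissible n lam T) : A.PosDef := by
  refine hA.1.posDef_iff_det_ne_zero.2 fun h => ?_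
  have := hA.2.2
  rw [h] at this
  simp at this
  linarith

lemma adjugate_posDef {A : Matrix (Fin n) (Fin n) ℂ} (hA : A.PosDef) : A.adjugate.PosDef := by
  have h := hA.inv
  have hd := hA.det_pos
  rw [Matrix.inv_def, Ring.inverse_eq_inv'] at h
  have h2 := h.smul hd
  rwa [smul_smul, mul_inv_cancel₀ hd.ne', one_smul] at h2

lemma exists_realCoef_lower {lam : ℝ} (hlam : 0 < lam) (T : ℝ) :
    ∃ c, 0 < c ∧ ∀ A ∈ admissible n lam T, ∀ X : Fin n × Fin 2 → ℝ,
      c * ∑ α, X α ^ 2 ≤ ∑ α, ∑ β, realCoef A.adjugate α β * (X α * X β) := by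
  have hcS : IsCompact {X : Fin n × Fin 2 → ℝ | ∑ α, X α ^ 2 = 1} := by
    refine Metric.isCompact_of_isClosed_isBounded (isClosed_eq (by fun_prop) (by fun_prop)) ?_
    refine (isBounded_iff_forall_norm_le).2 ⟨1, fun X hX => ?_⟩
    refine (pi_norm_le_iff_of_nonneg zero_le_one).2 fun α => ?_
    have := Finset.single_le_sum (f := fun i => X i ^ 2) (fun i _ => sq_nonneg _)
      (Finset.mem_univ α)
    rw [hX] at this
    exact (sq_le_one_iff_abs_le_one _).1 this
  have hcont : Continuous fun q : Matrix (Fin n) (Fin n) ℂ × (Fin n × Fin 2 → ℝ) =>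
      ∑ α, ∑ β, realCoef q.1.adjugate α β * (q.2 α * q.2 β) := by
    unfold realCoef
    have : Continuous fun q : Matrix (Fin n) (Fin n) ℂ × (Fin n × Fin 2 → ℝ) => q.1.adjugate :=
      continuous_fst.matrix_adjugate
    have h2 : ∀ i j, Continuous
      fun q : Matrix (Fin n) (Fin n) ℂ × (Fin n × Fin 2 → ℝ) => q.1.adjugate i j :=
      fun i j => this.matrix_elem i j
    fun_prop
  obtain ⟨c, hc0, hc⟩ := ((isCompact_admissible n lam T).prod hcS).exists_forall_le' (a := 0)
    hcont.continuousOn (by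
      rintro ⟨A, X⟩ ⟨hA, hX⟩
      simp only [Set.mem_ofPred_eq] at hX ⊢
      rw [realCoef_form]
      refine (adjugate_posDef (posDef_of_mem_admissible hlam hA)).re_dotProduct_pos fun h0 => ?_
      have : ∀ α, X α = 0 := by
        rintro ⟨i, s⟩
        have hi := congrFun h0 i
        simp [Fin.sum_univ_two, unitC, Complex.ext_iff] at hi
        fin_cases s
        · exact hi.1
        · exact hi.2
      simp [this] at hX)
  refine ⟨c, hc0, fun A hA X => ?_⟩
  rcases eq_or_ne (∑ α, X α ^ 2) 0 with h0 | h0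
  · have : ∀ α, X α = 0 := fun α => by
      simpa using (Finset.sum_eq_zero_iff_of_nonneg (fun i _ => sq_nonneg (X i))).1 h0 α
        (Finset.mem_univ α)
    simp [this]
  · have hp : 0 < ∑ α, X α ^ 2 := lt_of_le_of_ne (Finset.sum_nonneg fun i _ => sq_nonneg _) h0.symm
    set r := √(∑ α, X α ^ 2) with hr
    have hr2 : r ^ 2 = ∑ α, X α ^ 2 := Real.sq_sqrt hp.le
    have hr0 : 0 < r := Real.sqrt_pos.2 hp
    have := hc ⟨A, fun α => X α / r⟩ ⟨hA, by
      simp only [Set.mem_ofPred_eq, div_pow, ← Finset.sum_div, ← hr2]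
      field_simp⟩
    simp only at this
    rw [← hr2, mul_comm c]
    calc r ^ 2 * c ≤ r ^ 2 * ∑ α, ∑ β, realCoef A.adjugate α β * (X α / r * (X β / r)) := by
          gcongr
      _ = _ := by
        simp only [Finset.mul_sum]
        refine Finset.sum_congr rfl fun α _ => Finset.sum_congr rfl fun β _ => ?_
        field_simp

end MatrixCoefficients

section DeterminantMonotonicity

open Complex Matrix
open scoped ComplexConjugate

attribute [local instance] Matrix.normedAddCommGroup Matrix.normedSpace

variable {n : ℕ}

lemma PosSemidef.exists_eq_conjTranspose_mul {A : Matrix (Fin n) (Fin n) ℂ} (hA : A.PosSemidef) :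
    ∃ C : Matrix (Fin n) (Fin n) ℂ, A = Cᴴ * C := by
  open scoped MatrixOrder Matrix.Norms.L2Operator in
  obtain ⟨C, hC⟩ := CStarAlgebra.nonneg_iff_eq_star_mul_self.mp hA.nonneg
  exact ⟨C, by rw [hC, star_eq_conjTranspose]⟩

lemma re_trace_inv_mul_sq_nonneg {g A : Matrix (Fin n) (Fin n) ℂ} (hg : g.PosDef)
    (hA : A.IsHermitian) : 0 ≤ (g⁻¹ * A * (g⁻¹ * A)).trace.re := by
  obtain ⟨C, hC⟩ := PosSemidef.exists_eq_conjTranspose_mul hg.inv.posSemidef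
  have hY : (C * A * Cᴴ)ᴴ = C * A * Cᴴ := by
    simp [hA.eq, Matrix.mul_assoc]
  have h := (posSemidef_conjTranspose_mul_self (C * A * Cᴴ)).trace_nonneg
  rw [hY] at h
  have e : (g⁻¹ * A * (g⁻¹ * A)).trace = (C * A * Cᴴ * (C * A * Cᴴ)).trace := by
    rw [hC]
    simp only [Matrix.mul_assoc]
    rw [Matrix.trace_mul_comm]
    simp only [Matrix.mul_assoc]
  rw [e]
  exact (Complex.le_def.1 h).1

lemma one_add_sum_le_prod_one_add {ι : Type*} (s : Finset ι) {a : ι → ℝ} (ha : ∀ i, 0 ≤ a i) :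
    1 + ∑ i ∈ s, a i ≤ ∏ i ∈ s, (1 + a i) := by
  classical
  induction s using Finset.induction_on with
  | empty => simp
  | insert i s hi ih =>
    rw [Finset.sum_insert hi, Finset.prod_insert hi]
    have h0 : 0 ≤ ∑ i ∈ s, a i := Finset.sum_nonneg fun i _ => ha i
    nlinarith [ha i]

lemma one_add_trace_le_det {N : Matrix (Fin n) (Fin n) ℂ} (hN : N.PosSemidef) :
    1 + N.trace.re ≤ (1 + N).det.re := by
  have h1 : (1 + N).det = ∏ i, (1 + (hN.1.eigenvalues i : ℂ)) := by
    have h := congrArg (Polynomial.eval (-1)) hN.1.charpoly_eq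
    rw [Matrix.eval_charpoly, Polynomial.eval_prod] at h
    have e1 : (Matrix.scalar (Fin n) (-1 : ℂ)) - N = -(1 + N) := by
      have : Matrix.scalar (Fin n) (-1 : ℂ) = -1 := by
        rw [map_neg, map_one]
      rw [this]
      abel
    have e2 : ∀ i, Polynomial.eval (-1) (Polynomial.X - Polynomial.C (hN.1.eigenvalues i : ℂ))
        = -1 * (1 + (hN.1.eigenvalues i : ℂ)) := fun i => by simp; ring
    rw [e1, Matrix.det_neg] at h
    erw [Finset.prod_congr rfl fun i _ => e2 i] at h
    rw [Finset.prod_mul_distrib] at h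
    simp only [Finset.prod_const, Finset.card_univ] at h
    exact mul_left_cancel₀ (by simp) h
  rw [h1, hN.1.trace_eq_sum_eigenvalues]
  have e : (∏ i, (1 + (hN.1.eigenvalues i : ℂ))) = ((∏ i, (1 + hN.1.eigenvalues i) : ℝ) : ℂ) := by
    push_cast; rfl
  have e' : (∑ i, (hN.1.eigenvalues i : ℂ)) = ((∑ i, hN.1.eigenvalues i : ℝ) : ℂ) := by
    push_cast; rfl
  erw [e, e', ofReal_re, ofReal_re]
  exact one_add_sum_le_prod_one_add _ hN.eigenvalues_nonneg

lemma eq_zero_of_det_add_eq {q S : Matrix (Fin n) (Fin n) ℂ} (hq : q.PosDef) (hS : S.PosSemidef)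
    (h : (q + S).det = q.det) : S = 0 := by
  obtain ⟨B, hB⟩ := PosSemidef.exists_eq_conjTranspose_mul hq.posSemidef
  have hdq : q.det ≠ 0 := hq.det_pos.ne'
  have hBd : IsUnit B.det := by
    rw [isUnit_iff_ne_zero]
    rintro h0
    rw [hB, det_mul, h0, mul_zero] at hdq
    exact hdq rfl
  set N := (B⁻¹)ᴴ * S * B⁻¹ with hN
  have hNP : N.PosSemidef := hS.conjTranspose_mul_mul_same B⁻¹
  have hBB : B⁻¹ * B = 1 := Matrix.nonsing_inv_mul _ hBd
  have hBB' : Bᴴ * (B⁻¹)ᴴ = 1 := by rw [← conjTranspose_mul, hBB, conjTranspose_one]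
  have hSN : S = Bᴴ * N * B := by
    rw [hN]
    calc S = (Bᴴ * (B⁻¹)ᴴ) * S * (B⁻¹ * B) := by rw [hBB, hBB']; simp
      _ = _ := by simp only [Matrix.mul_assoc]
  have hqS : q + S = Bᴴ * (1 + N) * B := by
    conv_lhs => rw [hB, hSN]
    rw [Matrix.mul_add, Matrix.add_mul, Matrix.mul_one]
  have hdet : (1 + N).det = 1 := by
    rw [hqS, hB, det_mul, det_mul, det_mul] at h
    have h1 : (Bᴴ).det ≠ 0 := by
      intro h0
      rw [hB, det_mul, h0, zero_mul] at hdq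
      exact hdq rfl
    have := hBd.ne_zero
    have h2 : (Bᴴ).det * B.det * (1 + N).det = (Bᴴ).det * B.det * 1 := by
      linear_combination h
    exact mul_left_cancel₀ (mul_ne_zero h1 this) h2
  have htr := one_add_trace_le_det hNP
  rw [hdet, one_re] at htr
  have ht0 : N.trace = 0 := by
    have := Complex.le_def.1 hNP.trace_nonneg
    refine Complex.ext (le_antisymm (by simpa using by linarith) this.1) this.2.symm
  have hN0 := hNP.trace_eq_zero_iff.1 ht0
  rw [hSN, hN0]
  simp

/-- The Hermitian form of a matrix, as a real number. -/
def hermForm (A : Matrix (Fin n) (Fin n) ℂ) (ξ : Fin n → ℂ) : ℝ := (star ξ ⬝ᵥ (A *ᵥ ξ)).re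

lemma continuous_hermForm (ξ : Fin n → ℂ) : Continuous fun A => hermForm A ξ := by
  unfold hermForm
  fun_prop

lemma hermForm_sub (A B : Matrix (Fin n) (Fin n) ℂ) (ξ : Fin n → ℂ) :
    hermForm (A - B) ξ = hermForm A ξ - hermForm B ξ := by
  simp [hermForm, Matrix.sub_mulVec, dotProduct_sub]

lemma hermForm_nonneg {A : Matrix (Fin n) (Fin n) ℂ} (hA : A.PosSemidef) (ξ : Fin n → ℂ) :
    0 ≤ hermForm A ξ := hA.re_dotProduct_nonneg ξ

lemma posSemidef_of_hermForm_nonneg {A : Matrix (Fin n) (Fin n) ℂ} (hA : A.IsHermitian)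
    (h : ∀ ξ, 0 ≤ hermForm A ξ) : A.PosSemidef := by
  refine .of_dotProduct_mulVec_nonneg hA fun ξ => Complex.le_def.2 ⟨h ξ, ?_⟩
  have : star (star ξ ⬝ᵥ (A *ᵥ ξ)) = star ξ ⬝ᵥ (A *ᵥ ξ) := by
    rw [← star_dotProduct, star_mulVec, ← dotProduct_mulVec, hA.eq]
  exact (Complex.conj_eq_iff_im.1 this).symm

/-- Two admissible matrices which are far apart and have almost the same determinant are
separated by one of finitely many Hermitian forms, in the prescribed direction. -/
lemma exists_separating_forms {lam : ℝ} (hlam : 0 < lam) (T : ℝ) {θ : ℝ} (hθ : 0 < θ) :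
    ∃ (Ξ : Finset (Fin n → ℂ)) (c : ℝ), 0 < c ∧ ∀ p ∈ admissible n lam T,
      ∀ q ∈ admissible n lam T, θ ≤ ‖p - q‖ →
        c ≤ |p.det.re - q.det.re| ∨ ∃ ξ ∈ Ξ, c ≤ hermForm q ξ - hermForm p ξ := by
  classical
  set W : Set (Matrix (Fin n) (Fin n) ℂ × Matrix (Fin n) (Fin n) ℂ) :=
    (admissible n lam T ×ˢ admissible n lam T) ∩ {x | θ ≤ ‖x.1 - x.2‖} with hW
  have hWc : IsCompact W := ((isCompact_admissible n lam T).prod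
    (isCompact_admissible n lam T)).inter_right (isClosed_le (by fun_prop) (by fun_prop))
  suffices h : ∃ (Ξ : Finset (Fin n → ℂ)) (c : ℝ), 0 < c ∧ ∀ x ∈ W,
      c ≤ |x.1.det.re - x.2.det.re| ∨ ∃ ξ ∈ Ξ, c ≤ hermForm x.2 ξ - hermForm x.1 ξ by
    obtain ⟨Ξ, c, hc, h⟩ := h
    exact ⟨Ξ, c, hc, fun p hp q hq hpq => h (p, q) ⟨⟨hp, hq⟩, hpq⟩⟩
  refine hWc.induction_on (p := fun W => ∃ (Ξ : Finset (Fin n → ℂ)) (c : ℝ), 0 < c ∧ ∀ x ∈ W,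
      c ≤ |x.1.det.re - x.2.det.re| ∨ ∃ ξ ∈ Ξ, c ≤ hermForm x.2 ξ - hermForm x.1 ξ) ?_ ?_ ?_ ?_
  · exact ⟨∅, 1, one_pos, by simp⟩
  · rintro s t hst ⟨Ξ, c, hc, h⟩
    exact ⟨Ξ, c, hc, fun x hx => h x (hst hx)⟩
  · rintro s t ⟨Ξ, c, hc, h⟩ ⟨Ξ', c', hc', h'⟩
    refine ⟨Ξ ∪ Ξ', min c c', lt_min hc hc', ?_⟩
    rintro x (hx | hx)
    · rcases h x hx with h1 | ⟨ξ, hξ, h1⟩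
      · exact .inl ((min_le_left _ _).trans h1)
      · exact .inr ⟨ξ, Finset.mem_union_left _ hξ, (min_le_left _ _).trans h1⟩
    · rcases h' x hx with h1 | ⟨ξ, hξ, h1⟩
      · exact .inl ((min_le_right _ _).trans h1)
      · exact .inr ⟨ξ, Finset.mem_union_right _ hξ, (min_le_right _ _).trans h1⟩
  · rintro ⟨p, q⟩ ⟨⟨hp, hq⟩, hpq⟩
    by_cases hd : p.det.re = q.det.re
    · obtain ⟨ξ, hξ⟩ : ∃ ξ, 0 < hermForm q ξ - hermForm p ξ := by
        by_contra! hcon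
        have hS : (p - q).PosSemidef := by
          refine posSemidef_of_hermForm_nonneg (hp.1.1.sub hq.1.1) fun ξ => ?_
          rw [hermForm_sub]
          linarith [hcon ξ]
        have hdet : (q + (p - q)).det = q.det := by
          rw [add_sub_cancel]
          refine Complex.ext hd ?_
          rw [← (Complex.le_def.1 hp.1.det_nonneg).2, ← (Complex.le_def.1 hq.1.det_nonneg).2]
        have := eq_zero_of_det_add_eq (posDef_of_mem_admissible hlam hq) hS hdet
        simp only [Set.mem_ofPred_eq, this, norm_zero] at hpq
        linarith
      have hc : Continuous fun x : Matrix (Fin n) (Fin n) ℂ × Matrix (Fin n) (Fin n) ℂ =>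
          hermForm x.2 ξ - hermForm x.1 ξ :=
        ((continuous_hermForm ξ).comp continuous_snd).sub
          ((continuous_hermForm ξ).comp continuous_fst)
      refine ⟨_, mem_nhdsWithin_of_mem_nhds
        (hc.continuousAt.preimage_mem_nhds (Ioi_mem_nhds (half_lt_self hξ))),
        {ξ}, _, half_pos hξ, fun x hx => .inr ⟨ξ, Finset.mem_singleton_self _, le_of_lt hx⟩⟩
    · have h0 : 0 < |p.det.re - q.det.re| := abs_pos.2 (sub_ne_zero.2 hd)
      have hc : Continuous fun x : Matrix (Fin n) (Fin n) ℂ × Matrix (Fin n) (Fin n) ℂ =>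
          |x.1.det.re - x.2.det.re| := by fun_prop
      exact ⟨_, mem_nhdsWithin_of_mem_nhds
        (hc.continuousAt.preimage_mem_nhds (Ioi_mem_nhds (half_lt_self h0))),
        ∅, _, half_pos h0, fun x hx => .inl (le_of_lt hx)⟩

end DeterminantMonotonicity

section DeterminantDerivative

open Complex Matrix

attribute [local instance] Matrix.normedAddCommGroup Matrix.normedSpace

variable {n : ℕ}

lemma contDiff_det {k : WithTop ℕ∞} : ContDiff ℝ k fun A : Matrix (Fin n) (Fin n) ℂ => A.det := by
  have h : ∀ i j, ContDiff ℝ k fun A : Matrix (Fin n) (Fin n) ℂ => A i j := fun i j =>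
    contDiff_pi.1 (contDiff_pi.1 (contDiff_id (𝕜 := ℝ) (E := Fin n → Fin n → ℂ)) i) j
  simp only [Matrix.det_apply]
  exact ContDiff.sum fun σ _ => (contDiff_prod fun i _ => h _ _).const_smul _

lemma contDiff_adjugate {k : WithTop ℕ∞} :
    ContDiff ℝ k fun A : Matrix (Fin n) (Fin n) ℂ => A.adjugate := by
  have h : ∀ i j, ContDiff ℝ k fun A : Matrix (Fin n) (Fin n) ℂ => A i j := fun i j =>
    contDiff_pi.1 (contDiff_pi.1 (contDiff_id (𝕜 := ℝ) (E := Fin n → Fin n → ℂ)) i) j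
  refine contDiff_pi.2 fun i => contDiff_pi.2 fun j => ?_
  simp only [Matrix.adjugate_apply]
  refine contDiff_det.comp (contDiff_pi.2 fun a => contDiff_pi.2 fun b => ?_)
  by_cases ha : a = j
  · subst ha
    simp only [Matrix.updateRow_self]
    exact contDiff_const
  · simp only [Matrix.updateRow_ne ha]
    exact h a b

lemma fderiv_det_apply {A : Matrix (Fin n) (Fin n) ℂ} (hA : A.det ≠ 0)
    (B : Matrix (Fin n) (Fin n) ℂ) :
    fderiv ℝ (fun A : Matrix (Fin n) (Fin n) ℂ => A.det) A B = (A.adjugate * B).trace := by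
  have h1 : HasDerivAt (fun t : ℝ => (A + t • B).det)
      (fderiv ℝ (fun A : Matrix (Fin n) (Fin n) ℂ => A.det) A B) 0 := by
    have hd : HasFDerivAt (fun A : Matrix (Fin n) (Fin n) ℂ => A.det)
        (fderiv ℝ (fun A : Matrix (Fin n) (Fin n) ℂ => A.det) A) (A + (0 : ℝ) • B) := by
      rw [zero_smul, add_zero]
      exact (contDiff_det.differentiable one_ne_zero A).hasFDerivAt
    have hl : HasDerivAt (fun t : ℝ => A + t • B) B 0 := by
      have := ((hasDerivAt_id (0 : ℝ)).smul_const B).const_add A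
      rwa [one_smul] at this
    exact hd.comp_hasDerivAt 0 hl
  have h2 : HasDerivAt (fun t : ℝ => (A + t • B).det) (A.adjugate * B).trace 0 := by
    have e : (fun t : ℝ => (A + t • B).det) = fun t : ℝ => A.det * (1 + (A⁻¹ * B).trace * (t : ℂ)
        + ((1 + (Polynomial.X : Polynomial ℂ) • (A⁻¹ * B).map Polynomial.C).det.divX.divX).eval
          (t : ℂ) * (t : ℂ) ^ 2) := by
      funext t
      rw [← Matrix.det_one_add_smul, ← det_mul, Matrix.mul_add, Matrix.mul_one, Matrix.mul_smul,
        ← Matrix.mul_assoc, Matrix.mul_nonsing_inv _ (isUnit_iff_ne_zero.2 hA), Matrix.one_mul]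
      congr 2
    rw [e]
    set P := (1 + (Polynomial.X : Polynomial ℂ) • (A⁻¹ * B).map Polynomial.C).det.divX.divX
    have hc : HasDerivAt (fun z : ℂ => A.det * (1 + (A⁻¹ * B).trace * z + P.eval z * z ^ 2))
        (A.adjugate * B).trace ((0 : ℝ) : ℂ) := by
      have := ((((hasDerivAt_id (0 : ℂ)).const_mul (A⁻¹ * B).trace).const_add 1).add
        ((P.hasDerivAt 0).mul ((hasDerivAt_id (0 : ℂ)).pow 2))).const_mul A.det
      rw [ofReal_zero]
      refine HasDerivAt.congr_deriv this ?_
      simp [Matrix.inv_def, hA, Matrix.trace_smul]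
    exact hc.comp_ofReal
  exact h1.unique h2

end DeterminantDerivative

section DirectionalDerivatives

open Complex Matrix
open scoped ComplexConjugate

attribute [local instance] Matrix.normedAddCommGroup Matrix.normedSpace

variable {n : ℕ} {F : Type*} [NormedAddCommGroup F] [NormedSpace ℝ F]

/-- The derivative of `v` in the real direction `e`. -/
def pd (e : Cn n) (v : Cn n → F) (z : Cn n) : F := fderiv ℝ v z e

lemma contDiffOn_pd {U : Set (Cn n)} (hU : IsOpen U) {k m : WithTop ℕ∞} (hkm : k + 1 ≤ m)
    {v : Cn n → F} (hv : ContDiffOn ℝ m v U) (e : Cn n) : ContDiffOn ℝ k (pd e v) U :=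
  (hv.fderiv_of_isOpen hU hkm).clm_apply contDiffOn_const

lemma pd_congr {U : Set (Cn n)} (hU : IsOpen U) {v w : Cn n → F} (h : ∀ z ∈ U, v z = w z)
    (e : Cn n) : ∀ z ∈ U, pd e v z = pd e w z := fun z hz => by
  have : v =ᶠ[nhds z] w := by
    filter_upwards [hU.mem_nhds hz] with y hy using h y hy
  rw [pd, pd, this.fderiv_eq]

lemma fderiv_fderiv_apply {U : Set (Cn n)} (hU : IsOpen U) {v : Cn n → F}
    (hv : ContDiffOn ℝ 2 v U) {z : Cn n} (hz : z ∈ U) (e e' : Cn n) :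
    fderiv ℝ (fderiv ℝ v) z e e' = pd e (pd e' v) z := by
  have hd : DifferentiableAt ℝ (fderiv ℝ v) z :=
    ((hv.fderiv_of_isOpen hU (m := 1) (by norm_num)).differentiableOn one_ne_zero).differentiableAt
      (hU.mem_nhds hz)
  unfold pd
  rw [fderiv_clm_apply hd (differentiableAt_const e')]
  simp

lemma pd_comm {U : Set (Cn n)} (hU : IsOpen U) {v : Cn n → F} (hv : ContDiffOn ℝ 2 v U)
    (e e' : Cn n) : ∀ z ∈ U, pd e (pd e' v) z = pd e' (pd e v) z := fun z hz => by
  rw [← fderiv_fderiv_apply hU hv hz, ← fderiv_fderiv_apply hU hv hz]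
  exact ((hv.contDiffAt (hU.mem_nhds hz)).isSymmSndFDerivAt (by simp)) e e'

lemma D2_eq_pd {U : Set (Cn n)} (hU : IsOpen U) {v : Cn n → ℝ} (hv : ContDiffOn ℝ 2 v U)
    {z : Cn n} (hz : z ∈ U) (e e' : Cn n) : D2 v z e e' = pd e (pd e' v) z :=
  fderiv_fderiv_apply hU hv hz e e'

lemma D2_comm {U : Set (Cn n)} (hU : IsOpen U) {v : Cn n → ℝ} (hv : ContDiffOn ℝ 2 v U)
    {z : Cn n} (hz : z ∈ U) (e e' : Cn n) : D2 v z e e' = D2 v z e' e := by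
  rw [D2_eq_pd hU hv hz, D2_eq_pd hU hv hz, pd_comm hU hv e e' z hz]

lemma D2_pd {U : Set (Cn n)} (hU : IsOpen U) {v : Cn n → ℝ} (hv : ContDiffOn ℝ 3 v U)
    (e e₁ e₂ : Cn n) : ∀ z ∈ U, D2 (pd e v) z e₁ e₂ = pd e (fun y => D2 v y e₁ e₂) z := by
  intro z hz
  have h1 : ∀ z ∈ U, pd e₂ (pd e v) z = pd e (pd e₂ v) z :=
    pd_comm hU (hv.of_le (by norm_num)) e₂ e
  have h2 : ContDiffOn ℝ 2 (pd e₂ v) U := contDiffOn_pd hU (by norm_num) hv e₂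
  rw [D2_eq_pd hU (contDiffOn_pd hU (by norm_num) hv e) hz, pd_congr hU h1 e₁ z hz,
    pd_comm hU h2 e₁ e z hz]
  exact (pd_congr hU (fun y hy => D2_eq_pd hU (hv.of_le (by norm_num)) hy e₁ e₂) e z hz).symm

/-- `hessC` as a linear map. -/
def hessL (n : ℕ) : (Matrix (Fin n × Fin 2) (Fin n × Fin 2) ℝ) →L[ℝ] Matrix (Fin n) (Fin n) ℂ :=
  LinearMap.toContinuousLinearMap
    { toFun := hessC
      map_add' := fun S S' => by
        ext i j
        simp only [hessC, Matrix.add_apply, ofReal_add, mul_add, Finset.sum_add_distrib]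
      map_smul' := fun c S => by
        ext i j
        simp only [hessC, Matrix.smul_apply, smul_eq_mul, ofReal_mul, Finset.mul_sum,
          RingHom.id_apply, real_smul]
        refine Finset.sum_congr rfl fun s _ => Finset.sum_congr rfl fun t _ => by ring }

/-- The real Hessian matrix in the standard basis. -/
def realHess (u : Cn n → ℝ) (z : Cn n) : Matrix (Fin n × Fin 2) (Fin n × Fin 2) ℝ :=
  fun α β => D2 u z (realDir α) (realDir β)

lemma complexHessian_eq_hessL (u : Cn n → ℝ) (z : Cn n) :
    complexHessian u z = hessL n (realHess u z) := complexHessian_eq_hessC u z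

lemma contDiffOn_D2 {U : Set (Cn n)} (hU : IsOpen U) {k m : WithTop ℕ∞} (hkm : k + 2 ≤ m)
    {v : Cn n → ℝ} (hv : ContDiffOn ℝ m v U) (e e' : Cn n) :
    ContDiffOn ℝ k (fun z => D2 v z e e') U := by
  have h : k + 1 + 1 ≤ m := by rwa [add_assoc, one_add_one_eq_two]
  exact ((((hv.fderiv_of_isOpen hU h).fderiv_of_isOpen hU le_rfl).clm_apply
    contDiffOn_const).clm_apply contDiffOn_const)

lemma contDiffOn_realHess {U : Set (Cn n)} (hU : IsOpen U) {k m : WithTop ℕ∞} (hkm : k + 2 ≤ m)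
    {v : Cn n → ℝ} (hv : ContDiffOn ℝ m v U) : ContDiffOn ℝ k (realHess v) U :=
  contDiffOn_pi.2 fun _ => contDiffOn_pi.2 fun _ => contDiffOn_D2 hU hkm hv _ _

lemma contDiffOn_complexHessian {U : Set (Cn n)} (hU : IsOpen U) {k m : WithTop ℕ∞}
    (hkm : k + 2 ≤ m) {v : Cn n → ℝ} (hv : ContDiffOn ℝ m v U) :
    ContDiffOn ℝ k (complexHessian v) U := by
  rw [show complexHessian v = fun z => hessL n (realHess v z) from
    funext fun z => complexHessian_eq_hessL v z]
  exact (hessL n).contDiff.comp_contDiffOn (contDiffOn_realHess hU hkm hv)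

lemma differentiableAt_of_contDiffOn {U : Set (Cn n)} (hU : IsOpen U) {k : WithTop ℕ∞}
    (hk : 1 ≤ k) {v : Cn n → F} (hv : ContDiffOn ℝ k v U) {z : Cn n} (hz : z ∈ U) :
    DifferentiableAt ℝ v z :=
  ((hv.of_le hk).differentiableOn one_ne_zero).differentiableAt (hU.mem_nhds hz)

lemma pd_matrix_apply {ι ι' 𝕂 : Type*} [Fintype ι] [Fintype ι'] [NormedAddCommGroup 𝕂]
    [NormedSpace ℝ 𝕂] {A : Cn n → Matrix ι ι' 𝕂} {z : Cn n}
    (hA : DifferentiableAt ℝ A z) (e : Cn n) (i : ι) (j : ι') :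
    pd e A z i j = pd e (fun y => A y i j) z := by
  have h := hA.hasFDerivAt
  have h1 := (hasFDerivAt_pi'.1 ((hasFDerivAt_pi'.1 h) i)) j
  unfold pd
  rw [h1.fderiv]
  rfl

lemma complexHessian_pd {U : Set (Cn n)} (hU : IsOpen U) {v : Cn n → ℝ}
    (hv : ContDiffOn ℝ 3 v U) (e : Cn n) :
    ∀ z ∈ U, complexHessian (pd e v) z = pd e (complexHessian v) z := by
  intro z hz
  have h1 : DifferentiableAt ℝ (realHess v) z :=
    differentiableAt_of_contDiffOn hU le_rfl (contDiffOn_realHess hU (by norm_num) hv) hz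
  have h2 : realHess (pd e v) z = pd e (realHess v) z := by
    ext α β
    rw [pd_matrix_apply h1]
    exact D2_pd hU hv e _ _ z hz
  rw [complexHessian_eq_hessL, h2,
    show complexHessian v = fun z => hessL n (realHess v z) from
      funext fun z => complexHessian_eq_hessL v z]
  unfold pd
  have := (hessL n).hasFDerivAt.comp z h1.hasFDerivAt
  have e := this.fderiv
  rw [show (fun z => hessL n (realHess v z)) = (hessL n) ∘ (realHess v) from rfl, e]
  rfl

lemma pd_mul {A B : Cn n → Matrix (Fin n) (Fin n) ℂ} {z : Cn n} (hA : DifferentiableAt ℝ A z)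
    (hB : DifferentiableAt ℝ B z) (e : Cn n) :
    pd e (fun y => A y * B y) z = pd e A z * B z + A z * pd e B z ∧
      DifferentiableAt ℝ (fun y => A y * B y) z := by
  have hA' : ∀ i j, HasFDerivAt (fun y => A y i j) (fderiv ℝ (fun y => A y i j) z) z :=
    fun i j => (differentiableAt_pi.1 (differentiableAt_pi.1 hA i) j).hasFDerivAt
  have hB' : ∀ i j, HasFDerivAt (fun y => B y i j) (fderiv ℝ (fun y => B y i j) z) z :=
    fun i j => (differentiableAt_pi.1 (differentiableAt_pi.1 hB i) j).hasFDerivAt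
  have hd : DifferentiableAt ℝ (fun y => A y * B y) z := by
    refine differentiableAt_pi.2 fun i => differentiableAt_pi.2 fun j => ?_
    simp only [Matrix.mul_apply]
    exact DifferentiableAt.fun_sum fun k _ => (hA' i k).differentiableAt.mul (hB' k j).differentiableAt
  refine ⟨?_, hd⟩
  ext i j
  rw [pd_matrix_apply hd]
  simp only [Matrix.mul_apply, Matrix.add_apply]
  have h : HasFDerivAt (fun y => ∑ k, A y i k * B y k j)
      (∑ k, (A z i k • fderiv ℝ (fun y => B y k j) z + B z k j • fderiv ℝ (fun y => A y i k) z)) z :=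
    HasFDerivAt.fun_sum fun k _ => (hA' i k).mul (hB' k j)
  rw [pd, h.fderiv, ← Finset.sum_add_distrib, _root_.sum_apply]
  refine Finset.sum_congr rfl fun k _ => ?_
  rw [pd_matrix_apply hA, pd_matrix_apply hB]
  simp [pd]
  ring

lemma pd_clm {G : Type*} [NormedAddCommGroup G] [NormedSpace ℝ G] (L : F →L[ℝ] G) {v : Cn n → F}
    {z : Cn n} (hv : DifferentiableAt ℝ v z) (e : Cn n) :
    pd e (fun y => L (v y)) z = L (pd e v z) := by
  unfold pd
  have := (L.hasFDerivAt.comp z hv.hasFDerivAt).fderiv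
  rw [show (fun y => L (v y)) = L ∘ v from rfl, this]
  rfl

lemma pd_trace {A : Cn n → Matrix (Fin n) (Fin n) ℂ} {z : Cn n} (hA : DifferentiableAt ℝ A z)
    (e : Cn n) : pd e (fun y => (A y).trace) z = (pd e A z).trace :=
  pd_clm (LinearMap.toContinuousLinearMap (Matrix.traceLinearMap (Fin n) ℝ ℂ)) hA e

lemma pd_ofReal {f : Cn n → ℝ} {z : Cn n} (hf : DifferentiableAt ℝ f z) (e : Cn n) :
    pd e (fun y => (f y : ℂ)) z = ((pd e f z : ℝ) : ℂ) :=
  pd_clm Complex.ofRealCLM hf e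

end DirectionalDerivatives

section MongeAmpereEquation

open Complex Matrix
open scoped ComplexConjugate

attribute [local instance] Matrix.normedAddCommGroup Matrix.normedSpace

variable {n : ℕ}

/-- A `C⁴` solution of the complex Monge–Ampère equation in the ball of radius `2`, with bounds
scaling like `κ` for the right hand side. -/
structure IsMASolution (n : ℕ) (lam T κ : ℝ) (u f : Cn n → ℝ) : Prop where
  contDiffOn : ContDiffOn ℝ 4 u (ball 0 2)
  contDiffOn_rhs : ContDiffOn ℝ 2 f (ball 0 2)
  mem : ∀ z ∈ ball (0 : Cn n) 2, complexHessian u z ∈ admissible n lam T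
  det_eq : ∀ z ∈ ball (0 : Cn n) 2, (complexHessian u z).det = (f z : ℂ)
  norm_fderiv_rhs_le : ∀ z ∈ ball (0 : Cn n) 2, ‖fderiv ℝ f z‖ ≤ κ
  norm_fderiv_fderiv_rhs_le : ∀ z ∈ ball (0 : Cn n) 2, ‖fderiv ℝ (fderiv ℝ f) z‖ ≤ κ ^ 2

/-- The linearized operator with coefficients `b`. -/
def maOp (b : Matrix (Fin n) (Fin n) ℂ) (v : Cn n → ℝ) (z : Cn n) : ℝ :=
  ∑ α, ∑ β, realCoef b α β * realHess v z α β

lemma maOp_eq_trace (b : Matrix (Fin n) (Fin n) ℂ) (v : Cn n → ℝ) (z : Cn n) :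
    maOp b v z = (b * complexHessian v z).trace.re := by
  rw [maOp, sum_realCoef_mul, Finset.sum_comm, Matrix.trace]
  simp only [Matrix.diag_apply, Matrix.mul_apply]
  rw [show complexHessian v z = hessC (realHess v z) from complexHessian_eq_hessC v z]

lemma norm_realDir (α : Fin n × Fin 2) : ‖realDir α‖ = 1 := by
  obtain ⟨i, s⟩ := α
  fin_cases s <;> simp [realDir, unitC]

namespace IsMASolution

variable {lam T κ : ℝ} {u f : Cn n → ℝ}

lemma contDiffOn_hessian (h : IsMASolution n lam T κ u f) :
    ContDiffOn ℝ 2 (complexHessian u) (ball 0 2) :=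
  contDiffOn_complexHessian isOpen_ball (by norm_num) h.contDiffOn

lemma contDiffOn_adjugate (h : IsMASolution n lam T κ u f) :
    ContDiffOn ℝ 2 (fun z => (complexHessian u z).adjugate) (ball 0 2) :=
  contDiff_adjugate.comp_contDiffOn h.contDiffOn_hessian

lemma le_rhs (h : IsMASolution n lam T κ u f) {z : Cn n} (hz : z ∈ ball (0 : Cn n) 2) :
    lam ≤ f z := by
  have := (h.mem z hz).2.2
  rwa [h.det_eq z hz, ofReal_re] at this

lemma posDef (h : IsMASolution n lam T κ u f) (hlam : 0 < lam) {z : Cn n}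
    (hz : z ∈ ball (0 : Cn n) 2) : (complexHessian u z).PosDef :=
  posDef_of_mem_admissible hlam (h.mem z hz)

/-- The once differentiated equation. -/
lemma pd_rhs (h : IsMASolution n lam T κ u f) (hlam : 0 < lam) (e : Cn n) :
    ∀ z ∈ ball (0 : Cn n) 2, ((pd e f z : ℝ) : ℂ)
      = ((complexHessian u z).adjugate * pd e (complexHessian u) z).trace := by
  intro z hz
  have hg := differentiableAt_of_contDiffOn isOpen_ball one_le_two h.contDiffOn_hessian hz
  have hf := differentiableAt_of_contDiffOn isOpen_ball one_le_two h.contDiffOn_rhs hz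
  rw [← pd_ofReal hf, pd_congr isOpen_ball (fun y hy => (h.det_eq y hy).symm) e z hz, pd]
  have h1 := ((contDiff_det (k := 1)).differentiable one_ne_zero
    (complexHessian u z)).hasFDerivAt.comp z hg.hasFDerivAt
  have h2 := h1.fderiv
  rw [show (fun y => (complexHessian u y).det) = (fun A : Matrix (Fin n) (Fin n) ℂ => A.det)
    ∘ complexHessian u from rfl, h2, ContinuousLinearMap.comp_apply]
  exact fderiv_det_apply (h.posDef hlam hz).det_pos.ne' _

/-- The twice differentiated equation. -/
lemma pd_pd_rhs (h : IsMASolution n lam T κ u f) (hlam : 0 < lam) (e e' : Cn n) :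
    ∀ z ∈ ball (0 : Cn n) 2, ((pd e' (pd e f) z : ℝ) : ℂ)
      = (pd e' (fun y => (complexHessian u y).adjugate) z * pd e (complexHessian u) z).trace
        + ((complexHessian u z).adjugate * complexHessian (pd e' (pd e u)) z).trace := by
  intro z hz
  have hb := differentiableAt_of_contDiffOn isOpen_ball one_le_two h.contDiffOn_adjugate hz
  have hg' : ContDiffOn ℝ 1 (pd e (complexHessian u)) (ball 0 2) :=
    contDiffOn_pd isOpen_ball (by norm_num) h.contDiffOn_hessian e
  have hgd := differentiableAt_of_contDiffOn isOpen_ball le_rfl hg' hz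
  have hf' : ContDiffOn ℝ 1 (pd e f) (ball 0 2) :=
    contDiffOn_pd isOpen_ball (by norm_num) h.contDiffOn_rhs e
  have hu' : ContDiffOn ℝ 3 (pd e u) (ball 0 2) :=
    contDiffOn_pd isOpen_ball (by norm_num) h.contDiffOn e
  obtain ⟨h1, h2⟩ := pd_mul hb hgd e'
  rw [← pd_ofReal (differentiableAt_of_contDiffOn isOpen_ball le_rfl hf' hz),
    pd_congr isOpen_ball (h.pd_rhs hlam e) e' z hz, pd_trace h2, h1, Matrix.trace_add,
    complexHessian_pd isOpen_ball hu' e' z hz,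
    pd_congr isOpen_ball (complexHessian_pd isOpen_ball (h.contDiffOn.of_le (by norm_num)) e)
      e' z hz]

lemma pd_adjugate (h : IsMASolution n lam T κ u f) (e : Cn n) :
    ∀ z ∈ ball (0 : Cn n) 2, pd e (complexHessian u) z * (complexHessian u z).adjugate
      + complexHessian u z * pd e (fun y => (complexHessian u y).adjugate) z
      = ((pd e f z : ℝ) : ℂ) • (1 : Matrix (Fin n) (Fin n) ℂ) := by
  intro z hz
  have hb := differentiableAt_of_contDiffOn isOpen_ball one_le_two h.contDiffOn_adjugate hz
  have hg := differentiableAt_of_contDiffOn isOpen_ball one_le_two h.contDiffOn_hessian hz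
  have hf := differentiableAt_of_contDiffOn isOpen_ball one_le_two h.contDiffOn_rhs hz
  rw [← (pd_mul hg hb e).1]
  have e1 : ∀ y ∈ ball (0 : Cn n) 2, complexHessian u y * (complexHessian u y).adjugate
      = (f y : ℂ) • (1 : Matrix (Fin n) (Fin n) ℂ) := fun y hy => by
    rw [Matrix.mul_adjugate, h.det_eq y hy]
  rw [pd_congr isOpen_ball e1 e z hz]
  exact pd_clm (LinearMap.toContinuousLinearMap
    (LinearMap.toSpanSingleton ℂ (Matrix (Fin n) (Fin n) ℂ) 1 ∘ₗ Complex.ofRealLI.toLinearMap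
      : ℝ →ₗ[ℝ] Matrix (Fin n) (Fin n) ℂ)) hf e

lemma isHermitian_pd (h : IsMASolution n lam T κ u f) (e : Cn n) {z : Cn n}
    (hz : z ∈ ball (0 : Cn n) 2) : (pd e (complexHessian u) z).IsHermitian := by
  have hg := differentiableAt_of_contDiffOn isOpen_ball one_le_two h.contDiffOn_hessian hz
  have h1 : ∀ y ∈ ball (0 : Cn n) 2, complexHessian u y
      = (Matrix.conjTransposeLinearEquiv (Fin n) (Fin n) ℝ ℂ).toLinearMap (complexHessian u y) :=
    fun y hy => (h.mem y hy).1.1.symm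
  have h2 := pd_clm (LinearMap.toContinuousLinearMap
    ((Matrix.conjTransposeLinearEquiv (Fin n) (Fin n) ℝ ℂ).toLinearMap)) hg e
  have h3 := pd_congr isOpen_ball h1 e z hz
  exact (h3.trans h2).symm

/-- Second derivatives of a solution are almost subsolutions of the linearized equation. -/
lemma le_maOp_pd_pd (h : IsMASolution n lam T κ u f) (hlam : 0 < lam) (e : Cn n) {z : Cn n}
    (hz : z ∈ ball (0 : Cn n) 2) :
    pd e (pd e f) z - (pd e f z) ^ 2 / f z
      ≤ maOp (complexHessian u z).adjugate (pd e (pd e u)) z := by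
  have hpd := h.posDef hlam hz
  have hfpos : 0 < f z := hlam.trans_le (h.le_rhs hz)
  set g := complexHessian u z
  set A := pd e (complexHessian u) z with hA
  set B := pd e (fun y => (complexHessian u y).adjugate) z with hB
  have hdet : g.det = (f z : ℂ) := h.det_eq z hz
  have hu : IsUnit g.det := hpd.det_pos.ne'.isUnit
  have hgg : g⁻¹ * g = 1 := Matrix.nonsing_inv_mul _ hu
  have hadj : g.adjugate = (f z : ℂ) • g⁻¹ := by
    rw [Matrix.inv_def, ← hdet, smul_smul, Ring.mul_inverse_cancel _ hu, one_smul]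
  have hBeq : B = ((pd e f z : ℝ) : ℂ) • g⁻¹ - (f z : ℂ) • (g⁻¹ * A * g⁻¹) := by
    have h1 := congrArg (g⁻¹ * ·) (h.pd_adjugate e z hz)
    simp only [Matrix.mul_add, ← Matrix.mul_assoc] at h1
    change g⁻¹ * A * g.adjugate + g⁻¹ * g * B = _ at h1
    rw [hgg, Matrix.one_mul, hadj, Matrix.mul_smul, Matrix.mul_smul, Matrix.mul_one] at h1
    rw [← h1]
    abel
  have h1 : ((pd e f z : ℝ) : ℂ) = (f z : ℂ) * (g⁻¹ * A).trace := by
    rw [h.pd_rhs hlam e z hz]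
    change (g.adjugate * A).trace = _
    rw [hadj, Matrix.smul_mul, Matrix.trace_smul, smul_eq_mul]
  have h2 : (B * A).trace = ((pd e f z : ℝ) : ℂ) * (g⁻¹ * A).trace
      - (f z : ℂ) * (g⁻¹ * A * (g⁻¹ * A)).trace := by
    rw [hBeq, Matrix.sub_mul, Matrix.trace_sub, Matrix.smul_mul, Matrix.smul_mul,
      Matrix.trace_smul, Matrix.trace_smul, smul_eq_mul, smul_eq_mul, Matrix.mul_assoc _ g⁻¹ A]
  have h3 : (g⁻¹ * A).trace = ((pd e f z / f z : ℝ) : ℂ) := by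
    push_cast
    rw [h1]
    have : (f z : ℂ) ≠ 0 := by exact_mod_cast hfpos.ne'
    field_simp
  have h4 := re_trace_inv_mul_sq_nonneg hpd (h.isHermitian_pd e hz)
  have h5 := congrArg Complex.re (h.pd_pd_rhs hlam e e z hz)
  change _ = ((B * A).trace + (g.adjugate * _).trace).re at h5
  rw [add_re, ← maOp_eq_trace, h2, h3, sub_re, ofReal_re, re_ofReal_mul, re_ofReal_mul,
    ofReal_re] at h5
  have h6 : 0 ≤ f z * (g⁻¹ * A * (g⁻¹ * A)).trace.re := mul_nonneg hfpos.le h4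
  have h7 : pd e f z ^ 2 / f z = pd e f z * (pd e f z / f z) := by ring
  rw [h7]
  linarith

lemma abs_pd_rhs_le (h : IsMASolution n lam T κ u f) (e : Cn n) {z : Cn n}
    (hz : z ∈ ball (0 : Cn n) 2) : |pd e f z| ≤ κ * ‖e‖ :=
  ((fderiv ℝ f z).le_opNorm e).trans
    (mul_le_mul_of_nonneg_right (h.norm_fderiv_rhs_le z hz) (norm_nonneg _))

lemma abs_pd_pd_rhs_le (h : IsMASolution n lam T κ u f) (e e' : Cn n) {z : Cn n}
    (hz : z ∈ ball (0 : Cn n) 2) : |pd e' (pd e f) z| ≤ κ ^ 2 * ‖e‖ * ‖e'‖ := by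
  rw [← fderiv_fderiv_apply isOpen_ball h.contDiffOn_rhs hz]
  calc |fderiv ℝ (fderiv ℝ f) z e' e| ≤ ‖fderiv ℝ (fderiv ℝ f) z e'‖ * ‖e‖ :=
        (fderiv ℝ (fderiv ℝ f) z e').le_opNorm e
    _ ≤ ‖fderiv ℝ (fderiv ℝ f) z‖ * ‖e'‖ * ‖e‖ := by
        gcongr
        exact (fderiv ℝ (fderiv ℝ f) z).le_opNorm e'
    _ ≤ κ ^ 2 * ‖e'‖ * ‖e‖ := by gcongr; exact h.norm_fderiv_fderiv_rhs_le z hz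
    _ = _ := by ring

lemma neg_le_maOp_pd_pd (h : IsMASolution n lam T κ u f) (hlam : 0 < lam) (e : Cn n) {z : Cn n}
    (hz : z ∈ ball (0 : Cn n) 2) :
    -((1 + 1 / lam) * κ ^ 2 * ‖e‖ ^ 2)
      ≤ maOp (complexHessian u z).adjugate (pd e (pd e u)) z := by
  refine le_trans ?_ (h.le_maOp_pd_pd hlam e hz)
  have h1 := abs_le.1 (h.abs_pd_pd_rhs_le e e hz)
  have h2 : (pd e f z) ^ 2 ≤ (κ * ‖e‖) ^ 2 := by
    rw [← sq_abs]
    exact pow_le_pow_left₀ (abs_nonneg _) (h.abs_pd_rhs_le e hz) 2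
  have h3 : (pd e f z) ^ 2 / f z ≤ (κ * ‖e‖) ^ 2 / lam :=
    div_le_div₀ (sq_nonneg _) h2 hlam (h.le_rhs hz)
  have h4 : (1 + 1 / lam) * κ ^ 2 * ‖e‖ ^ 2 = κ ^ 2 * ‖e‖ * ‖e‖ + (κ * ‖e‖) ^ 2 / lam := by
    field_simp
  linarith [h1.1]

/-- The coefficient matrix of the linearized equation is divergence free. -/
lemma sum_pd_realCoef (h : IsMASolution n lam T κ u f) (hlam : 0 < lam) (β : Fin n × Fin 2)
    {z : Cn n} (hz : z ∈ ball (0 : Cn n) 2) :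
    ∑ α, pd (realDir α) (fun y => realCoef (complexHessian u y).adjugate α β) z = 0 := by
  set g := complexHessian u z with hg
  set b : Cn n → Matrix (Fin n) (Fin n) ℂ := fun y => (complexHessian u y).adjugate with hb
  have hbd := differentiableAt_of_contDiffOn isOpen_ball one_le_two h.contDiffOn_adjugate hz
  have hgd := differentiableAt_of_contDiffOn isOpen_ball one_le_two h.contDiffOn_hessian hz
  -- complex derivative of the Hessian entries is symmetric
  set Dg : Fin n → Matrix (Fin n) (Fin n) ℂ :=
    fun i => ∑ s, conj (unitC s) • pd (realDir (i, s)) (complexHessian u) z with hDg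
  set Db : Fin n → Matrix (Fin n) (Fin n) ℂ :=
    fun i => ∑ s, conj (unitC s) • pd (realDir (i, s)) b z with hDb
  set Df : Fin n → ℂ := fun i => ∑ s, conj (unitC s) * ((pd (realDir (i, s)) f z : ℝ) : ℂ)
    with hDf
  have hsymm : ∀ i k j, Dg i k j = Dg k i j := by
    intro i k j
    have e1 : ∀ e k j, pd e (complexHessian u) z k j
        = (1/4) * ∑ s, ∑ t, conj (unitC s) * unitC t *
          ((D2 (pd e u) z (realDir (k, s)) (realDir (j, t)) : ℝ) : ℂ) := fun e k j => by
      rw [← complexHessian_pd isOpen_ball (h.contDiffOn.of_le (by norm_num)) e z hz,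
        complexHessian_eq_hessC]
      rfl
    have e2 : ∀ e e₁ e₂, D2 (pd e u) z e₁ e₂ = D2 (pd e₁ u) z e e₂ := fun e e₁ e₂ => by
      have hu3 : ContDiffOn ℝ 3 u (ball 0 2) := h.contDiffOn.of_le (by norm_num)
      have hu2 : ContDiffOn ℝ 2 u (ball 0 2) := h.contDiffOn.of_le (by norm_num)
      have hc : ∀ e, ContDiffOn ℝ 2 (pd e u) (ball 0 2) :=
        fun e => contDiffOn_pd isOpen_ball (by norm_num) hu3 e
      rw [D2_comm isOpen_ball (hc _) hz, D2_eq_pd isOpen_ball (hc _) hz,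
        pd_congr isOpen_ball (pd_comm isOpen_ball hu2 e₁ e) e₂ z hz,
        ← D2_eq_pd isOpen_ball (hc _) hz, D2_comm isOpen_ball (hc _) hz]
    have e3 : ∀ i k, Dg i k j = ∑ s, conj (unitC s) * ((1/4) * ∑ s', ∑ t, conj (unitC s') * unitC t *
        ((D2 (pd (realDir (i, s)) u) z (realDir (k, s')) (realDir (j, t)) : ℝ) : ℂ)) :=
      fun i k => by
        refine (Matrix.sum_apply k j _ _).trans ?_
        exact Finset.sum_congr rfl fun s _ => by rw [Matrix.smul_apply, e1, smul_eq_mul]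
    rw [e3, e3]
    simp only [Finset.mul_sum]
    rw [Finset.sum_comm]
    refine Finset.sum_congr rfl fun s _ => Finset.sum_congr rfl fun s' _ =>
      Finset.sum_congr rfl fun t _ => ?_
    rw [e2]
    ring
  have hF1 : ∀ i, Df i = (b z * Dg i).trace := by
    intro i
    simp only [hDf, hDg, Matrix.mul_sum, Matrix.trace_sum, Matrix.mul_smul, Matrix.trace_smul,
      smul_eq_mul]
    exact Finset.sum_congr rfl fun s _ => by rw [h.pd_rhs hlam _ z hz]
  have hF2 : ∀ i, Dg i * b z + g * Db i = Df i • (1 : Matrix (Fin n) (Fin n) ℂ) := by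
    intro i
    simp only [hDg, hDb, hDf, Matrix.mul_sum, Matrix.sum_mul, Matrix.mul_smul, Matrix.smul_mul,
      Finset.sum_smul, ← Finset.sum_add_distrib, ← smul_add]
    refine Finset.sum_congr rfl fun s _ => ?_
    rw [h.pd_adjugate _ z hz, smul_smul]
  have hv : (fun j => ∑ i, Db i j i) = 0 := by
    have hinj : g *ᵥ (fun j => ∑ i, Db i j i) = 0 := by
      ext k
      have e1 : (g *ᵥ (fun j => ∑ i, Db i j i)) k = ∑ i, (g * Db i) k i := by
        simp only [mulVec, dotProduct, Matrix.mul_apply, Finset.mul_sum]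
        exact Finset.sum_comm
      have e2 : ∀ i, (g * Db i) k i = Df i * (1 : Matrix (Fin n) (Fin n) ℂ) k i
          - (Dg i * b z) k i := fun i => by
        have := congrFun (congrFun (hF2 i) k) i
        simp only [Matrix.add_apply, Matrix.smul_apply, smul_eq_mul] at this
        rw [← this]
        ring
      have e3 : ∑ i, (Dg i * b z) k i = Df k := by
        rw [hF1, Matrix.trace_mul_comm, Matrix.trace]
        simp only [Matrix.diag_apply, Matrix.mul_apply]
        exact Finset.sum_congr rfl fun i _ => Finset.sum_congr rfl fun j _ => by
          rw [hsymm i k j]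
      rw [e1, Finset.sum_congr rfl fun i _ => e2 i, Finset.sum_sub_distrib, e3]
      simp [Matrix.one_apply]
    have hdet : g.det ≠ 0 := (h.posDef hlam hz).det_pos.ne'
    exact Matrix.eq_zero_of_mulVec_eq_zero hdet hinj
  have e1 : ∀ α, pd (realDir α) (fun y => realCoef (b y) α β) z
      = (1/4) * ((conj (unitC α.2) * pd (realDir α) b z β.1 α.1) * unitC β.2).re := fun α => by
    rw [pd_matrix_apply hbd]
    have hd : DifferentiableAt ℝ (fun y => b y β.1 α.1) z :=
      differentiableAt_pi.1 (differentiableAt_pi.1 hbd _) _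
    have := pd_clm (F := ℂ) ((1/4 : ℝ) • Complex.reCLM ∘L
      (ContinuousLinearMap.mul ℝ ℂ (conj (unitC α.2) * unitC β.2))) hd (realDir α)
    have e : ∀ w : ℂ, ((1/4 : ℝ) • Complex.reCLM ∘L
      (ContinuousLinearMap.mul ℝ ℂ (conj (unitC α.2) * unitC β.2))) w
        = (1/4) * (w * (conj (unitC α.2) * unitC β.2)).re := fun w => by
      rw [mul_comm w]
      rfl
    simp only [e] at this
    unfold realCoef
    rw [this]
    congr 2
    ring
  rw [Finset.sum_congr rfl fun α _ => e1 α, ← Finset.mul_sum, ← re_sum, ← Finset.sum_mul]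
  have e2 : ∑ α : Fin n × Fin 2, conj (unitC α.2) * pd (realDir α) b z β.1 α.1 = 0 := by
    have := congrFun hv β.1
    rw [Pi.zero_apply] at this
    rw [← this, Fintype.sum_prod_type]
    simp [hDb]
  rw [e2]
  simp

end IsMASolution

end MongeAmpereEquation

section LinearizedForm

open Complex Matrix
open scoped ComplexConjugate

attribute [local instance] Matrix.normedAddCommGroup Matrix.normedSpace

variable {n : ℕ}

/-- The quadratic form of the linearized operator. -/
def maForm (b : Matrix (Fin n) (Fin n) ℂ) :
    (Cn n →L[ℝ] ℝ) →ₗ[ℝ] (Cn n →L[ℝ] ℝ) →ₗ[ℝ] ℝ :=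
  LinearMap.mk₂ ℝ (fun p q => ∑ α, ∑ β, realCoef b α β * (p (realDir β) * q (realDir α)))
    (fun p p' q => by
      simp only [_root_.add_apply, ← Finset.sum_add_distrib]
      exact Finset.sum_congr rfl fun α _ => Finset.sum_congr rfl fun β _ => by ring)
    (fun t p q => by
      simp only [_root_.smul_apply, smul_eq_mul, Finset.mul_sum]
      exact Finset.sum_congr rfl fun α _ => Finset.sum_congr rfl fun β _ => by ring)
    (fun p q q' => by
      simp only [_root_.add_apply, ← Finset.sum_add_distrib]
      exact Finset.sum_congr rfl fun α _ => Finset.sum_congr rfl fun β _ => by ring)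
    (fun t p q => by
      simp only [_root_.smul_apply, smul_eq_mul, Finset.mul_sum]
      exact Finset.sum_congr rfl fun α _ => Finset.sum_congr rfl fun β _ => by ring)

lemma maForm_apply (b : Matrix (Fin n) (Fin n) ℂ) (p q : Cn n →L[ℝ] ℝ) :
    maForm b p q = ∑ α, ∑ β, realCoef b α β * (p (realDir β) * q (realDir α)) := rfl

/-- The real coordinates of a point of `ℂⁿ`. -/
def realCoord (x : Cn n) (α : Fin n × Fin 2) : ℝ := ![(x α.1).re, (x α.1).im] α.2

lemma sum_realCoord_smul (x : Cn n) : ∑ α, realCoord x α • realDir α = x := by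
  ext i
  rw [Fintype.sum_prod_type]
  simp only [Fin.sum_univ_two, realCoord, realDir, unitC]
  simp [Finset.sum_add_distrib, Pi.single_apply, re_add_im]

lemma sum_realCoord_sq (x : Cn n) : ∑ α, realCoord x α ^ 2 = ‖x‖ ^ 2 := by
  rw [EuclideanSpace.norm_sq_eq, Fintype.sum_prod_type]
  refine Finset.sum_congr rfl fun i _ => ?_
  rw [Fin.sum_univ_two, ← Complex.normSq_eq_norm_sq, Complex.normSq_apply]
  simp [realCoord]
  ring

lemma sq_norm_le_sum_realDir (p : Cn n →L[ℝ] ℝ) : ‖p‖ ^ 2 ≤ ∑ α, p (realDir α) ^ 2 := by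
  have h0 : 0 ≤ ∑ α, p (realDir α) ^ 2 := Finset.sum_nonneg fun _ _ => sq_nonneg _
  have h : ‖p‖ ≤ √(∑ α, p (realDir α) ^ 2) := by
    refine p.opNorm_le_bound (Real.sqrt_nonneg _) fun x => ?_
    rw [Real.norm_eq_abs]
    refine abs_le_of_sq_le_sq ?_ (by positivity)
    rw [mul_pow, Real.sq_sqrt h0, ← sum_realCoord_sq]
    have : p x = ∑ α, p (realDir α) * realCoord x α := by
      conv_lhs => rw [← sum_realCoord_smul x]
      rw [map_sum]
      exact Finset.sum_congr rfl fun α _ => by rw [map_smul, smul_eq_mul, mul_comm]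
    rw [this]
    exact Finset.sum_mul_sq_le_sq_mul_sq _ _ _
  calc ‖p‖ ^ 2 ≤ √(∑ α, p (realDir α) ^ 2) ^ 2 := by gcongr
    _ = _ := Real.sq_sqrt h0

lemma continuous_realCoef (α β : Fin n × Fin 2) :
    Continuous fun b : Matrix (Fin n) (Fin n) ℂ => realCoef b α β := by
  unfold realCoef
  fun_prop

lemma exists_sum_abs_realCoef_le (lam T : ℝ) (n : ℕ) : ∃ Lam, 0 ≤ Lam ∧
    ∀ A ∈ admissible n lam T, ∑ α, ∑ β, |realCoef A.adjugate α β| ≤ Lam := by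
  have hc : Continuous fun A : Matrix (Fin n) (Fin n) ℂ =>
      ∑ α, ∑ β, |realCoef A.adjugate α β| :=
    continuous_finsetSum _ fun α _ => continuous_finsetSum _ fun β _ =>
      ((continuous_realCoef α β).comp (contDiff_adjugate (k := 1)).continuous).abs
  obtain ⟨C, hC⟩ := (isCompact_admissible n lam T).exists_bound_of_continuousOn hc.continuousOn
  exact ⟨|C|, abs_nonneg _, fun A hA => (le_abs_self _).trans ((hC A hA).trans (le_abs_self _))⟩

lemma exists_ellipticity {lam : ℝ} (hlam : 0 < lam) (T : ℝ) (n : ℕ) : ∃ c Lam, 0 < c ∧ 0 ≤ Lam ∧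
    ∀ A ∈ admissible n lam T, (∀ X : Fin n × Fin 2 → ℝ,
      c * ∑ α, X α ^ 2 ≤ ∑ α, ∑ β, realCoef A.adjugate α β * (X α * X β)) ∧
      ∑ α, ∑ β, |realCoef A.adjugate α β| ≤ Lam := by
  obtain ⟨c, hc, h1⟩ := exists_realCoef_lower (n := n) hlam T
  obtain ⟨Lam, hL, h2⟩ := exists_sum_abs_realCoef_le lam T n
  exact ⟨c, Lam, hc, hL, fun A hA => ⟨h1 A hA, h2 A hA⟩⟩

namespace IsMASolution

variable {lam T κ : ℝ} {u f : Cn n → ℝ}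

lemma ellipticField (h : IsMASolution n lam T κ u f) {c Lam : ℝ} (hc : 0 < c)
    (hcL : ∀ A ∈ admissible n lam T, (∀ X : Fin n × Fin 2 → ℝ,
      c * ∑ α, X α ^ 2 ≤ ∑ α, ∑ β, realCoef A.adjugate α β * (X α * X β)) ∧
      ∑ α, ∑ β, |realCoef A.adjugate α β| ≤ Lam) :
    EllipticField (fun z => maForm (complexHessian u z).adjugate) c Lam where
  continuousOn P Q hP hQ := by
    simp only [maForm_apply]
    have hb : ContinuousOn (fun z => (complexHessian u z).adjugate) (ball 0 1) :=
      h.contDiffOn_adjugate.continuousOn.mono (ball_subset_ball one_le_two)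
    refine continuousOn_finsetSum _ fun α _ => continuousOn_finsetSum _ fun β _ => ?_
    exact ((continuous_realCoef α β).comp_continuousOn hb).mul
      ((hP.clm_apply continuous_const).mul (hQ.clm_apply continuous_const)).continuousOn
  lower x hx p := by
    refine le_trans ?_ ((hcL _ (h.mem x (ball_subset_ball one_le_two hx))).1
      fun α => p (realDir α)) |>.trans (le_of_eq ?_)
    · exact mul_le_mul_of_nonneg_left (sq_norm_le_sum_realDir p) hc.le
    · rw [maForm_apply]
      exact Finset.sum_congr rfl fun α _ => Finset.sum_congr rfl fun β _ => by ring
  upper x hx p q := by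
    have hL := (hcL _ (h.mem x (ball_subset_ball one_le_two hx))).2
    have hp : ∀ (p : Cn n →L[ℝ] ℝ) α, |p (realDir α)| ≤ ‖p‖ := fun p α => by
      simpa [norm_realDir] using p.le_opNorm (realDir α)
    rw [maForm_apply]
    calc |∑ α, ∑ β, realCoef (complexHessian u x).adjugate α β * (p (realDir β) * q (realDir α))|
        ≤ ∑ α, ∑ β, |realCoef (complexHessian u x).adjugate α β| * (‖p‖ * ‖q‖) := by
          refine (Finset.abs_sum_le_sum_abs _ _).trans (Finset.sum_le_sum fun α _ => ?_)
          refine (Finset.abs_sum_le_sum_abs _ _).trans (Finset.sum_le_sum fun β _ => ?_)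
          rw [abs_mul, abs_mul]
          gcongr
          · exact hp p β
          · exact hp q α
      _ = (∑ α, ∑ β, |realCoef (complexHessian u x).adjugate α β|) * (‖p‖ * ‖q‖) := by
          simp only [Finset.sum_mul]
      _ ≤ Lam * (‖p‖ * ‖q‖) := by gcongr
      _ = _ := by ring

/-- Integration by parts for the linearized operator, which is in divergence form. -/
lemma integral_maForm (h : IsMASolution n lam T κ u f) (hlam : 0 < lam)
    (μ : Measure (Cn n)) [μ.IsAddHaarMeasure] {v ψ : Cn n → ℝ}
    (hv : ContDiffOn ℝ 2 v (ball 0 2)) (hψ : ContDiff ℝ 1 ψ) (hψc : HasCompactSupport ψ)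
    (hψs : tsupport ψ ⊆ ball 0 1) :
    ∫ x, maForm (complexHessian u x).adjugate (fderiv ℝ v x) (fderiv ℝ ψ x) ∂μ
      = -∫ x, ψ x * maOp (complexHessian u x).adjugate v x ∂μ := by
  have hψs2 : tsupport ψ ⊆ ball 0 2 := hψs.trans (ball_subset_ball one_le_two)
  set G : Fin n × Fin 2 → Cn n → ℝ := fun α x =>
    ∑ β, realCoef (complexHessian u x).adjugate α β * pd (realDir β) v x with hG
  have hcoef : ∀ α β, ContDiffOn ℝ 1 (fun x => realCoef (complexHessian u x).adjugate α β)
      (ball 0 2) := fun α β => by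
    have h1 : ContDiff ℝ 1 fun b : Matrix (Fin n) (Fin n) ℂ => realCoef b α β := by
      unfold realCoef
      exact contDiff_const.mul (Complex.reCLM.contDiff.comp
        ((contDiff_apply_apply ℝ ℂ β.1 α.1).mul contDiff_const))
    exact h1.comp_contDiffOn (h.contDiffOn_adjugate.of_le one_le_two)
  have hpv : ∀ β, ContDiffOn ℝ 1 (pd (realDir β) v) (ball 0 2) := fun β =>
    contDiffOn_pd isOpen_ball (by norm_num) hv _
  have hGC : ∀ α, ContDiffOn ℝ 1 (G α) (ball 0 2) := fun α =>
    ContDiffOn.sum fun β _ => (hcoef α β).mul (hpv β)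
  have hGc' : ∀ α, ContinuousOn (fun x => fderiv ℝ (G α) x (realDir α)) (ball 0 2) := fun α =>
    (contDiffOn_pd isOpen_ball (k := 0) (by norm_num) (hGC α) _).continuousOn
  have hψ' : Continuous (fderiv ℝ ψ) := hψ.continuous_fderiv (by norm_num)
  have hI1 : ∀ α, Integrable (fun x => fderiv ℝ ψ x (realDir α) * G α x) μ := fun α => by
    refine integrable_of_continuousOn_of_eq_zero μ hψc.isCompact
      ((hψ'.clm_apply continuous_const).continuousOn.mul ((hGC α).continuousOn.mono hψs2))
      fun x hx => ?_
    rw [fderiv_eq_zero_of_notMem_tsupport hx]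
    simp
  have hI2 : ∀ α, Integrable (fun x => ψ x * fderiv ℝ (G α) x (realDir α)) μ := fun α => by
    refine integrable_of_continuousOn_of_eq_zero μ hψc.isCompact
      (hψ.continuous.continuousOn.mul ((hGc' α).mono hψs2)) fun x hx => ?_
    rw [image_eq_zero_of_notMem_tsupport hx, zero_mul]
  have hI3 : ∀ α, Integrable (fun x => ψ x * G α x) μ := fun α => by
    refine integrable_of_continuousOn_of_eq_zero μ hψc.isCompact
      (hψ.continuous.continuousOn.mul ((hGC α).continuousOn.mono hψs2)) fun x hx => ?_
    rw [image_eq_zero_of_notMem_tsupport hx, zero_mul]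
  have hparts : ∀ α, ∫ x, fderiv ℝ ψ x (realDir α) * G α x ∂μ
      = -∫ x, ψ x * fderiv ℝ (G α) x (realDir α) ∂μ := fun α => by
    rw [integral_mul_fderiv_eq_neg_fderiv_mul_of_integrable (hI1 α) (hI2 α) (hI3 α)
      (fun x _ => hψ.differentiable one_ne_zero x)
      (fun x hx => differentiableAt_of_contDiffOn isOpen_ball le_rfl (hGC α) (hψs2 hx)), neg_neg]
  have e1 : ∀ x, maForm (complexHessian u x).adjugate (fderiv ℝ v x) (fderiv ℝ ψ x)
      = ∑ α, fderiv ℝ ψ x (realDir α) * G α x := fun x => by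
    rw [maForm_apply]
    refine Finset.sum_congr rfl fun α _ => ?_
    rw [hG, Finset.mul_sum]
    exact Finset.sum_congr rfl fun β _ => by rw [pd]; ring
  have e2 : ∀ x, ψ x * maOp (complexHessian u x).adjugate v x
      = ∑ α, ψ x * fderiv ℝ (G α) x (realDir α) := fun x => by
    by_cases hx : x ∈ tsupport ψ
    · have hx2 := hψs2 hx
      rw [← Finset.mul_sum]
      congr 1
      have h1 : ∀ α, fderiv ℝ (G α) x (realDir α)
          = ∑ β, (pd (realDir α) (fun y => realCoef (complexHessian u y).adjugate α β) x
              * pd (realDir β) v x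
            + realCoef (complexHessian u x).adjugate α β * realHess v x α β) := fun α => by
        have hd : ∀ β, HasFDerivAt (fun y => realCoef (complexHessian u y).adjugate α β
            * pd (realDir β) v y) _ x := fun β =>
          (differentiableAt_of_contDiffOn isOpen_ball le_rfl (hcoef α β) hx2).hasFDerivAt.mul
            (differentiableAt_of_contDiffOn isOpen_ball le_rfl (hpv β) hx2).hasFDerivAt
        have hs : HasFDerivAt (G α) _ x := HasFDerivAt.fun_sum fun β (_ : β ∈ Finset.univ) => hd β
        rw [hs.fderiv, _root_.sum_apply]
        refine Finset.sum_congr rfl fun β _ => ?_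
        simp only [_root_.add_apply, _root_.smul_apply, smul_eq_mul]
        rw [realHess, D2_eq_pd isOpen_ball hv hx2]
        unfold pd
        ring
      rw [Finset.sum_congr rfl fun α _ => h1 α, maOp]
      simp only [Finset.sum_add_distrib]
      rw [Finset.sum_comm (f := fun α β => pd (realDir α)
        (fun y => realCoef (complexHessian u y).adjugate α β) x * pd (realDir β) v x)]
      simp only [← Finset.sum_mul]
      have h0 : ∑ β, (∑ α, pd (realDir α)
          (fun y => realCoef (complexHessian u y).adjugate α β) x) * pd (realDir β) v x = 0 :=
        Finset.sum_eq_zero fun β _ => by rw [h.sum_pd_realCoef hlam β hx2, zero_mul]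
      rw [h0, zero_add]
    · simp [image_eq_zero_of_notMem_tsupport hx]
  simp only [e1, e2]
  rw [integral_finsetSum _ fun α _ => hI1 α, integral_finsetSum _ fun α _ => hI2 α,
    ← Finset.sum_neg_distrib]
  exact Finset.sum_congr rfl fun α _ => hparts α

lemma maOp_growth (hn : n ≠ 0) {lam : ℝ} (hlam : 0 < lam) (T : ℝ) {μ₀ : ℝ} (hμ₀ : 0 < μ₀)
    (μ : Measure (Cn n)) [μ.IsAddHaarMeasure] :
    ∃ c : ℝ, 0 < c ∧ ∀ κ u f, IsMASolution n lam T κ u f → ∀ w : Cn n → ℝ,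
      ContDiffOn ℝ 2 w (ball 0 2) →
      (∀ x ∈ ball (0 : Cn n) 1, 0 ≤ maOp (complexHessian u x).adjugate w x) →
      ∀ m δ : ℝ, 0 < δ → (∀ x ∈ ball (0 : Cn n) 2, w x ≤ m) →
      μ₀ ≤ μ.real {x | x ∈ closedBall (0 : Cn n) (3 / 4) ∧ w x ≤ m - δ} →
      ∀ x ∈ ball (0 : Cn n) (1 / 2), w x ≤ m - c * δ := by
  obtain ⟨c₀, Lam, hc₀, -, hcL⟩ := exists_ellipticity hlam T n
  have hdim : 1 < Module.finrank ℝ (Cn n) := by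
    rw [finrank_real_of_complex, finrank_euclideanSpace, Fintype.card_fin]
    omega
  obtain ⟨c, hc, h⟩ := exists_growth_constant μ hdim hc₀ Lam hμ₀
  refine ⟨c, hc, fun κ u f hu w hw hsub => h _ (hu.ellipticField hc₀ hcL) w
    (hw.of_le one_le_two) fun ψ hψ hψc hψs hψ0 => ?_⟩
  rw [hu.integral_maForm hlam μ hw hψ hψc hψs, neg_nonpos]
  refine integral_nonneg fun x => ?_
  by_cases hx : x ∈ tsupport ψ
  · exact mul_nonneg (hψ0 x) (hsub x (hψs hx))
  · simp [image_eq_zero_of_notMem_tsupport hx]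

end IsMASolution

end LinearizedForm

section Rescaling

open Complex Matrix
open scoped ComplexConjugate

attribute [local instance] Matrix.normedAddCommGroup Matrix.normedSpace

variable {n : ℕ}

lemma fderiv_comp_add_smul {F : Type*} [NormedAddCommGroup F] [NormedSpace ℝ F] (f : Cn n → F)
    (x₀ : Cn n) (R : ℝ) (z : Cn n) :
    fderiv ℝ (fun y => f (x₀ + R • y)) z = R • fderiv ℝ f (x₀ + R • z) := by
  rw [fderiv_comp_smul (f := fun y => f (x₀ + y)) (c := R), fderiv_comp_add_left]

lemma fderiv_fderiv_comp_add_smul {F : Type*} [NormedAddCommGroup F] [NormedSpace ℝ F]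
    (f : Cn n → F) (x₀ : Cn n) (R : ℝ) (z : Cn n) :
    fderiv ℝ (fderiv ℝ fun y => f (x₀ + R • y)) z
      = R ^ 2 • fderiv ℝ (fderiv ℝ f) (x₀ + R • z) := by
  rw [show (fderiv ℝ fun y => f (x₀ + R • y)) = fun y => R • fderiv ℝ f (x₀ + R • y) from
    funext fun y => fderiv_comp_add_smul f x₀ R y]
  have h := congrFun (fderiv_const_smul_field (𝕜 := ℝ) (f := fun y => fderiv ℝ f (x₀ + R • y)) R) z
  refine h.trans ?_
  rw [Pi.smul_apply, fderiv_comp_add_smul, smul_smul, sq]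

/-- Quadratic rescaling. -/
def rescale (x₀ : Cn n) (R : ℝ) (u : Cn n → ℝ) (z : Cn n) : ℝ := (R ^ 2)⁻¹ * u (x₀ + R • z)

lemma D2_const_mul (t : ℝ) (v : Cn n → ℝ) (z e e' : Cn n) :
    D2 (fun y => t * v y) z e e' = t * D2 v z e e' := by
  have h1 : (fderiv ℝ fun y => t * v y) = t • fderiv ℝ v :=
    fderiv_const_smul_field (𝕜 := ℝ) (f := v) t
  have h2 : fderiv ℝ (t • fderiv ℝ v) = t • fderiv ℝ (fderiv ℝ v) :=
    fderiv_const_smul_field (𝕜 := ℝ) (f := fderiv ℝ v) t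
  rw [D2, h1, h2]
  rfl

lemma D2_rescale (x₀ : Cn n) {R : ℝ} (hR : R ≠ 0) (u : Cn n → ℝ) (z e e' : Cn n) :
    D2 (rescale x₀ R u) z e e' = D2 u (x₀ + R • z) e e' := by
  have h := D2_const_mul (R ^ 2)⁻¹ (fun y => u (x₀ + R • y)) z e e'
  refine h.trans ?_
  rw [D2, fderiv_fderiv_comp_add_smul]
  exact inv_mul_cancel_left₀ (pow_ne_zero 2 hR) _

lemma complexHessian_rescale (x₀ : Cn n) {R : ℝ} (hR : R ≠ 0) (u : Cn n → ℝ) (z : Cn n) :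
    complexHessian (rescale x₀ R u) z = complexHessian u (x₀ + R • z) := by
  simp only [complexHessian_eq_hessC, D2_rescale x₀ hR]

lemma add_smul_mem_ball {x₀ z : Cn n} {R r : ℝ} (hR : 0 < R) (hz : z ∈ ball (0 : Cn n) r) :
    x₀ + R • z ∈ ball x₀ (r * R) := by
  rw [mem_ball_zero_iff] at hz
  rw [mem_ball, dist_eq_norm, add_sub_cancel_left, norm_smul, Real.norm_of_nonneg hR.le, mul_comm]
  gcongr

lemma IsMASolution.of_bounds {lam T κ M₃ M₄ R : ℝ} {U : Set (Cn n)} {u f : Cn n → ℝ}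
    (hu : ContDiffOn ℝ 4 u U) (hf : ContDiffOn ℝ 2 f U)
    (hmem : ∀ z ∈ U, complexHessian u z ∈ admissible n lam T)
    (hdet : ∀ z ∈ U, (complexHessian u z).det = (f z : ℂ))
    (hf1 : ∀ z ∈ U, ‖fderiv ℝ f z‖ ≤ M₃) (hf2 : ∀ z ∈ U, ‖fderiv ℝ (fderiv ℝ f) z‖ ≤ M₄)
    (hR : 0 < R) (hM₃ : R * M₃ ≤ κ) (hM₄ : R ^ 2 * M₄ ≤ κ ^ 2) {x₀ : Cn n}
    (hsub : ball x₀ (2 * R) ⊆ U) :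
    IsMASolution n lam T κ (rescale x₀ R u) (fun z => f (x₀ + R • z)) := by
  have hmaps : ∀ z ∈ ball (0 : Cn n) 2, x₀ + R • z ∈ U := fun z hz =>
    hsub (add_smul_mem_ball hR hz)
  have haff : ContDiff ℝ ⊤ fun z : Cn n => x₀ + R • z := by fun_prop
  refine ⟨contDiffOn_const.mul (hu.comp (haff.of_le le_top).contDiffOn hmaps),
    hf.comp (haff.of_le le_top).contDiffOn hmaps, fun z hz => ?_, fun z hz => ?_, fun z hz => ?_,
    fun z hz => ?_⟩
  · rw [complexHessian_rescale x₀ hR.ne']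
    exact hmem _ (hmaps z hz)
  · rw [complexHessian_rescale x₀ hR.ne']
    exact hdet _ (hmaps z hz)
  · rw [fderiv_comp_add_smul, norm_smul, Real.norm_of_nonneg hR.le]
    exact (mul_le_mul_of_nonneg_left (hf1 _ (hmaps z hz)) hR.le).trans hM₃
  · rw [fderiv_fderiv_comp_add_smul]
    refine (@norm_smul ℝ (Cn n →L[ℝ] Cn n →L[ℝ] ℝ) _ _ _ NormedSpace.toNormSMulClass
      (R ^ 2) _).trans_le ?_
    rw [Real.norm_of_nonneg (sq_nonneg R)]
    exact (mul_le_mul_of_nonneg_left (hf2 _ (hmaps z hz)) (sq_nonneg R)).trans hM₄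

lemma IsMASolution.rescale {lam T κ R : ℝ} {u f : Cn n → ℝ} (h : IsMASolution n lam T κ u f)
    (hR : 0 < R) {x₀ : Cn n} (hsub : ball x₀ (2 * R) ⊆ ball 0 2) :
    IsMASolution n lam T (R * κ) (rescale x₀ R u) (fun z => f (x₀ + R • z)) :=
  IsMASolution.of_bounds h.contDiffOn h.contDiffOn_rhs h.mem h.det_eq h.norm_fderiv_rhs_le
    h.norm_fderiv_fderiv_rhs_le hR le_rfl (by rw [mul_pow]) hsub

lemma IsMASolution.bound_nonneg {lam T κ : ℝ} {u f : Cn n → ℝ} (h : IsMASolution n lam T κ u f) :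
    0 ≤ κ :=
  (norm_nonneg _).trans (h.norm_fderiv_rhs_le 0 (mem_ball_self two_pos))

lemma IsMASolution.mono {lam T κ κ' : ℝ} {u f : Cn n → ℝ} (h : IsMASolution n lam T κ u f)
    (hκ : κ ≤ κ') : IsMASolution n lam T κ' u f :=
  ⟨h.contDiffOn, h.contDiffOn_rhs, h.mem, h.det_eq,
    fun z hz => (h.norm_fderiv_rhs_le z hz).trans hκ,
    fun z hz => (h.norm_fderiv_fderiv_rhs_le z hz).trans
      (pow_le_pow_left₀ h.bound_nonneg hκ 2)⟩

lemma IsMASolution.abs_rhs_sub_le {lam T κ : ℝ} {u f : Cn n → ℝ}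
    (h : IsMASolution n lam T κ u f) {x y : Cn n} (hx : x ∈ ball (0 : Cn n) 2)
    (hy : y ∈ ball (0 : Cn n) 2) : |f x - f y| ≤ 4 * κ := by
  have h1 := (convex_ball (0 : Cn n) 2).norm_image_sub_le_of_norm_fderiv_le (𝕜 := ℝ)
    (fun z hz => differentiableAt_of_contDiffOn isOpen_ball one_le_two h.contDiffOn_rhs hz)
    h.norm_fderiv_rhs_le hy hx
  have h2 : ‖x - y‖ ≤ 4 := by
    rw [mem_ball_zero_iff] at hx hy
    linarith [norm_sub_le x y]
  calc |f x - f y| ≤ κ * ‖x - y‖ := h1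
    _ ≤ κ * 4 := by gcongr; exact h.bound_nonneg
    _ = _ := mul_comm _ _

end Rescaling

section SecondDerivativeAlgebra

open Complex Matrix
open scoped ComplexConjugate

attribute [local instance] Matrix.normedAddCommGroup Matrix.normedSpace

variable {n : ℕ}

lemma D2_add {U : Set (Cn n)} (hU : IsOpen U) {v w : Cn n → ℝ} (hv : ContDiffOn ℝ 2 v U)
    (hw : ContDiffOn ℝ 2 w U) {z : Cn n} (hz : z ∈ U) (e e' : Cn n) :
    D2 (fun y => v y + w y) z e e' = D2 v z e e' + D2 w z e e' := by
  rw [D2_eq_pd hU (hv.add hw) hz, D2_eq_pd hU hv hz, D2_eq_pd hU hw hz]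
  have h1 : ∀ y ∈ U, pd e' (fun y => v y + w y) y = pd e' v y + pd e' w y := fun y hy => by
    have h1 := differentiableAt_of_contDiffOn hU one_le_two hv hy
    have h2 := differentiableAt_of_contDiffOn hU one_le_two hw hy
    simp only [pd]
    rw [fderiv_fun_add h1 h2, _root_.add_apply]
  rw [pd_congr hU h1 e z hz]
  have h2 := differentiableAt_of_contDiffOn hU le_rfl
    (contDiffOn_pd hU (k := 1) (by norm_num) hv e') hz
  have h3 := differentiableAt_of_contDiffOn hU le_rfl
    (contDiffOn_pd hU (k := 1) (by norm_num) hw e') hz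
  unfold pd at h2 h3 ⊢
  rw [fderiv_fun_add h2 h3, _root_.add_apply]

lemma maOp_add (b : Matrix (Fin n) (Fin n) ℂ) {U : Set (Cn n)} (hU : IsOpen U) {v w : Cn n → ℝ}
    (hv : ContDiffOn ℝ 2 v U) (hw : ContDiffOn ℝ 2 w U) {z : Cn n} (hz : z ∈ U) :
    maOp b (fun y => v y + w y) z = maOp b v z + maOp b w z := by
  simp only [maOp, realHess, D2_add hU hv hw hz, mul_add, Finset.sum_add_distrib]

lemma maOp_const_mul (b : Matrix (Fin n) (Fin n) ℂ) (t : ℝ) (v : Cn n → ℝ) (z : Cn n) :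
    maOp b (fun y => t * v y) z = t * maOp b v z := by
  simp only [maOp, realHess, D2_const_mul, Finset.mul_sum]
  exact Finset.sum_congr rfl fun α _ => Finset.sum_congr rfl fun β _ => by ring

/-- The real coordinates as continuous linear functionals. -/
def realCoordL (α : Fin n × Fin 2) : Cn n →L[ℝ] ℝ :=
  LinearMap.toContinuousLinearMap
    { toFun := fun x => realCoord x α
      map_add' := fun x y => by
        obtain ⟨i, s⟩ := α
        fin_cases s <;> simp [realCoord]
      map_smul' := fun t x => by
        obtain ⟨i, s⟩ := α
        fin_cases s <;> simp [realCoord] }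

lemma realCoordL_apply (α : Fin n × Fin 2) (x : Cn n) : realCoordL α x = realCoord x α := rfl

lemma realCoord_realDir (α β : Fin n × Fin 2) :
    realCoord (realDir β : Cn n) α = if α = β then 1 else 0 := by
  obtain ⟨i, s⟩ := α
  obtain ⟨j, t⟩ := β
  by_cases hij : i = j
  · subst hij
    fin_cases s <;> fin_cases t <;> simp [realCoord, realDir, unitC]
  · fin_cases s <;> simp [realCoord, realDir, unitC, hij]

lemma D2_norm_sq (z e e' : Cn n) :
    D2 (fun y => ‖y‖ ^ 2) z e e' = 2 * ∑ α, realCoord e α * realCoord e' α := by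
  have h1 : fderiv ℝ (fun y : Cn n => ‖y‖ ^ 2)
      = (∑ α, (2 : ℝ) • (realCoordL α).smulRight (realCoordL α) : Cn n →L[ℝ] (Cn n →L[ℝ] ℝ)) := by
    funext y
    have h2 : (fun y : Cn n => ‖y‖ ^ 2) = fun y => ∑ α, realCoordL α y ^ 2 :=
      funext fun y => (sum_realCoord_sq y).symm
    have h3 : HasFDerivAt (fun y : Cn n => ∑ α, realCoordL α y ^ 2) _ y :=
      HasFDerivAt.fun_sum fun α (_ : α ∈ Finset.univ) => (realCoordL α).hasFDerivAt.pow 2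
    rw [h2, h3.fderiv, _root_.sum_apply]
    refine Finset.sum_congr rfl fun α _ => ?_
    ext x
    simp
    ring
  rw [D2, h1, ContinuousLinearMap.fderiv, _root_.sum_apply, _root_.sum_apply, Finset.mul_sum]
  refine Finset.sum_congr rfl fun α _ => ?_
  simp [realCoordL_apply]

lemma contDiff_norm_sq' {k : WithTop ℕ∞} : ContDiff ℝ k fun y : Cn n => ‖y‖ ^ 2 := by
  rw [show (fun y : Cn n => ‖y‖ ^ 2) = fun y => ∑ α, realCoordL α y ^ 2 from
    funext fun y => (sum_realCoord_sq y).symm]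
  exact ContDiff.sum fun α _ => (realCoordL α).contDiff.pow 2

lemma maOp_norm_sq (b : Matrix (Fin n) (Fin n) ℂ) (z : Cn n) :
    maOp b (fun y => ‖y‖ ^ 2) z = 2 * ∑ α, realCoef b α α := by
  simp only [maOp, realHess, D2_norm_sq, realCoord_realDir]
  rw [Finset.mul_sum]
  refine Finset.sum_congr rfl fun α _ => ?_
  simp
  ring

/-- The Hermitian form of the complex Hessian is an average of two pure second derivatives. -/
lemma exists_hermForm_complexHessian (ξ : Fin n → ℂ) : ∃ e₁ e₂ : Cn n, ∀ (u : Cn n → ℝ) (z : Cn n),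
    hermForm (complexHessian u z) ξ = (1/4) * (D2 u z e₁ e₁ + D2 u z e₂ e₂) := by
  set ζ : Fin n × Fin 2 → ℂ := fun α => ξ α.1 * unitC α.2 with hζ
  refine ⟨∑ α, (ζ α).re • realDir α, ∑ α, (ζ α).im • realDir α, fun u z => ?_⟩
  have hD : ∀ X : Fin n × Fin 2 → ℝ, D2 u z (∑ α, X α • realDir α) (∑ α, X α • realDir α)
      = ∑ α, ∑ β, X α * X β * realHess u z α β := fun X => by
    simp only [D2, map_sum, map_smul, _root_.sum_apply, _root_.smul_apply, smul_eq_mul,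
      Finset.mul_sum]
    refine (Finset.sum_comm).trans (Finset.sum_congr rfl fun α _ => Finset.sum_congr rfl fun β _ => ?_)
    rw [realHess, D2]
    ring
  rw [hD, hD, ← Finset.sum_add_distrib, hermForm, complexHessian_eq_hessC]
  have h1 : star ξ ⬝ᵥ (hessC (fun α β => D2 u z (realDir α) (realDir β)) *ᵥ ξ)
      = (1/4) * ∑ α, ∑ β, conj (ζ α) * ζ β * ((realHess u z α β : ℝ) : ℂ) := by
    simp only [dotProduct, mulVec, hessC, Pi.star_apply, Fintype.sum_prod_type, Finset.mul_sum,
      Finset.sum_mul]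
    refine Finset.sum_congr rfl fun i _ => ?_
    refine Finset.sum_comm.trans (Finset.sum_congr rfl fun s _ => Finset.sum_congr rfl fun j _ =>
      Finset.sum_congr rfl fun t _ => ?_)
    simp only [hζ, map_mul, starRingEnd_apply, realHess]
    ring
  rw [h1, show (1 / 4 : ℂ) = ((1 / 4 : ℝ) : ℂ) by push_cast; rfl, re_ofReal_mul, re_sum]
  congr 1
  refine Finset.sum_congr rfl fun α _ => ?_
  rw [re_sum, ← Finset.sum_add_distrib]
  refine Finset.sum_congr rfl fun β _ => ?_
  rw [re_mul_ofReal, mul_re, conj_re, conj_im]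
  ring

end SecondDerivativeAlgebra

section EvansKrylov

open Complex Matrix
open scoped ComplexConjugate

attribute [local instance] Matrix.normedAddCommGroup Matrix.normedSpace

variable {n : ℕ} {lam T : ℝ}

lemma exists_hermForm_subsolution (hn : n ≠ 0) (hlam : 0 < lam) (T : ℝ) (ξ : Fin n → ℂ) :
    ∃ K₀, 0 ≤ K₀ ∧ ∀ K, K₀ ≤ K → ∀ κ u f, IsMASolution n lam T κ u f →
      ∀ z ∈ ball (0 : Cn n) 2, 0 ≤ maOp (complexHessian u z).adjugate
        (fun y => hermForm (complexHessian u y) ξ + K * κ ^ 2 * ‖y‖ ^ 2) z := by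
  obtain ⟨e₁, e₂, he⟩ := exists_hermForm_complexHessian ξ
  obtain ⟨c, Lam, hc, -, hcL⟩ := exists_ellipticity hlam T n
  set S := (1/4) * ((1 + 1 / lam) * (‖e₁‖ ^ 2 + ‖e₂‖ ^ 2)) with hS
  have hS0 : 0 ≤ S := by positivity
  refine ⟨S / c, by positivity, fun K hK κ u f h z hz => ?_⟩
  have hc4 : ∀ e, ContDiffOn ℝ 2 (pd e (pd e u)) (ball 0 2) := fun e =>
    contDiffOn_pd isOpen_ball (by norm_num)
      (contDiffOn_pd (k := 3) isOpen_ball (by norm_num) h.contDiffOn e) e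
  have hcong : ∀ y ∈ ball (0 : Cn n) 2,
      hermForm (complexHessian u y) ξ + K * κ ^ 2 * ‖y‖ ^ 2
        = (1/4) * (pd e₁ (pd e₁ u) y + pd e₂ (pd e₂ u) y) + K * κ ^ 2 * ‖y‖ ^ 2 := fun y hy => by
    rw [he, D2_eq_pd isOpen_ball (h.contDiffOn.of_le (by norm_num)) hy,
      D2_eq_pd isOpen_ball (h.contDiffOn.of_le (by norm_num)) hy]
  have hop : maOp (complexHessian u z).adjugate
      (fun y => hermForm (complexHessian u y) ξ + K * κ ^ 2 * ‖y‖ ^ 2) z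
      = maOp (complexHessian u z).adjugate (fun y =>
        (1/4) * (pd e₁ (pd e₁ u) y + pd e₂ (pd e₂ u) y) + K * κ ^ 2 * ‖y‖ ^ 2) z := by
    have hev : (fun y => hermForm (complexHessian u y) ξ + K * κ ^ 2 * ‖y‖ ^ 2)
        =ᶠ[nhds z] fun y => (1/4) * (pd e₁ (pd e₁ u) y + pd e₂ (pd e₂ u) y)
          + K * κ ^ 2 * ‖y‖ ^ 2 := by
      filter_upwards [isOpen_ball.mem_nhds hz] with y hy using hcong y hy
    simp only [maOp, realHess, D2]
    rw [hev.fderiv.fderiv_eq]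
  rw [hop, maOp_add _ isOpen_ball (contDiffOn_const.mul ((hc4 e₁).add (hc4 e₂)))
    (contDiffOn_const.mul contDiff_norm_sq'.contDiffOn) hz, maOp_const_mul, maOp_const_mul,
    maOp_add _ isOpen_ball (hc4 e₁) (hc4 e₂) hz, maOp_norm_sq]
  have hsum : c ≤ ∑ α, realCoef (complexHessian u z).adjugate α α := by
    have h1 : ∀ α, c ≤ realCoef (complexHessian u z).adjugate α α := fun α => by
      have := (hcL _ (h.mem z hz)).1 (Pi.single α 1)
      simpa [Pi.single_apply] using this
    have h2 : c ≤ realCoef (complexHessian u z).adjugate (⟨0, by omega⟩, 0) (⟨0, by omega⟩, 0) :=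
      h1 _
    exact h2.trans (Finset.single_le_sum (f := fun α => realCoef (complexHessian u z).adjugate α α)
      (fun α _ => hc.le.trans (h1 α)) (Finset.mem_univ _))
  have h1 := h.neg_le_maOp_pd_pd hlam e₁ hz
  have h2 := h.neg_le_maOp_pd_pd hlam e₂ hz
  have h3 : S ≤ K * c := (div_le_iff₀ hc).1 hK
  have hK0 : 0 ≤ K := (by positivity : 0 ≤ S / c).trans hK
  have h4 : S * κ ^ 2 ≤ K * κ ^ 2 * (2 * ∑ α, realCoef (complexHessian u z).adjugate α α) := by
    calc S * κ ^ 2 ≤ K * c * κ ^ 2 := by gcongr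
      _ = K * κ ^ 2 * c := by ring
      _ ≤ _ := by
        gcongr
        linarith
  have h5 : S * κ ^ 2 = (1/4) * ((1 + 1 / lam) * κ ^ 2 * ‖e₁‖ ^ 2
      + (1 + 1 / lam) * κ ^ 2 * ‖e₂‖ ^ 2) := by rw [hS]; ring
  linarith

lemma exists_finite_pieces (lam T : ℝ) (Ξ : Finset (Fin n → ℂ)) {ε : ℝ} (hε : 0 < ε) :
    ∃ t : Finset (Matrix (Fin n) (Fin n) ℂ), ∀ A ∈ admissible n lam T, ∃ p ∈ t,
      ∀ ξ ∈ Ξ, |hermForm A ξ - hermForm p ξ| < ε := by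
  have hopen : ∀ p : Matrix (Fin n) (Fin n) ℂ,
      IsOpen {A : Matrix (Fin n) (Fin n) ℂ | ∀ ξ ∈ Ξ, |hermForm A ξ - hermForm p ξ| < ε} :=
    fun p => by
      have : {A : Matrix (Fin n) (Fin n) ℂ | ∀ ξ ∈ Ξ, |hermForm A ξ - hermForm p ξ| < ε}
          = ⋂ ξ ∈ Ξ, {A | |hermForm A ξ - hermForm p ξ| < ε} := by
        ext A
        simp
      rw [this]
      exact isOpen_biInter_finset fun ξ _ =>
        isOpen_lt ((continuous_hermForm ξ).sub continuous_const).abs continuous_const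
  obtain ⟨t, ht⟩ := (isCompact_admissible n lam T).elim_nhds_subcover'
    (fun p _ => {A | ∀ ξ ∈ Ξ, |hermForm A ξ - hermForm p ξ| < ε})
    (fun p _ => (hopen p).mem_nhds fun ξ _ => by simpa using hε)
  classical
  refine ⟨t.image Subtype.val, fun A hA => ?_⟩
  obtain ⟨p, hp, hAp⟩ := mem_iUnion₂.1 (ht hA)
  exact ⟨p, Finset.mem_image_of_mem _ hp, hAp⟩

/-- Either the complex Hessian is nearly constant, or one of finitely many quantities decreases
by a fixed amount on a smaller ball. -/
lemma exists_oscillation_alternative (hn : n ≠ 0) (hlam : 0 < lam) (T : ℝ) {θ : ℝ} (hθ : 0 < θ) :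
    ∃ (Ξ : Finset (Fin n → ℂ)) (κ₀ δ : ℝ), 0 < κ₀ ∧ 0 < δ ∧ ∀ κ u f,
      IsMASolution n lam T κ u f → κ ≤ κ₀ →
      (∃ p, ∀ y ∈ ball (0 : Cn n) 2, ‖complexHessian u y - p‖ < θ) ∨
      ∃ ξ ∈ Ξ, ∀ m, (∀ x ∈ ball (0 : Cn n) 2, hermForm (complexHessian u x) ξ ≤ m) →
        ∀ x ∈ ball (0 : Cn n) (1 / 2), hermForm (complexHessian u x) ξ ≤ m - δ := by
  classical
  set μ : Measure (Cn n) := Measure.addHaar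
  obtain ⟨Ξ, c, hc, hsep⟩ := exists_separating_forms (n := n) hlam T hθ
  obtain ⟨t, ht⟩ := exists_finite_pieces lam T Ξ (ε := c / 8) (by positivity)
  set V := μ.real (closedBall (0 : Cn n) (3 / 4)) with hV
  have hVfin : μ (closedBall (0 : Cn n) (3 / 4)) ≠ ⊤ :=
    (isCompact_closedBall (0 : Cn n) (3 / 4)).measure_lt_top.ne
  have hVpos : 0 < V := ENNReal.toReal_pos (measure_closedBall_pos μ _ (by norm_num)).ne' hVfin
  have hμ₀ : 0 < V / (t.card + 1) := by positivity
  obtain ⟨c₀, hc₀, hgrow⟩ := IsMASolution.maOp_growth hn hlam T hμ₀ μ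
  choose K₀ hK₀ hsubs using fun ξ : Fin n → ℂ => exists_hermForm_subsolution hn hlam T ξ
  set K := ∑ ξ ∈ Ξ, K₀ ξ with hK
  have hK0 : 0 ≤ K := Finset.sum_nonneg fun ξ _ => hK₀ ξ
  have hKξ : ∀ ξ ∈ Ξ, K₀ ξ ≤ K := fun ξ hξ =>
    Finset.single_le_sum (fun ξ _ => hK₀ ξ) hξ
  obtain ⟨κ₀, hκ₀, hκ₀1, hκ₀2, hκ₀3⟩ : ∃ κ₀ > 0, 4 * κ₀ < c ∧ 4 * (K * κ₀ ^ 2) ≤ c₀ * c / 4 ∧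
      K * κ₀ ^ 2 ≤ c / 4 := by
    have h1 : Filter.Tendsto (fun κ : ℝ => 4 * κ) (nhdsWithin 0 (Ioi 0)) (nhds 0) := by
      have : Continuous fun κ : ℝ => 4 * κ := by fun_prop
      simpa using (this.tendsto 0).mono_left nhdsWithin_le_nhds
    have h2 : Filter.Tendsto (fun κ : ℝ => 4 * (K * κ ^ 2)) (nhdsWithin 0 (Ioi 0)) (nhds 0) := by
      have : Continuous fun κ : ℝ => 4 * (K * κ ^ 2) := by fun_prop
      simpa using (this.tendsto 0).mono_left nhdsWithin_le_nhds
    have h3 : Filter.Tendsto (fun κ : ℝ => K * κ ^ 2) (nhdsWithin 0 (Ioi 0)) (nhds 0) := by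
      have : Continuous fun κ : ℝ => K * κ ^ 2 := by fun_prop
      simpa using (this.tendsto 0).mono_left nhdsWithin_le_nhds
    obtain ⟨κ, h⟩ := ((h1.eventually_lt_const hc).and ((h2.eventually_le_const
      (by positivity : 0 < c₀ * c / 4)).and ((h3.eventually_le_const
      (by positivity : 0 < c / 4)).and self_mem_nhdsWithin))).exists
    exact ⟨κ, h.2.2.2, h.1, h.2.1, h.2.2.1⟩
  refine ⟨Ξ, κ₀, c₀ * c / 4, hκ₀, by positivity, fun κ u f h hκ => ?_⟩
  have hκ0 := h.bound_nonneg
  have hKκ : K * κ ^ 2 ≤ K * κ₀ ^ 2 := by gcongr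
  have hKκ0 : 0 ≤ K * κ ^ 2 := by positivity
  have hmem2 : ∀ x ∈ closedBall (0 : Cn n) (3 / 4), x ∈ ball (0 : Cn n) 2 := fun x hx =>
    closedBall_subset_ball (by norm_num) hx
  -- a piece of the ball of substantial measure on which the Hessian is nearly constant
  obtain ⟨p₀, hp₀, hpiece⟩ : ∃ p₀ ∈ t, V / (t.card + 1) ≤ μ.real {x | x ∈ closedBall (0 : Cn n) (3/4) ∧
      ∀ ξ ∈ Ξ, |hermForm (complexHessian u x) ξ - hermForm p₀ ξ| < c / 8} := by
    by_contra! hcon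
    have hcov : closedBall (0 : Cn n) (3 / 4) ⊆ ⋃ p ∈ t, {x | x ∈ closedBall (0 : Cn n) (3/4) ∧
        ∀ ξ ∈ Ξ, |hermForm (complexHessian u x) ξ - hermForm p ξ| < c / 8} := fun x hx => by
      obtain ⟨p, hp, hxp⟩ := ht _ (h.mem x (hmem2 x hx))
      exact mem_iUnion₂.2 ⟨p, hp, hx, hxp⟩
    have h1 : V ≤ ∑ p ∈ t, μ.real {x | x ∈ closedBall (0 : Cn n) (3/4) ∧
        ∀ ξ ∈ Ξ, |hermForm (complexHessian u x) ξ - hermForm p ξ| < c / 8} := by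
      refine (measureReal_mono hcov ?_).trans (measureReal_biUnion_finset_le _ _)
      refine ne_top_of_le_ne_top hVfin (measure_mono (iUnion₂_subset fun p _ x hx => hx.1))
    have h2 : V ≤ ∑ p ∈ t, V / (t.card + 1) :=
      h1.trans (Finset.sum_le_sum fun p hp => (hcon p hp).le)
    rw [Finset.sum_const, nsmul_eq_mul, mul_div_assoc', le_div_iff₀ (by positivity)] at h2
    nlinarith
  have hne : {x | x ∈ closedBall (0 : Cn n) (3/4) ∧
      ∀ ξ ∈ Ξ, |hermForm (complexHessian u x) ξ - hermForm p₀ ξ| < c / 8}.Nonempty := by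
    by_contra hcon
    rw [not_nonempty_iff_eq_empty] at hcon
    rw [hcon, measureReal_empty] at hpiece
    exact hμ₀.not_ge hpiece
  obtain ⟨x₁, hx₁, hx₁p⟩ := hne
  by_cases hosc : ∀ y ∈ ball (0 : Cn n) 2, ‖complexHessian u y - complexHessian u x₁‖ < θ
  · exact Or.inl ⟨_, hosc⟩
  right
  push Not at hosc
  obtain ⟨y, hy, hyθ⟩ := hosc
  rw [norm_sub_rev] at hyθ
  rcases hsep _ (h.mem x₁ (hmem2 x₁ hx₁)) _ (h.mem y hy) hyθ with hdet | ⟨ξ, hξ, hyξ⟩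
  · rw [h.det_eq _ (hmem2 x₁ hx₁), h.det_eq _ hy, ofReal_re, ofReal_re] at hdet
    have := h.abs_rhs_sub_le (hmem2 x₁ hx₁) hy
    linarith
  refine ⟨ξ, hξ, fun m hm x hx => ?_⟩
  have hsmooth : ContDiffOn ℝ 2 (fun y => hermForm (complexHessian u y) ξ
      + K * κ ^ 2 * ‖y‖ ^ 2) (ball 0 2) := by
    refine ContDiffOn.add ?_ (contDiffOn_const.mul contDiff_norm_sq'.contDiffOn)
    have : ContDiff ℝ 2 fun A : Matrix (Fin n) (Fin n) ℂ => hermForm A ξ := by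
      unfold hermForm
      simp only [dotProduct, mulVec]
      exact Complex.reCLM.contDiff.comp (ContDiff.sum fun i _ => contDiff_const.mul
        (ContDiff.sum fun j _ => (contDiff_apply_apply ℝ ℂ i j).mul contDiff_const))
    exact this.comp_contDiffOn h.contDiffOn_hessian
  have hkey := hgrow κ u f h _ hsmooth (fun z hz => hsubs ξ K (hKξ ξ hξ) κ u f h z
    (ball_subset_ball one_le_two hz)) (m + 4 * (K * κ ^ 2)) (c / 2) (by positivity) ?_ ?_ x hx
  · have : 0 ≤ K * κ ^ 2 * ‖x‖ ^ 2 := by positivity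
    linarith
  · intro z hz
    have h1 : ‖z‖ ^ 2 ≤ 4 := by
      rw [mem_ball_zero_iff] at hz
      nlinarith [norm_nonneg z]
    have h2 : K * κ ^ 2 * ‖z‖ ^ 2 ≤ K * κ ^ 2 * 4 := by gcongr
    linarith [hm z hz]
  · refine hpiece.trans (measureReal_mono (fun z hz => ⟨hz.1, ?_⟩) ?_)
    · have h1 : ‖z‖ ^ 2 ≤ 1 := by
        have := mem_closedBall_zero_iff.1 hz.1
        nlinarith [norm_nonneg z]
      have h2 : K * κ ^ 2 * ‖z‖ ^ 2 ≤ K * κ ^ 2 * 1 := by gcongr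
      have h3 := abs_lt.1 (hz.2 ξ hξ)
      have h4 := abs_lt.1 (hx₁p ξ hξ)
      have h5 := hm y hy
      linarith [h3.1, h3.2, h4.1, h4.2]
    · exact ne_top_of_le_ne_top hVfin (measure_mono fun z hz => hz.1)

/-- Interior smallness of the oscillation of the complex Hessian. -/
lemma exists_oscillation_le (hn : n ≠ 0) (hlam : 0 < lam) (T : ℝ) {θ : ℝ} (hθ : 0 < θ) :
    ∃ ρ κ₀ : ℝ, 0 < ρ ∧ ρ ≤ 1 ∧ 0 < κ₀ ∧ ∀ κ u f, IsMASolution n lam T κ u f → κ ≤ κ₀ →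
      ∀ x ∈ ball (0 : Cn n) (2 * ρ), ∀ y ∈ ball (0 : Cn n) (2 * ρ),
        ‖complexHessian u x - complexHessian u y‖ ≤ θ := by
  classical
  obtain ⟨Ξ, κ₀, δ, hκ₀, hδ, halt⟩ :=
    exists_oscillation_alternative (n := n) hn hlam T (half_pos hθ)
  have hstep : ∀ N : ℕ, ∀ M : (Fin n → ℂ) → ℝ, ∑ ξ ∈ Ξ, M ξ ≤ N * δ → ∀ κ u f,
      IsMASolution n lam T κ u f → κ ≤ κ₀ →
      (∀ ξ ∈ Ξ, ∀ x ∈ ball (0 : Cn n) 2, hermForm (complexHessian u x) ξ ≤ M ξ) →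
      ∃ p, ∀ x ∈ ball (0 : Cn n) (2 * (1/4) ^ N), ‖complexHessian u x - p‖ < θ / 2 := by
    intro N
    induction N with
    | zero =>
      intro M hM κ u f h hκ hle
      rcases halt κ u f h hκ with ⟨p, hp⟩ | ⟨ξ, hξ, hdrop⟩
      · exact ⟨p, by simpa using hp⟩
      · have h0 : ∀ ξ, 0 ≤ hermForm (complexHessian u 0) ξ := fun ξ =>
          hermForm_nonneg (h.mem 0 (mem_ball_self two_pos)).1 ξ
        have h1 := hdrop (M ξ) (hle ξ hξ) 0 (mem_ball_self (by norm_num))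
        have h2 : M ξ ≤ ∑ ξ ∈ Ξ, M ξ := Finset.single_le_sum
          (fun ξ hξ => (h0 ξ).trans (hle ξ hξ 0 (mem_ball_self two_pos))) hξ
        have h3 := h0 ξ
        simp only [Nat.cast_zero, zero_mul] at hM
        linarith
    | succ N ih =>
      intro M hM κ u f h hκ hle
      rcases halt κ u f h hκ with ⟨p, hp⟩ | ⟨ξ, hξ, hdrop⟩
      · refine ⟨p, fun x hx => hp x (ball_subset_ball ?_ hx)⟩
        have : ((1:ℝ)/4) ^ (N + 1) ≤ 1 := pow_le_one₀ (by norm_num) (by norm_num)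
        linarith
      · have hsub : ball (0 : Cn n) (2 * (1/4)) ⊆ ball 0 2 := ball_subset_ball (by norm_num)
        have h' := h.rescale (R := 1/4) (by norm_num) hsub
        have hκ' : 1/4 * κ ≤ κ₀ := by linarith [h.bound_nonneg]
        have hsum : ∑ ζ ∈ Ξ, (M ζ - if ζ = ξ then δ else 0) ≤ N * δ := by
          rw [Finset.sum_sub_distrib, Finset.sum_ite_eq' Ξ ξ, if_pos hξ]
          push_cast at hM
          linarith
        obtain ⟨p, hp⟩ := ih _ hsum _ _ _ h' hκ' fun ζ hζ x hx => by
          rw [complexHessian_rescale _ (by norm_num)]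
          have hx' := add_smul_mem_ball (x₀ := 0) (R := 1/4) (by norm_num) hx
          by_cases hζξ : ζ = ξ
          · rw [if_pos hζξ, hζξ]
            exact hdrop (M ξ) (hle ξ hξ) _ (by convert hx' using 2; norm_num)
          · rw [if_neg hζξ, sub_zero]
            exact hle ζ hζ _ (hsub hx')
        refine ⟨p, fun x hx => ?_⟩
        have h4 : (4 : ℝ) • x ∈ ball (0 : Cn n) (2 * (1/4) ^ N) := by
          rw [mem_ball_zero_iff] at hx ⊢
          rw [norm_smul, Real.norm_of_nonneg (by norm_num)]
          rw [pow_succ] at hx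
          linarith
        have h5 := hp _ h4
        rw [complexHessian_rescale _ (by norm_num), smul_smul] at h5
        simpa using h5
  have hbd : ∀ ξ : Fin n → ℂ, ∃ C, ∀ A ∈ admissible n lam T, hermForm A ξ ≤ C := fun ξ => by
    obtain ⟨C, hC⟩ := (isCompact_admissible n lam T).exists_bound_of_continuousOn
      (continuous_hermForm ξ).continuousOn
    exact ⟨C, fun A hA => (le_abs_self _).trans (hC A hA)⟩
  choose M hM using hbd
  obtain ⟨N, hN⟩ := exists_nat_ge ((∑ ξ ∈ Ξ, M ξ) / δ)
  refine ⟨(1/4) ^ N, κ₀, by positivity, pow_le_one₀ (by norm_num) (by norm_num), hκ₀,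
    fun κ u f h hκ x hx y hy => ?_⟩
  obtain ⟨p, hp⟩ := hstep N M ((div_le_iff₀ hδ).1 hN) κ u f h hκ fun ξ _ x hx => hM ξ _ (h.mem x hx)
  have h1 := hp x hx
  have h2 := hp y hy
  rw [norm_sub_rev] at h2
  have h3 := norm_add_le (complexHessian u x - p) (p - complexHessian u y)
  rw [sub_add_sub_cancel] at h3
  linarith

end EvansKrylov

section DoublingVariables

open Matrix Filter
open scoped Topology

variable {n : ℕ}

lemma le_two_mul_of_eventually_le {p p' : ℝ → ℝ} {a b q : ℝ}
    (hle : ∀ᶠ t in 𝓝 (0 : ℝ), p t ≤ p 0 + a * t + b * t ^ 2)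
    (hp : ∀ᶠ t in 𝓝 (0 : ℝ), HasDerivAt p (p' t) t) (hp' : HasDerivAt p' q 0) : q ≤ 2 * b := by
  by_contra! hq
  set h : ℝ → ℝ := fun t => p t - (p 0 + a * t + b * t ^ 2) with hh
  have h0 : h 0 = 0 := by simp [hh]
  have hd : ∀ᶠ t in 𝓝 (0 : ℝ), HasDerivAt h (p' t - (a + b * (2 * t))) t := by
    filter_upwards [hp] with t ht
    have h1 : HasDerivAt (fun t : ℝ => p 0 + a * t + b * t ^ 2) (a + b * (2 * t)) t := by
      have := (((hasDerivAt_id t).const_mul a).const_add (p 0)).add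
        (((hasDerivAt_id t).pow 2).const_mul b)
      simp only [id_eq, Nat.cast_ofNat, mul_one, Nat.add_one_sub_one, pow_one] at this
      exact this
    exact ht.sub h1
  have hd' : deriv h =ᶠ[𝓝 0] fun t => p' t - (a + b * (2 * t)) := hd.mono fun t ht => ht.deriv
  have hdd : deriv (deriv h) 0 = q - 2 * b := by
    rw [hd'.deriv_eq]
    have h1 : HasDerivAt (fun t : ℝ => a + b * (2 * t)) (b * 2) 0 := by
      simpa using (((hasDerivAt_id (0 : ℝ)).const_mul 2).const_mul b).const_add a
    have h2 : HasDerivAt (fun t => p' t - (a + b * (2 * t))) (q - b * 2) 0 := hp'.sub h1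
    rw [h2.deriv]
    ring
  have hmax : IsLocalMax h 0 := by
    filter_upwards [hle] with t ht
    rw [h0]
    simp only [hh]
    linarith
  have hmin : IsLocalMin h 0 := isLocalMin_of_deriv_deriv_pos (by rw [hdd]; linarith)
    hmax.deriv_eq_zero hd.self_of_nhds.continuousAt
  have hz : h =ᶠ[𝓝 0] fun _ => (0 : ℝ) := by
    filter_upwards [hmax, hmin] with t h1 h2
    rw [h0] at h1 h2
    exact le_antisymm h1 h2
  have := hz.deriv.deriv_eq
  rw [hdd] at this
  simp at this
  linarith

lemma exists_norm_add_smul_sq (x X : Cn n) :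
    ∃ l : ℝ, ∀ t : ℝ, ‖x + t • X‖ ^ 2 = ‖x‖ ^ 2 + 2 * l * t + ‖X‖ ^ 2 * t ^ 2 := by
  refine ⟨RCLike.re (inner ℂ x X), fun t => ?_⟩
  have h : (t • X : Cn n) = (t : ℂ) • X := by
    ext i
    simp
  rw [h, norm_add_sq (𝕜 := ℂ), inner_smul_right, norm_smul, mul_pow]
  simp
  ring

lemma hasDerivAt_line {U : Set (Cn n)} (hU : IsOpen U) {v : Cn n → ℝ} (hv : ContDiffOn ℝ 2 v U)
    {x : Cn n} (hx : x ∈ U) (X : Cn n) :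
    (∀ᶠ t in 𝓝 (0 : ℝ), HasDerivAt (fun t : ℝ => v (x + t • X)) (pd X v (x + t • X)) t) ∧
      HasDerivAt (fun t : ℝ => pd X v (x + t • X)) (D2 v x X X) 0 := by
  have hl : ∀ t : ℝ, HasDerivAt (fun t : ℝ => x + t • X) X t := fun t => by
    simpa using ((hasDerivAt_id t).smul_const X).const_add x
  have hc : ContinuousAt (fun t : ℝ => x + t • X) 0 := (hl 0).continuousAt
  refine ⟨?_, ?_⟩
  · have : ∀ᶠ t in 𝓝 (0 : ℝ), x + t • X ∈ U :=
      hc.preimage_mem_nhds (hU.mem_nhds (by simpa using hx))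
    filter_upwards [this] with t ht
    exact (differentiableAt_of_contDiffOn hU one_le_two hv ht).hasFDerivAt.comp_hasDerivAt t (hl t)
  · have h1 : DifferentiableAt ℝ (pd X v) (x + (0 : ℝ) • X) :=
      differentiableAt_of_contDiffOn hU le_rfl (contDiffOn_pd hU (k := 1) (by norm_num) hv X)
        (by simpa using hx)
    have h2 := h1.hasFDerivAt.comp_hasDerivAt (0 : ℝ) (hl 0)
    rw [D2_eq_pd hU hv hx]
    rw [zero_smul, add_zero] at h2
    exact h2

/-- The penalized doubled function. -/
def doubled (K A β : ℝ) (v : Cn n → ℝ) (x y : Cn n) : ℝ :=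
  v x - v y - K * (‖x - y‖ - β * ‖x - y‖ ^ 2) - A * (‖x‖ ^ 2 + ‖y‖ ^ 2)

lemma D2_sub_D2_le {U : Set (Cn n)} (hU : IsOpen U) {v : Cn n → ℝ} (hv : ContDiffOn ℝ 2 v U)
    {x y : Cn n} (hx : x ∈ U) (hy : y ∈ U) {K A β g₁ g₂ : ℝ} (hK : 0 ≤ K) {X Y : Cn n}
    (hmax : ∀ᶠ t in 𝓝 (0 : ℝ),
      doubled K A β v (x + t • X) (y + t • Y) ≤ doubled K A β v x y)
    (hφ : ∀ᶠ t in 𝓝 (0 : ℝ), ‖x + t • X - (y + t • Y)‖ - β * ‖x + t • X - (y + t • Y)‖ ^ 2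
      ≤ ‖x - y‖ - β * ‖x - y‖ ^ 2 + g₁ * t + g₂ * t ^ 2) :
    D2 v x X X - D2 v y Y Y ≤ 2 * (K * g₂ + A * (‖X‖ ^ 2 + ‖Y‖ ^ 2)) := by
  obtain ⟨l, hl⟩ := exists_norm_add_smul_sq x X
  obtain ⟨l', hl'⟩ := exists_norm_add_smul_sq y Y
  obtain ⟨h1, h2⟩ := hasDerivAt_line hU hv hx X
  obtain ⟨h3, h4⟩ := hasDerivAt_line hU hv hy Y
  refine le_two_mul_of_eventually_le (p := fun t => v (x + t • X) - v (y + t • Y))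
    (p' := fun t => pd X v (x + t • X) - pd Y v (y + t • Y))
    (a := K * g₁ + A * (2 * l + 2 * l')) ?_ ?_ (h2.sub h4)
  · filter_upwards [hmax, hφ] with t ht hφt
    have := mul_le_mul_of_nonneg_left hφt hK
    simp only [doubled, hl, hl'] at ht
    simp only [zero_smul, add_zero]
    linarith
  · filter_upwards [h1, h3] with t h1 h3 using h1.sub h3

lemma apply_sum_smul_realDir (Q : Cn n →L[ℝ] Cn n →L[ℝ] ℝ) (X Y : Fin n × Fin 2 → ℝ) :
    Q (∑ α, X α • realDir α) (∑ β, Y β • realDir β)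
      = ∑ α, ∑ β, X α * Y β * Q (realDir α) (realDir β) := by
  simp only [map_sum, map_smul, _root_.sum_apply, _root_.smul_apply, smul_eq_mul, Finset.mul_sum]
  refine Finset.sum_comm.trans (Finset.sum_congr rfl fun α _ => Finset.sum_congr rfl fun β _ => ?_)
  ring

lemma sum_mul_form_le {N : Matrix (Fin n × Fin 2) (Fin n × Fin 2) ℝ}
    (hs : ∀ α β, N α β = N β α) (hN : ∀ X : Fin n × Fin 2 → ℝ, 0 ≤ ∑ α, ∑ β, N α β * (X α * X β))
    {Q : Cn n →L[ℝ] Cn n →L[ℝ] ℝ} {M : ℝ} (hQ : ∀ X, Q X X ≤ M * ‖X‖ ^ 2) :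
    ∑ α, ∑ β, N α β * Q (realDir α) (realDir β) ≤ M * ∑ α, N α α := by
  have hpsd : N.PosSemidef := by
    refine .of_dotProduct_mulVec_nonneg (Matrix.IsHermitian.ext fun α β => by simp [hs β α])
      fun X => ?_
    refine (hN X).trans (le_of_eq ?_)
    simp only [dotProduct, mulVec, Finset.mul_sum, Pi.star_apply, star_trivial]
    exact Finset.sum_congr rfl fun α _ => Finset.sum_congr rfl fun β _ => by ring
  obtain ⟨R, hR⟩ : ∃ R : Matrix (Fin n × Fin 2) (Fin n × Fin 2) ℝ, N = Rᴴ * R := by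
    open scoped MatrixOrder Matrix.Norms.L2Operator in
    obtain ⟨C, hC⟩ := CStarAlgebra.nonneg_iff_eq_star_mul_self.mp hpsd.nonneg
    exact ⟨C, by rw [hC, star_eq_conjTranspose]⟩
  have hR' : ∀ α β, N α β = ∑ k, R k α * R k β := fun α β => by
    rw [hR]
    simp [Matrix.mul_apply]
  set r : Fin n × Fin 2 → Cn n := fun k => ∑ α, R k α • realDir α with hr
  have hrc : ∀ k, ‖r k‖ ^ 2 = ∑ α, R k α * R k α := fun k => by
    rw [← sum_realCoord_sq]
    refine Finset.sum_congr rfl fun α _ => ?_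
    have : realCoord (r k) α = R k α := by
      rw [← realCoordL_apply, hr]
      simp only [map_sum, map_smul, realCoordL_apply, realCoord_realDir]
      simp
    rw [this, sq]
  have h1 : ∑ α, ∑ β, N α β * Q (realDir α) (realDir β) = ∑ k, Q (r k) (r k) := by
    simp only [hr, apply_sum_smul_realDir, hR', Finset.sum_mul]
    refine (Finset.sum_congr rfl fun α _ => Finset.sum_comm).trans ?_
    exact Finset.sum_comm
  have h2 : ∑ α, N α α = ∑ k, ‖r k‖ ^ 2 := by
    simp only [hrc, hR']
    exact Finset.sum_comm
  rw [h1, h2, Finset.mul_sum]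
  exact Finset.sum_le_sum fun k _ => hQ _

end DoublingVariables

section TwoPointInequality

variable {n : ℕ}

/-- The coupling of the second order conditions at the two points of the doubled function. -/
lemma sum_mul_sub_sum_mul_le {a b : Matrix (Fin n × Fin 2) (Fin n × Fin 2) ℝ}
    (ha : ∀ α β, a α β = a β α) (hb : ∀ α β, b α β = b β α) {c₀ Λ δ A B G : ℝ}
    (hlow : ∀ X : Fin n × Fin 2 → ℝ, c₀ * ∑ α, X α ^ 2 ≤ ∑ α, ∑ β, a α β * (X α * X β))
    (hup : ∀ α β, |a α β| ≤ Λ) (hab : ∀ α β, |a α β - b α β| ≤ δ) (hc₀ : 0 ≤ c₀) (hδ : 0 ≤ δ)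
    (hA : 0 ≤ A) (hB : 0 ≤ B) (hτ : Fintype.card (Fin n × Fin 2) * δ ≤ c₀ / 2)
    {Q₁ Q₂ : Cn n →L[ℝ] Cn n →L[ℝ] ℝ} {ζ : Cn n} (hζ : ‖ζ‖ = 1)
    (h₁ : ∀ X, Q₁ X X - Q₂ X X ≤ A * ‖X‖ ^ 2) (hζζ : Q₁ ζ ζ - Q₂ ζ ζ ≤ G)
    (h₃ : ∀ X, Q₁ X X ≤ B * ‖X‖ ^ 2) (h₄ : ∀ X, -Q₂ X X ≤ B * ‖X‖ ^ 2) :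
    ∑ α, ∑ β, a α β * Q₁ (realDir α) (realDir β) - ∑ α, ∑ β, b α β * Q₂ (realDir α) (realDir β)
      ≤ A * (Fintype.card (Fin n × Fin 2) * Λ) + c₀ / 2 * G
        + B * (3 * Fintype.card (Fin n × Fin 2) ^ 2 * δ) := by
  set N : ℝ := (Fintype.card (Fin n × Fin 2) : ℝ) with hN
  have hN0 : 0 ≤ N := Nat.cast_nonneg _
  set τ := N * δ with hτd
  have hτ0 : 0 ≤ τ := by positivity
  set z : Fin n × Fin 2 → ℝ := realCoord ζ with hz
  have hz1 : ∑ α, z α ^ 2 = 1 := by rw [hz, sum_realCoord_sq, hζ, one_pow]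
  set I : Matrix (Fin n × Fin 2) (Fin n × Fin 2) ℝ := fun α β => if α = β then 1 else 0 with hI
  have hIs : ∀ α β, I α β = I β α := fun α β => by simp [hI, eq_comm]
  have hIX : ∀ X : Fin n × Fin 2 → ℝ, ∑ α, ∑ β, I α β * (X α * X β) = ∑ α, X α ^ 2 := fun X => by
    simp [hI, sq]
  have hIt : ∑ α, I α α = N := by simp [hI, hN]
  have hsq : ∀ X : Fin n × Fin 2 → ℝ, 0 ≤ ∑ α, X α ^ 2 := fun X =>
    Finset.sum_nonneg fun _ _ => sq_nonneg _
  have e1 : ∑ α, ∑ β, (a α β - τ * I α β - c₀ / 2 * (z α * z β)) *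
      (Q₁ - Q₂) (realDir α) (realDir β) ≤ A * (N * Λ) := by
    refine (sum_mul_form_le (N := fun α β => a α β - τ * I α β - c₀ / 2 * (z α * z β))
      (fun α β => by rw [ha, hIs, mul_comm (z α)]) (fun X => ?_) (M := A) fun X => ?_).trans ?_
    · have h1 : ∑ α, ∑ β, (a α β - τ * I α β - c₀ / 2 * (z α * z β)) * (X α * X β)
          = ∑ α, ∑ β, a α β * (X α * X β) - τ * ∑ α, X α ^ 2
            - c₀ / 2 * (∑ α, z α * X α) ^ 2 := by
        rw [← hIX X, sq (∑ α, z α * X α), Finset.sum_mul_sum]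
        simp only [Finset.mul_sum, ← Finset.sum_sub_distrib]
        exact Finset.sum_congr rfl fun α _ => Finset.sum_congr rfl fun β _ => by ring
      rw [h1]
      have h2 : (∑ α, z α * X α) ^ 2 ≤ (∑ α, z α ^ 2) * ∑ α, X α ^ 2 :=
        Finset.sum_mul_sq_le_sq_mul_sq _ _ _
      rw [hz1, one_mul] at h2
      nlinarith [hlow X, mul_le_mul_of_nonneg_left h2 hc₀, mul_le_mul_of_nonneg_right hτ (hsq X)]
    · simpa using h₁ X
    · refine mul_le_mul_of_nonneg_left ?_ hA
      calc ∑ α, (a α α - τ * I α α - c₀ / 2 * (z α * z α)) ≤ ∑ _α : Fin n × Fin 2, Λ := by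
            refine Finset.sum_le_sum fun α _ => ?_
            have h1 : 0 ≤ τ * I α α := by simpa [hI] using hτ0
            have h2 : 0 ≤ c₀ / 2 * (z α * z α) := mul_nonneg (by linarith) (mul_self_nonneg _)
            linarith [(abs_le.1 (hup α α)).2]
        _ = N * Λ := by simp [hN]
  have e2 : ∑ α, ∑ β, (z α * z β) * (Q₁ - Q₂) (realDir α) (realDir β) ≤ G := by
    rw [← apply_sum_smul_realDir, hz, sum_realCoord_smul]
    exact hζζ
  have e3 : ∑ α, ∑ β, (τ * I α β) * Q₁ (realDir α) (realDir β) ≤ B * (N * τ) := by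
    refine (sum_mul_form_le (N := fun α β => τ * I α β) (fun α β => by rw [hIs]) (fun X => ?_)
      h₃).trans (le_of_eq ?_)
    · simp only [mul_assoc, ← Finset.mul_sum, hIX]
      exact mul_nonneg hτ0 (hsq X)
    · rw [← Finset.mul_sum, hIt, mul_comm τ]
  have e4 : ∑ α, ∑ β, (b α β - a α β + τ * I α β) * (-Q₂) (realDir α) (realDir β)
      ≤ B * (2 * (N * τ)) := by
    have hba : ∀ α β, |b α β - a α β| ≤ δ := fun α β => by rw [abs_sub_comm]; exact hab α β
    refine (sum_mul_form_le (N := fun α β => b α β - a α β + τ * I α β)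
      (fun α β => by rw [ha, hIs, hb]) (fun X => ?_) (M := B) fun X => ?_).trans ?_
    · have h1 : ∑ α, ∑ β, (b α β - a α β + τ * I α β) * (X α * X β)
          = ∑ α, ∑ β, (b α β - a α β) * (X α * X β) + τ * ∑ α, X α ^ 2 := by
        rw [← hIX X]
        simp only [Finset.mul_sum, ← Finset.sum_add_distrib]
        exact Finset.sum_congr rfl fun α _ => Finset.sum_congr rfl fun β _ => by ring
      have h2 : -(δ * (∑ α, |X α|) ^ 2) ≤ ∑ α, ∑ β, (b α β - a α β) * (X α * X β) := by
        rw [sq, Finset.sum_mul_sum, Finset.mul_sum, ← Finset.sum_neg_distrib]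
        refine Finset.sum_le_sum fun α _ => ?_
        rw [Finset.mul_sum, ← Finset.sum_neg_distrib]
        refine Finset.sum_le_sum fun β _ => ?_
        refine le_trans (neg_le_neg ?_) (neg_abs_le _)
        rw [abs_mul, abs_mul]
        exact mul_le_mul_of_nonneg_right (hba α β) (by positivity)
      have h3 : (∑ α, |X α|) ^ 2 ≤ N * ∑ α, X α ^ 2 := by
        have := sq_sum_le_card_mul_sum_sq (s := Finset.univ) (f := fun α => |X α|)
        simpa only [sq_abs, Finset.card_univ, hN] using this
      rw [h1]
      have := mul_le_mul_of_nonneg_left h3 hδ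
      have h5 : τ * ∑ α, X α ^ 2 = δ * (N * ∑ α, X α ^ 2) := by rw [hτd]; ring
      linarith
    · simpa using h₄ X
    · refine mul_le_mul_of_nonneg_left ?_ hB
      calc ∑ α, (b α α - a α α + τ * I α α) ≤ ∑ _α : Fin n × Fin 2, (δ + τ) := by
            refine Finset.sum_le_sum fun α _ => ?_
            have h1 : τ * I α α = τ := by simp [hI]
            linarith [(abs_le.1 (hba α α)).2]
        _ = N * δ + N * τ := by simp [hN]
        _ ≤ N * τ + N * τ := by
            have : N * δ ≤ N * τ := by
              rcases eq_or_ne n 0 with rfl | h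
              · simp [hN]
              · have : 1 ≤ N := by
                  have : NeZero n := ⟨h⟩
                  exact Nat.one_le_cast.2 Fintype.card_pos
                rw [hτd]
                exact mul_le_mul_of_nonneg_left (le_mul_of_one_le_left hδ this) hN0
            linarith
        _ = _ := by ring
  have key : ∑ α, ∑ β, a α β * Q₁ (realDir α) (realDir β)
        - ∑ α, ∑ β, b α β * Q₂ (realDir α) (realDir β)
      = ∑ α, ∑ β, (a α β - τ * I α β - c₀ / 2 * (z α * z β)) *
          (Q₁ - Q₂) (realDir α) (realDir β)
        + c₀ / 2 * ∑ α, ∑ β, (z α * z β) * (Q₁ - Q₂) (realDir α) (realDir β)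
        + ∑ α, ∑ β, (τ * I α β) * Q₁ (realDir α) (realDir β)
        + ∑ α, ∑ β, (b α β - a α β + τ * I α β) * (-Q₂) (realDir α) (realDir β) := by
    simp only [Finset.mul_sum, ← Finset.sum_sub_distrib, ← Finset.sum_add_distrib]
    refine Finset.sum_congr rfl fun α _ => Finset.sum_congr rfl fun β _ => ?_
    simp only [_root_.sub_apply, _root_.neg_apply]
    ring
  rw [key]
  have e2' := mul_le_mul_of_nonneg_left e2 (by linarith : 0 ≤ c₀ / 2)
  have : B * (3 * N ^ 2 * δ) = B * (N * τ) + B * (2 * (N * τ)) := by rw [hτd]; ring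
  linarith

end TwoPointInequality

section GradientFromOscillation

open Filter
open scoped Topology

variable {n : ℕ}

lemma norm_sub_penalty_le {s β : ℝ} (hs : 0 < s) (hβ : 0 ≤ β) (hβs : 2 * β * s ≤ 1) {z : Cn n}
    (hz : ‖z‖ = s) (X : Cn n) : ∃ g : ℝ, ∀ t : ℝ,
      ‖z + t • X‖ - β * ‖z + t • X‖ ^ 2
        ≤ s - β * s ^ 2 + g * t + (1 / (2 * s) * ‖X‖ ^ 2) * t ^ 2 := by
  obtain ⟨l, hl⟩ := exists_norm_add_smul_sq z X
  refine ⟨(1 - 2 * β * s) * (l / s), fun t => ?_⟩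
  set r := ‖z + t • X‖ with hr
  have h1 : r ^ 2 = s ^ 2 + 2 * l * t + ‖X‖ ^ 2 * t ^ 2 := by rw [hr, hl, hz]
  have h2 : r - s ≤ l / s * t + 1 / (2 * s) * ‖X‖ ^ 2 * t ^ 2 := by
    have : l / s * t + 1 / (2 * s) * ‖X‖ ^ 2 * t ^ 2 = (r ^ 2 - s ^ 2) / (2 * s) := by
      rw [h1]
      field_simp
      ring
    rw [this, le_div_iff₀ (by positivity)]
    nlinarith [sq_nonneg (r - s)]
  have h3 := mul_le_mul_of_nonneg_left h2 (by linarith : 0 ≤ 1 - 2 * β * s)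
  have h4 : 0 ≤ 2 * β * s * (1 / (2 * s) * ‖X‖ ^ 2 * t ^ 2) := by positivity
  nlinarith [mul_nonneg hβ (sq_nonneg (r - s))]

lemma norm_sub_penalty_eq {s β : ℝ} (hs : 0 < s) {z : Cn n} (hz : ‖z‖ = s) :
    ∀ᶠ t in 𝓝 (0 : ℝ), ‖z + t • ((2 / s) • z)‖ - β * ‖z + t • ((2 / s) • z)‖ ^ 2
      ≤ s - β * s ^ 2 + 2 * (1 - 2 * β * s) * t + (-4 * β) * t ^ 2 := by
  filter_upwards [Ioi_mem_nhds (by linarith : -(s / 2) < 0)] with t ht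
  rw [mem_Ioi] at ht
  have h1 : z + t • ((2 / s) • z) = (1 + t * (2 / s)) • z := by
    rw [smul_smul, add_smul, one_smul]
  have h2 : 0 ≤ 1 + t * (2 / s) := by
    have : 1 + t * (2 / s) = (s + 2 * t) / s := by field_simp
    rw [this]
    exact div_nonneg (by linarith) hs.le
  have h3 : ‖z + t • ((2 / s) • z)‖ = s + 2 * t := by
    rw [h1, norm_smul, Real.norm_eq_abs, abs_of_nonneg h2, hz]
    field_simp
  rw [h3]
  exact le_of_eq (by ring)

lemma second_order_tests_false {c₀ Λ ℓ C₁ η θ s₀ : ℝ} (hc₀ : 0 < c₀) (hΛ : 0 ≤ Λ) (hℓ : 0 ≤ ℓ)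
    (hη : 0 < η) (hs₀ : 0 < s₀) (hs₁ : s₀ ≤ 1) {N : ℝ} (hN : N = Fintype.card (Fin n × Fin 2))
    (hs₂ : N * ℓ * s₀ ≤ c₀ / 2) (hs₃ : 6 * N ^ 2 * ℓ * s₀ ≤ c₀)
    (hs₄ : s₀ * (2 * C₁ + 4 * (4 * N * Λ + 2 * c₀ + 6 * N ^ 2 * ℓ)) < η * c₀ / 2)
    (hθ₀ : 0 < θ) (hθ₁ : θ ≤ 1) {a b : Matrix (Fin n × Fin 2) (Fin n × Fin 2) ℝ}
    {v : Cn n → ℝ} {p q : Cn n}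
    (ha : ∀ α β, a α β = a β α) (hb : ∀ α β, b α β = b β α)
    (hlow : ∀ X : Fin n × Fin 2 → ℝ, c₀ * ∑ α, X α ^ 2 ≤ ∑ α, ∑ β, a α β * (X α * X β))
    (hup : ∀ α β, |a α β| ≤ Λ) (hlip : ∀ α β, |a α β - b α β| ≤ ℓ * ‖p - q‖)
    (hav : |∑ α, ∑ β, a α β * realHess v p α β| ≤ C₁)
    (hbv : |∑ α, ∑ β, b α β * realHess v q α β| ≤ C₁)
    (hs0 : 0 < ‖p - q‖) (hs : ‖p - q‖ ≤ s₀)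
    (htest : ∀ (X Y : Cn n) (g₁ g₂ : ℝ),
      (∀ᶠ t in 𝓝 (0 : ℝ), ‖p - q + t • (X - Y)‖ - 1 / (4 * s₀) * ‖p - q + t • (X - Y)‖ ^ 2
        ≤ ‖p - q‖ - 1 / (4 * s₀) * ‖p - q‖ ^ 2 + g₁ * t + g₂ * t ^ 2) →
      D2 v p X X - D2 v q Y Y ≤ 2 * (η * g₂ + 4 * θ * (‖X‖ ^ 2 + ‖Y‖ ^ 2))) : False := by
  set A := 4 * θ with hA
  set β := 1 / (4 * s₀) with hβ
  have hβs₀ : β * s₀ = 1 / 4 := by rw [hβ]; field_simp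
  have hβ0 : 0 < β := by positivity
  set s := ‖p - q‖ with hsd
  have hβs : 2 * β * s ≤ 1 := by nlinarith
  have hN0 : 0 ≤ N := by rw [hN]; positivity
  set ζ : Cn n := (1 / s) • (p - q) with hζ
  have hζ1 : ‖ζ‖ = 1 := by
    rw [hζ, norm_smul, ← hsd, Real.norm_eq_abs, abs_of_pos (by positivity)]
    field_simp
  set B := η / s + 2 * A with hB
  have hB0 : 0 ≤ B := by positivity
  have hXX : ∀ X, fderiv ℝ (fderiv ℝ v) p X X - fderiv ℝ (fderiv ℝ v) q X X
      ≤ 4 * A * ‖X‖ ^ 2 := fun X => by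
    have := htest X X 0 0 (by simp [hsd])
    simp only [D2] at this
    linarith
  have hζζ : fderiv ℝ (fderiv ℝ v) p ζ ζ - fderiv ℝ (fderiv ℝ v) q ζ ζ
      ≤ -(8 * β * η) + 4 * A := by
    have h2 : ζ - -ζ = (2 / s) • (p - q) := by
      rw [sub_neg_eq_add, ← two_smul ℝ ζ, hζ, smul_smul]
      congr 1
      ring
    have h1 := htest ζ (-ζ) (2 * (1 - 2 * β * s)) (-4 * β) (by
      rw [h2]
      exact norm_sub_penalty_eq (β := β) hs0 hsd.symm)
    simp only [D2, norm_neg, hζ1, map_neg, _root_.neg_apply, neg_neg] at h1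
    linarith
  have hBX : ∀ X : Cn n, 2 * (η * (1 / (2 * s) * ‖X‖ ^ 2) + A * ‖X‖ ^ 2) = B * ‖X‖ ^ 2 :=
    fun X => by
      rw [hB]
      field_simp
  have hX0 : ∀ X, fderiv ℝ (fderiv ℝ v) p X X ≤ B * ‖X‖ ^ 2 := fun X => by
    obtain ⟨g, hg⟩ := norm_sub_penalty_le hs0 hβ0.le hβs hsd.symm X
    have := htest X 0 g (1 / (2 * s) * ‖X‖ ^ 2)
      (by simpa only [sub_zero] using Eventually.of_forall hg)
    rw [← hBX]
    simpa [D2] using this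
  have h0X : ∀ X, -fderiv ℝ (fderiv ℝ v) q X X ≤ B * ‖X‖ ^ 2 := fun X => by
    obtain ⟨g, hg⟩ := norm_sub_penalty_le hs0 hβ0.le hβs hsd.symm (-X)
    have := htest 0 X g (1 / (2 * s) * ‖X‖ ^ 2)
      (by simpa only [zero_sub, norm_neg] using Eventually.of_forall hg)
    rw [← hBX]
    simpa [D2] using this
  have hδ : Fintype.card (Fin n × Fin 2) * (ℓ * s) ≤ c₀ / 2 := by
    rw [← hN]
    nlinarith [mul_le_mul_of_nonneg_left hs (by positivity : 0 ≤ N * ℓ)]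
  have key := sum_mul_sub_sum_mul_le ha hb hlow hup hlip hc₀.le (by positivity)
    (by positivity) hB0 hδ hζ1 hXX hζζ hX0 h0X
  rw [← hN] at key
  have e1 := (abs_le.1 hav).1
  have e2 := (abs_le.1 hbv).2
  simp only [realHess, D2] at e1 e2
  have hBs : B * (3 * N ^ 2 * (ℓ * s)) = 3 * N ^ 2 * ℓ * η + 6 * A * N ^ 2 * ℓ * s := by
    rw [hB]
    field_simp
    ring
  rw [hBs] at key
  have hs1 : s ≤ 1 := hs.trans hs₁
  have f1 : 6 * A * N ^ 2 * ℓ * s ≤ A * (6 * N ^ 2 * ℓ) := by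
    have := mul_le_mul_of_nonneg_left hs1 (by positivity : 0 ≤ A * (6 * N ^ 2 * ℓ))
    linarith
  have f2 : 3 * N ^ 2 * ℓ * η * s₀ ≤ c₀ / 2 * η := by
    have := mul_le_mul_of_nonneg_right hs₃ hη.le
    linarith
  have f3 : c₀ / 2 * (8 * β * η) * s₀ = c₀ * η := by
    calc c₀ / 2 * (8 * β * η) * s₀ = c₀ / 2 * 8 * η * (β * s₀) := by ring
      _ = c₀ * η := by rw [hβs₀]; ring
  have f4 : A * (4 * N * Λ + 2 * c₀ + 6 * N ^ 2 * ℓ)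
      ≤ 4 * (4 * N * Λ + 2 * c₀ + 6 * N ^ 2 * ℓ) := by
    refine mul_le_mul_of_nonneg_right (by linarith) (by positivity)
  have f5 : c₀ / 2 * (8 * β * η) - 3 * N ^ 2 * ℓ * η
      ≤ 2 * C₁ + 4 * (4 * N * Λ + 2 * c₀ + 6 * N ^ 2 * ℓ) := by
    linarith
  have f6 := mul_le_mul_of_nonneg_left f5 hs₀.le
  linarith

/-- Solutions of a linear elliptic equation with Lipschitz coefficients and small oscillation have
small gradient: the doubled function of such a solution is nonpositive. -/
lemma doubled_nonpos {c₀ Λ ℓ C₁ η θ s₀ : ℝ} (hc₀ : 0 < c₀) (hΛ : 0 ≤ Λ) (hℓ : 0 ≤ ℓ) (hη : 0 < η)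
    (hs₀ : 0 < s₀) (hs₁ : s₀ ≤ 1) {N : ℝ} (hN : N = Fintype.card (Fin n × Fin 2))
    (hs₂ : N * ℓ * s₀ ≤ c₀ / 2) (hs₃ : 6 * N ^ 2 * ℓ * s₀ ≤ c₀)
    (hs₄ : s₀ * (2 * C₁ + 4 * (4 * N * Λ + 2 * c₀ + 6 * N ^ 2 * ℓ)) < η * c₀ / 2)
    (hθ₀ : 0 < θ) (hθ₁ : θ ≤ 1) (hθ₂ : θ ≤ η * s₀ / 2)
    {c : Cn n → Matrix (Fin n × Fin 2) (Fin n × Fin 2) ℝ} {v : Cn n → ℝ}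
    (hv : ContDiffOn ℝ 2 v (ball 0 1))
    (hsymm : ∀ x ∈ ball (0 : Cn n) 1, ∀ α β, c x α β = c x β α)
    (hlow : ∀ x ∈ ball (0 : Cn n) 1, ∀ X : Fin n × Fin 2 → ℝ,
      c₀ * ∑ α, X α ^ 2 ≤ ∑ α, ∑ β, c x α β * (X α * X β))
    (hup : ∀ x ∈ ball (0 : Cn n) 1, ∀ α β, |c x α β| ≤ Λ)
    (hlip : ∀ x ∈ ball (0 : Cn n) 1, ∀ y ∈ ball (0 : Cn n) 1, ∀ α β,
      |c x α β - c y α β| ≤ ℓ * ‖x - y‖)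
    (heq : ∀ x ∈ ball (0 : Cn n) 1, |∑ α, ∑ β, c x α β * realHess v x α β| ≤ C₁)
    (hosc : ∀ x ∈ ball (0 : Cn n) 1, ∀ y ∈ ball (0 : Cn n) 1, v x - v y ≤ θ)
    {x y : Cn n} (hx : ‖x‖ ≤ 1 / 2) (hy : ‖y‖ ≤ 1 / 2) (hxy : ‖x - y‖ ≤ s₀) :
    doubled η (4 * θ) (1 / (4 * s₀)) v x y ≤ 0 := by
  set A := 4 * θ with hA
  set β := 1 / (4 * s₀) with hβ
  have hβs₀ : β * s₀ = 1 / 4 := by rw [hβ]; field_simp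
  have hβ0 : 0 < β := by positivity
  set S : Set (Cn n × Cn n) := (closedBall 0 (1 / 2) ×ˢ closedBall 0 (1 / 2)) ∩
    {p | ‖p.1 - p.2‖ ≤ s₀} with hS
  have hin : ∀ x : Cn n, ‖x‖ ≤ 1 / 2 → x ∈ ball (0 : Cn n) 1 := fun x hx => by
    rw [mem_ball_zero_iff]; linarith
  have hSm : ∀ p : Cn n × Cn n, p ∈ S ↔ (‖p.1‖ ≤ 1 / 2 ∧ ‖p.2‖ ≤ 1 / 2) ∧ ‖p.1 - p.2‖ ≤ s₀ := by
    intro p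
    simp [hS]
  have hSc : IsCompact S := ((isCompact_closedBall _ _).prod (isCompact_closedBall _ _)).inter_right
    (isClosed_le (by fun_prop) continuous_const)
  have hcont : ContinuousOn (fun p : Cn n × Cn n => doubled η A β v p.1 p.2) S := by
    have h1 : ContinuousOn (fun p : Cn n × Cn n => v p.1) S :=
      hv.continuousOn.comp continuousOn_fst fun p hp => hin _ ((hSm p).1 hp).1.1
    have h2 : ContinuousOn (fun p : Cn n × Cn n => v p.2) S :=
      hv.continuousOn.comp continuousOn_snd fun p hp => hin _ ((hSm p).1 hp).1.2
    have h3 : Continuous fun p : Cn n × Cn n =>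
        η * (‖p.1 - p.2‖ - β * ‖p.1 - p.2‖ ^ 2) := by fun_prop
    have h4 : Continuous fun p : Cn n × Cn n => A * (‖p.1‖ ^ 2 + ‖p.2‖ ^ 2) := by fun_prop
    exact ((h1.sub h2).sub h3.continuousOn).sub h4.continuousOn
  obtain ⟨⟨p, q⟩, hpq, hmax⟩ := hSc.exists_isMaxOn ⟨(x, y), (hSm _).2 ⟨⟨hx, hy⟩, hxy⟩⟩ hcont
  refine le_trans (hmax ((hSm (x, y)).2 ⟨⟨hx, hy⟩, hxy⟩)) ?_
  show doubled η A β v p q ≤ 0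
  by_contra! hpos
  obtain ⟨⟨hp, hq⟩, hs⟩ := (hSm _).1 hpq
  simp only at hp hq hs
  have hpb := hin p hp
  have hqb := hin q hq
  set s := ‖p - q‖ with hsd
  have hs0 : 0 < s := by
    rw [hsd, norm_pos_iff, sub_ne_zero]
    rintro rfl
    simp only [doubled, sub_self, norm_zero] at hpos
    nlinarith [sq_nonneg ‖p‖]
  have hβs : 2 * β * s ≤ 1 := by nlinarith
  have hφ : s / 2 ≤ s - β * s ^ 2 := by nlinarith
  have hos := hosc p hpb q hqb
  have hpos' : 0 < v p - v q - η * (s - β * s ^ 2) - A * (‖p‖ ^ 2 + ‖q‖ ^ 2) := hpos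
  have hηφ : 0 ≤ η * (s - β * s ^ 2) := by nlinarith
  have hp' : ‖p‖ < 1 / 2 := by
    refine lt_of_le_of_ne hp fun h => ?_
    rw [h] at hpos'
    nlinarith [sq_nonneg ‖q‖, mul_nonneg hθ₀.le (sq_nonneg ‖q‖)]
  have hq' : ‖q‖ < 1 / 2 := by
    refine lt_of_le_of_ne hq fun h => ?_
    rw [h] at hpos'
    nlinarith [sq_nonneg ‖p‖, mul_nonneg hθ₀.le (sq_nonneg ‖p‖)]
  have hs' : s < s₀ := by
    refine lt_of_le_of_ne hs fun h => ?_
    have h1 : 0 ≤ A * (‖p‖ ^ 2 + ‖q‖ ^ 2) := by positivity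
    have h2 := mul_le_mul_of_nonneg_left hφ hη.le
    rw [h] at h2 hpos'
    linarith
  have hnear : ∀ X Y : Cn n, ∀ᶠ t in 𝓝 (0 : ℝ),
      doubled η A β v (p + t • X) (q + t • Y) ≤ doubled η A β v p q := by
    intro X Y
    have c1 : Continuous fun t : ℝ => ‖p + t • X‖ := by fun_prop
    have c2 : Continuous fun t : ℝ => ‖q + t • Y‖ := by fun_prop
    have c3 : Continuous fun t : ℝ => ‖p + t • X - (q + t • Y)‖ := by fun_prop
    filter_upwards [c1.continuousAt.eventually_lt (x₀ := (0 : ℝ)) (g := fun _ => 1 / 2)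
        continuousAt_const (by simpa using hp'),
      c2.continuousAt.eventually_lt (x₀ := (0 : ℝ)) (g := fun _ => 1 / 2)
        continuousAt_const (by simpa using hq'),
      c3.continuousAt.eventually_lt (x₀ := (0 : ℝ)) (g := fun _ => s₀)
        continuousAt_const (by simpa using hs')] with t h1 h2 h3
    exact hmax ((hSm (p + t • X, q + t • Y)).2 ⟨⟨h1.le, h2.le⟩, h3.le⟩)
  have htest : ∀ (X Y : Cn n) (g₁ g₂ : ℝ),
      (∀ᶠ t in 𝓝 (0 : ℝ), ‖p - q + t • (X - Y)‖ - β * ‖p - q + t • (X - Y)‖ ^ 2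
        ≤ s - β * s ^ 2 + g₁ * t + g₂ * t ^ 2) →
      D2 v p X X - D2 v q Y Y ≤ 2 * (η * g₂ + A * (‖X‖ ^ 2 + ‖Y‖ ^ 2)) := by
    intro X Y g₁ g₂ h
    refine D2_sub_D2_le (g₁ := g₁) isOpen_ball hv hpb hqb hη.le (hnear X Y) ?_
    filter_upwards [h] with t ht
    have : p + t • X - (q + t • Y) = p - q + t • (X - Y) := by
      rw [smul_sub]
      abel
    rw [this]
    exact ht
  exact second_order_tests_false hc₀ hΛ hℓ hη hs₀ hs₁ hN hs₂ hs₃ hs₄ hθ₀ hθ₁ (hsymm p hpb)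
    (hsymm q hqb) (hlow p hpb) (hup p hpb) (hlip p hpb q hqb) (heq p hpb) (heq q hqb) hs0 hs htest

/-- Interior gradient bound in terms of the oscillation. -/
lemma exists_norm_fderiv_le_of_oscillation (n : ℕ) {c₀ Λ ℓ C₁ η : ℝ} (hc₀ : 0 < c₀) (hΛ : 0 ≤ Λ)
    (hℓ : 0 ≤ ℓ) (hC₁ : 0 ≤ C₁) (hη : 0 < η) :
    ∃ θ, 0 < θ ∧ ∀ (c : Cn n → Matrix (Fin n × Fin 2) (Fin n × Fin 2) ℝ) (v : Cn n → ℝ),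
      ContDiffOn ℝ 2 v (ball 0 1) →
      (∀ x ∈ ball (0 : Cn n) 1, ∀ α β, c x α β = c x β α) →
      (∀ x ∈ ball (0 : Cn n) 1, ∀ X : Fin n × Fin 2 → ℝ,
        c₀ * ∑ α, X α ^ 2 ≤ ∑ α, ∑ β, c x α β * (X α * X β)) →
      (∀ x ∈ ball (0 : Cn n) 1, ∀ α β, |c x α β| ≤ Λ) →
      (∀ x ∈ ball (0 : Cn n) 1, ∀ y ∈ ball (0 : Cn n) 1, ∀ α β,
        |c x α β - c y α β| ≤ ℓ * ‖x - y‖) →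
      (∀ x ∈ ball (0 : Cn n) 1, |∑ α, ∑ β, c x α β * realHess v x α β| ≤ C₁) →
      (∀ x ∈ ball (0 : Cn n) 1, ∀ y ∈ ball (0 : Cn n) 1, v x - v y ≤ θ) →
      ‖fderiv ℝ v 0‖ ≤ η := by
  set N : ℝ := (Fintype.card (Fin n × Fin 2) : ℝ) with hN
  have hN0 : 0 ≤ N := Nat.cast_nonneg _
  set D := 2 * C₁ + 4 * (4 * N * Λ + 2 * c₀ + 6 * N ^ 2 * ℓ) with hD
  have hD0 : 0 < D := by positivity
  obtain ⟨s₀, hs₀, hs₁, hs₂, hs₃, hs₄⟩ : ∃ s₀ : ℝ, 0 < s₀ ∧ s₀ ≤ 1 ∧ N * ℓ * s₀ ≤ c₀ / 2 ∧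
      6 * N ^ 2 * ℓ * s₀ ≤ c₀ ∧ s₀ * D < (η / 2) * c₀ / 2 := by
    have h1 : ∀ a b : ℝ, 0 < b → ∀ᶠ s : ℝ in 𝓝[>] 0, s * a < b := fun a b hb => by
      have : Continuous fun s : ℝ => s * a := by fun_prop
      exact nhdsWithin_le_nhds (this.continuousAt.eventually_lt (x₀ := (0 : ℝ)) (g := fun _ => b)
        continuousAt_const (by simpa using hb))
    obtain ⟨s, ⟨⟨⟨⟨h0, h1⟩, h2⟩, h3⟩, h4⟩⟩ := ((((eventually_mem_nhdsWithin.and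
      (h1 1 1 one_pos)).and (h1 (N * ℓ) (c₀ / 2) (by positivity))).and
      (h1 (6 * N ^ 2 * ℓ) c₀ hc₀)).and (h1 D (η / 2 * c₀ / 2) (by positivity))).exists
    exact ⟨s, h0, by linarith, by linarith, by linarith, h4⟩
  refine ⟨min (min 1 (η / 2 * s₀ / 2)) (η / 16), by positivity,
    fun c v hv hsymm hlow hup hlip heq hosc => ?_⟩
  set θ := min (min 1 (η / 2 * s₀ / 2)) (η / 16) with hθ
  have hθ0 : 0 < θ := by positivity
  have hθ1 : θ ≤ η / 16 := min_le_right _ _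
  have hdoub : ∀ x y : Cn n, ‖x‖ ≤ 1 / 2 → ‖y‖ ≤ 1 / 2 → ‖x - y‖ ≤ s₀ →
      doubled (η / 2) (4 * θ) (1 / (4 * s₀)) v x y ≤ 0 := fun x y hx hy hxy =>
    doubled_nonpos hc₀ hΛ hℓ (half_pos hη) hs₀ hs₁ hN hs₂ hs₃ hs₄ hθ0
      ((min_le_left _ _).trans (min_le_left _ _)) ((min_le_left _ _).trans (min_le_right _ _))
      hv hsymm hlow hup hlip heq hosc hx hy hxy
  have h0 : (0 : Cn n) ∈ ball (0 : Cn n) 1 := by simp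
  refine (differentiableAt_of_contDiffOn isOpen_ball one_le_two hv h0).hasFDerivAt.le_of_lip'
    hη.le ?_
  filter_upwards [ball_mem_nhds (0 : Cn n) (lt_min hs₀ (by norm_num : (0 : ℝ) < 1 / 2))] with x hx
  rw [mem_ball_zero_iff, lt_min_iff] at hx
  have h1 := hdoub x 0 hx.2.le (by simp) (by simpa using hx.1.le)
  have h2 := hdoub 0 x (by simp) hx.2.le (by simpa using hx.1.le)
  simp only [doubled, sub_zero, zero_sub, norm_neg, norm_zero] at h1 h2
  have h3 : 0 ≤ 1 / (4 * s₀) * ‖x‖ ^ 2 := by positivity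
  have h4 : 4 * θ * ‖x‖ ^ 2 ≤ η / 2 * ‖x‖ := by
    have h5 := mul_le_mul_of_nonneg_right hθ1 (sq_nonneg ‖x‖)
    have h6 : ‖x‖ ^ 2 ≤ ‖x‖ := by nlinarith [norm_nonneg x, hx.2]
    nlinarith
  rw [Real.norm_eq_abs, sub_zero, abs_le]
  constructor <;> nlinarith

end GradientFromOscillation

section HessianGradient

open Complex Matrix
open scoped ComplexConjugate

attribute [local instance] Matrix.normedAddCommGroup Matrix.normedSpace

variable {n : ℕ} {lam T κ : ℝ} {u f : Cn n → ℝ}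

/-- The complex Hessian with values in the product space `ℂⁿˣⁿ`, normed by its largest entry. -/
def hessPi (u : Cn n → ℝ) (z : Cn n) : Fin n → Fin n → ℂ := complexHessian u z

lemma norm_pd_hessian_le (u : Cn n → ℝ) (e z : Cn n) :
    ‖pd e (complexHessian u) z‖ ≤ ‖fderiv ℝ (hessPi u) z‖ * ‖e‖ :=
  (fderiv ℝ (hessPi u) z).le_opNorm e

lemma exists_norm_fderiv_adjugate_le (n : ℕ) (lam T : ℝ) : ∃ C : ℝ, 0 ≤ C ∧
    ∀ A ∈ admissible n lam T, ∀ B,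
      ‖fderiv ℝ (fun A : Matrix (Fin n) (Fin n) ℂ => A.adjugate) A B‖ ≤ C * ‖B‖ := by
  let a : (Fin n → Fin n → ℂ) → (Fin n → Fin n → ℂ) := fun A => Matrix.adjugate A
  have ha : ContDiff ℝ 1 a := contDiff_adjugate (k := 1)
  have hc : Continuous (fderiv ℝ a) := ha.continuous_fderiv one_ne_zero
  have hK : IsCompact (X := Fin n → Fin n → ℂ) (admissible n lam T) :=
    isCompact_admissible n lam T
  obtain ⟨C, hC⟩ := hK.exists_bound_of_continuousOn hc.continuousOn
  refine ⟨|C|, abs_nonneg _, fun A hA B => ?_⟩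
  exact (fderiv ℝ a A).le_of_opNorm_le ((hC A hA).trans (le_abs_self _)) B

lemma norm_trace_mul_le (A B : Matrix (Fin n) (Fin n) ℂ) :
    ‖(A * B).trace‖ ≤ (n : ℝ) ^ 2 * (‖A‖ * ‖B‖) := by
  simp only [Matrix.trace, Matrix.diag_apply, Matrix.mul_apply]
  calc ‖∑ i, ∑ j, A i j * B j i‖ ≤ ∑ _i : Fin n, ∑ _j : Fin n, ‖A‖ * ‖B‖ := by
        refine norm_sum_le_of_le _ fun i _ => norm_sum_le_of_le _ fun j _ => ?_
        rw [norm_mul]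
        exact mul_le_mul (norm_entry_le_entrywise_sup_norm A) (norm_entry_le_entrywise_sup_norm B)
          (norm_nonneg _) (norm_nonneg _)
    _ = _ := by
        simp
        ring

lemma norm_unitC (s : Fin 2) : ‖unitC s‖ = 1 := by
  fin_cases s <;> simp [unitC]

lemma abs_realCoef_sub_le (b b' : Matrix (Fin n) (Fin n) ℂ) (α β : Fin n × Fin 2) :
    |realCoef b α β - realCoef b' α β| ≤ ‖b - b'‖ := by
  have h1 : realCoef b α β - realCoef b' α β
      = (1/4) * ((b - b') β.1 α.1 * (conj (unitC α.2) * unitC β.2)).re := by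
    simp only [realCoef, Matrix.sub_apply, sub_mul, sub_re]
    ring
  have h2 : |((b - b') β.1 α.1 * (conj (unitC α.2) * unitC β.2)).re| ≤ ‖b - b'‖ := by
    refine (Complex.abs_re_le_norm _).trans ?_
    rw [norm_mul, norm_mul, RCLike.norm_conj, norm_unitC, norm_unitC, mul_one, mul_one]
    exact norm_entry_le_entrywise_sup_norm _
  rw [h1, abs_mul, abs_of_pos (by norm_num : (0 : ℝ) < 1 / 4)]
  linarith [norm_nonneg (b - b')]

namespace IsMASolution

lemma norm_pd_adjugate_le (h : IsMASolution n lam T κ u f) {C : ℝ}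
    (hC : ∀ A ∈ admissible n lam T, ∀ B,
      ‖fderiv ℝ (fun A : Matrix (Fin n) (Fin n) ℂ => A.adjugate) A B‖ ≤ C * ‖B‖) {z : Cn n}
    (hz : z ∈ ball (0 : Cn n) 2) (e : Cn n) :
    ‖pd e (fun y => (complexHessian u y).adjugate) z‖ ≤ C * ‖pd e (complexHessian u) z‖ := by
  have hg := differentiableAt_of_contDiffOn isOpen_ball one_le_two h.contDiffOn_hessian hz
  have ha : DifferentiableAt ℝ (fun A : Matrix (Fin n) (Fin n) ℂ => A.adjugate)
      (complexHessian u z) := (contDiff_adjugate (k := 1)).differentiable one_ne_zero _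
  have h1 := (ha.hasFDerivAt.comp z hg.hasFDerivAt).fderiv
  have h2 : pd e (fun y => (complexHessian u y).adjugate) z
      = fderiv ℝ (fun A : Matrix (Fin n) (Fin n) ℂ => A.adjugate) (complexHessian u z)
        (pd e (complexHessian u) z) := congrArg (fun L => L e) h1
  rw [h2]
  exact hC _ (h.mem z hz) _

lemma abs_maOp_pd_pd_le (h : IsMASolution n lam T κ u f) (hlam : 0 < lam) {C : ℝ} (hC0 : 0 ≤ C)
    (hC : ∀ A ∈ admissible n lam T, ∀ B,
      ‖fderiv ℝ (fun A : Matrix (Fin n) (Fin n) ℂ => A.adjugate) A B‖ ≤ C * ‖B‖) (hκ : κ ≤ 1) {z : Cn n}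
    (hz : z ∈ ball (0 : Cn n) 2) (hD : ‖fderiv ℝ (hessPi u) z‖ ≤ 1) {e e' : Cn n}
    (he : ‖e‖ ≤ 1) (he' : ‖e'‖ ≤ 1) :
    |maOp (complexHessian u z).adjugate (pd e' (pd e u)) z| ≤ 1 + (n : ℝ) ^ 2 * C := by
  have hκ0 := h.bound_nonneg
  have h1 := congrArg Complex.re (h.pd_pd_rhs hlam e e' z hz)
  rw [ofReal_re, add_re, ← maOp_eq_trace] at h1
  have h2 : |pd e' (pd e f) z| ≤ 1 := by
    refine (h.abs_pd_pd_rhs_le e e' hz).trans ?_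
    exact mul_le_one₀ (mul_le_one₀ (pow_le_one₀ hκ0 hκ) (norm_nonneg _) he) (norm_nonneg _) he'
  have hp : ∀ {a : Cn n}, ‖a‖ ≤ 1 → ‖pd a (complexHessian u) z‖ ≤ 1 := fun ha =>
    (norm_pd_hessian_le u _ z).trans (mul_le_one₀ hD (norm_nonneg _) ha)
  have h3 : ‖pd e' (fun y => (complexHessian u y).adjugate) z‖ ≤ C :=
    (h.norm_pd_adjugate_le hC hz e').trans (mul_le_of_le_one_right hC0 (hp he'))
  have h4 := hp he
  have h5 : |(pd e' (fun y => (complexHessian u y).adjugate) z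
      * pd e (complexHessian u) z).trace.re| ≤ (n : ℝ) ^ 2 * C := by
    refine (Complex.abs_re_le_norm _).trans ((norm_trace_mul_le _ _).trans ?_)
    refine mul_le_mul_of_nonneg_left ?_ (by positivity)
    calc _ ≤ C * 1 := mul_le_mul h3 h4 (norm_nonneg _) hC0
      _ = C := mul_one C
  rw [abs_le] at *
  constructor <;> linarith [h2.1, h2.2, h5.1, h5.2]

lemma maOp_of_eq (h : IsMASolution n lam T κ u f) {w : Cn n → ℝ} {t : ℝ} {e₁ e₂ e₃ e₄ : Cn n}
    (hw : ∀ y, w y = (1/4) * (D2 u y e₁ e₂ + t * D2 u y e₃ e₄))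
    (b : Matrix (Fin n) (Fin n) ℂ) {z : Cn n} (hz : z ∈ ball (0 : Cn n) 2) :
    maOp b w z = (1/4) * (maOp b (pd e₁ (pd e₂ u)) z + t * maOp b (pd e₃ (pd e₄ u)) z) := by
  have hc : ∀ e e', ContDiffOn ℝ 2 (pd e (pd e' u)) (ball 0 2) := fun e e' =>
    contDiffOn_pd isOpen_ball (by norm_num)
      (contDiffOn_pd (k := 3) isOpen_ball (by norm_num) h.contDiffOn e') e
  have hev : w =ᶠ[nhds z] fun y => (1/4) * (pd e₁ (pd e₂ u) y + t * pd e₃ (pd e₄ u) y) := by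
    filter_upwards [isOpen_ball.mem_nhds hz] with y hy
    rw [hw, D2_eq_pd isOpen_ball (h.contDiffOn.of_le (by norm_num)) hy,
      D2_eq_pd isOpen_ball (h.contDiffOn.of_le (by norm_num)) hy]
  have h1 : maOp b w z
      = maOp b (fun y => (1/4) * (pd e₁ (pd e₂ u) y + t * pd e₃ (pd e₄ u) y)) z := by
    simp only [maOp, realHess, D2]
    rw [hev.fderiv.fderiv_eq]
  rw [h1, maOp_const_mul, maOp_add b isOpen_ball (hc _ _) (contDiffOn_const.mul (hc _ _)) hz,
    maOp_const_mul]

end IsMASolution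

/-- If the complex Hessian has small oscillation and bounded gradient, its gradient at the centre
is small. -/
lemma exists_norm_fderiv_hessian_le (n : ℕ) (hlam : 0 < lam) (T : ℝ) {η : ℝ} (hη : 0 < η) :
    ∃ θ, 0 < θ ∧ ∀ κ u f, IsMASolution n lam T κ u f → κ ≤ 1 →
      (∀ x ∈ ball (0 : Cn n) 1, ‖fderiv ℝ (hessPi u) x‖ ≤ 1) →
      (∀ x ∈ ball (0 : Cn n) 1, ∀ y ∈ ball (0 : Cn n) 1,
        ‖complexHessian u x - complexHessian u y‖ ≤ θ) →
      ‖fderiv ℝ (hessPi u) 0‖ ≤ η := by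
  obtain ⟨c₀, Lam, hc₀, hLam, hell⟩ := exists_ellipticity hlam T n
  obtain ⟨C, hC0, hC⟩ := exists_norm_fderiv_adjugate_le n lam T
  obtain ⟨θ, hθ, hgrad⟩ := exists_norm_fderiv_le_of_oscillation n (c₀ := c₀) (Λ := Lam) (ℓ := C)
    (C₁ := 1 + (n : ℝ) ^ 2 * C) (η := η / 2) hc₀ hLam hC0 (by positivity) (half_pos hη)
  refine ⟨θ, hθ, fun κ u f h hκ hD hosc => ?_⟩
  have hb : ∀ {x : Cn n}, x ∈ ball (0 : Cn n) 1 → x ∈ ball (0 : Cn n) 2 := fun hx =>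
    ball_subset_ball one_le_two hx
  have hadj : ∀ x ∈ ball (0 : Cn n) 1, ∀ y ∈ ball (0 : Cn n) 1,
      ‖(complexHessian u x).adjugate - (complexHessian u y).adjugate‖ ≤ C * ‖x - y‖ := by
    intro x hx y hy
    let a : Cn n → Fin n → Fin n → ℂ := fun y => (complexHessian u y).adjugate
    have ha : ContDiffOn ℝ 2 a (ball 0 2) := h.contDiffOn_adjugate
    refine (convex_ball (0 : Cn n) 1).norm_image_sub_le_of_norm_fderiv_le (𝕜 := ℝ) (f := a)
      (fun z hz => differentiableAt_of_contDiffOn isOpen_ball one_le_two ha (hb hz))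
      (fun z hz => ContinuousLinearMap.opNorm_le_bound _ hC0 fun e => ?_) hy hx
    refine (h.norm_pd_adjugate_le hC (hb hz) e).trans (mul_le_mul_of_nonneg_left ?_ hC0)
    exact (norm_pd_hessian_le u e z).trans (mul_le_of_le_one_left (norm_nonneg _) (hD z hz))
  have hentry : ∀ (w : Cn n → ℝ) (t : ℝ) (e₁ e₂ e₃ e₄ : Cn n), |t| ≤ 1 → ‖e₁‖ ≤ 1 → ‖e₂‖ ≤ 1 →
      ‖e₃‖ ≤ 1 → ‖e₄‖ ≤ 1 → (∀ y, w y = (1/4) * (D2 u y e₁ e₂ + t * D2 u y e₃ e₄)) →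
      (∀ x y, w x - w y ≤ ‖complexHessian u x - complexHessian u y‖) →
      ‖fderiv ℝ w 0‖ ≤ η / 2 := by
    intro w t e₁ e₂ e₃ e₄ ht h₁ h₂ h₃ h₄ hw hwosc
    refine hgrad (fun y => realCoef (complexHessian u y).adjugate) w ?_
      (fun x hx => realCoef_symm
        (adjugate_posDef (posDef_of_mem_admissible hlam (h.mem x (hb hx)))).1)
      (fun x hx => (hell _ (h.mem x (hb hx))).1) (fun x hx α β => ?_)
      (fun x hx y hy α β => (abs_realCoef_sub_le _ _ α β).trans (hadj x hx y hy))
      (fun x hx => ?_) (fun x hx y hy => (hwosc x y).trans (hosc x hx y hy))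
    · rw [funext hw]
      refine ContDiffOn.mono ?_ (ball_subset_ball one_le_two)
      have hu : ContDiffOn ℝ 4 u (ball 0 2) := h.contDiffOn
      exact contDiffOn_const.mul ((contDiffOn_D2 isOpen_ball (by norm_num) hu e₁ e₂).add
        (contDiffOn_const.mul (contDiffOn_D2 isOpen_ball (by norm_num) hu e₃ e₄)))
    · refine le_trans ?_ (hell _ (h.mem x (hb hx))).2
      refine le_trans ?_ (Finset.single_le_sum (f := fun α => ∑ β,
        |realCoef (complexHessian u x).adjugate α β|)
        (fun α _ => Finset.sum_nonneg fun β _ => abs_nonneg _) (Finset.mem_univ α))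
      exact Finset.single_le_sum (f := fun β => |realCoef (complexHessian u x).adjugate α β|)
        (fun β _ => abs_nonneg _) (Finset.mem_univ β)
    · change |maOp (complexHessian u x).adjugate w x| ≤ _
      rw [h.maOp_of_eq hw _ (hb hx)]
      have k1 := h.abs_maOp_pd_pd_le hlam hC0 hC hκ (hb hx) (hD x hx) h₂ h₁
      have k2 := h.abs_maOp_pd_pd_le hlam hC0 hC hκ (hb hx) (hD x hx) h₄ h₃
      set B := 1 + (n : ℝ) ^ 2 * C with hB
      have hB0 : 0 ≤ B := by positivity
      have k3 : |t * maOp (complexHessian u x).adjugate (pd e₃ (pd e₄ u)) x| ≤ B := by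
        rw [abs_mul]
        exact (mul_le_of_le_one_left (abs_nonneg _) ht).trans k2
      rw [abs_le] at k1 k3 ⊢
      constructor <;> linarith [k1.1, k1.2, k3.1, k3.2]
  have h0 : (0 : Cn n) ∈ ball (0 : Cn n) 2 := by simp
  have hg0 := differentiableAt_of_contDiffOn isOpen_ball one_le_two h.contDiffOn_hessian h0
  have hgij : ∀ i j, DifferentiableAt ℝ (fun y => complexHessian u y i j) 0 := fun i j =>
    differentiableAt_pi.1 (differentiableAt_pi.1 hg0 i) j
  have hre : ∀ i j, ‖fderiv ℝ (fun y => (complexHessian u y i j).re) 0‖ ≤ η / 2 := fun i j => by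
    refine hentry _ 1 (EuclideanSpace.single i 1) (EuclideanSpace.single j 1)
      (EuclideanSpace.single i I) (EuclideanSpace.single j I) (by simp) (by simp) (by simp)
      (by simp) (by simp) (fun y => ?_) fun x y => ?_
    · simp [complexHessian]
    · refine le_trans ?_ (norm_entry_le_entrywise_sup_norm
        (complexHessian u x - complexHessian u y) (i := i) (j := j))
      rw [Matrix.sub_apply, ← sub_re]
      exact re_le_norm _
  have him : ∀ i j, ‖fderiv ℝ (fun y => (complexHessian u y i j).im) 0‖ ≤ η / 2 := fun i j => by
    refine hentry _ (-1) (EuclideanSpace.single i 1) (EuclideanSpace.single j I)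
      (EuclideanSpace.single i I) (EuclideanSpace.single j 1) (by simp) (by simp) (by simp)
      (by simp) (by simp) (fun y => ?_) fun x y => ?_
    · simp [complexHessian]
      ring
    · refine le_trans ?_ (norm_entry_le_entrywise_sup_norm
        (complexHessian u x - complexHessian u y) (i := i) (j := j))
      rw [Matrix.sub_apply, ← sub_im]
      exact (le_abs_self _).trans (abs_im_le_norm _)
  refine ContinuousLinearMap.opNorm_le_bound _ hη.le fun e => ?_
  change ‖pd e (complexHessian u) 0‖ ≤ _
  rw [Matrix.norm_le_iff (by positivity)]
  intro i j
  rw [pd_matrix_apply hg0]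
  have k1 : (pd e (fun y => complexHessian u y i j) 0).re
      = fderiv ℝ (fun y => (complexHessian u y i j).re) 0 e :=
    (pd_clm Complex.reCLM (hgij i j) e).symm
  have k2 : (pd e (fun y => complexHessian u y i j) 0).im
      = fderiv ℝ (fun y => (complexHessian u y i j).im) 0 e :=
    (pd_clm Complex.imCLM (hgij i j) e).symm
  refine (Complex.norm_le_abs_re_add_abs_im _).trans ?_
  rw [k1, k2]
  have k3 := (fderiv ℝ (fun y => (complexHessian u y i j).re) 0).le_of_opNorm_le (hre i j) e
  have k4 := (fderiv ℝ (fun y => (complexHessian u y i j).im) 0).le_of_opNorm_le (him i j) e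
  rw [Real.norm_eq_abs] at k3 k4
  linarith

end HessianGradient

section InteriorEstimate

open Complex Matrix
open scoped ComplexConjugate

attribute [local instance] Matrix.normedAddCommGroup Matrix.normedSpace

variable {n : ℕ} {lam : ℝ}

lemma norm_fderiv_hessPi_rescale (x₀ : Cn n) {R : ℝ} (hR : 0 < R) (u : Cn n → ℝ) (z : Cn n) :
    ‖fderiv ℝ (hessPi (rescale x₀ R u)) z‖ = R * ‖fderiv ℝ (hessPi u) (x₀ + R • z)‖ := by
  rw [show hessPi (rescale x₀ R u) = fun y => hessPi u (x₀ + R • y) from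
    funext fun y => complexHessian_rescale x₀ hR.ne' u y, fderiv_comp_add_smul, norm_smul,
    Real.norm_of_nonneg hR.le]

lemma IsMASolution.contDiffOn_hessPi {T κ : ℝ} {u f : Cn n → ℝ}
    (h : IsMASolution n lam T κ u f) : ContDiffOn ℝ 2 (hessPi u) (ball 0 2) :=
  h.contDiffOn_hessian

/-- Small oscillation of the complex Hessian controls its gradient at the centre. -/
lemma exists_norm_fderiv_hessian_le_one (n : ℕ) (hlam : 0 < lam) (T : ℝ) :
    ∃ θ, 0 < θ ∧ ∀ κ u f, IsMASolution n lam T κ u f → κ ≤ 1 →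
      (∀ x ∈ ball (0 : Cn n) 2, ∀ y ∈ ball (0 : Cn n) 2,
        ‖complexHessian u x - complexHessian u y‖ ≤ θ) →
      ‖fderiv ℝ (hessPi u) 0‖ ≤ 1 := by
  obtain ⟨θ, hθ, hgrad⟩ := exists_norm_fderiv_hessian_le n hlam T (η := 1 / 8) (by norm_num)
  refine ⟨θ, hθ, fun κ u f h hκ hosc => ?_⟩
  by_contra! h0
  have hcont : ContinuousOn (fun x : Cn n => (1 - ‖x‖) * ‖fderiv ℝ (hessPi u) x‖)
      (closedBall 0 1) := by
    refine ContinuousOn.mul (by fun_prop) (ContinuousOn.norm ?_)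
    exact (h.contDiffOn_hessPi.continuousOn_fderiv_of_isOpen isOpen_ball one_le_two).mono
      (closedBall_subset_ball one_lt_two)
  obtain ⟨x₁, hx₁, hmax⟩ := (isCompact_closedBall (0 : Cn n) 1).exists_isMaxOn
    ⟨0, mem_closedBall_self zero_le_one⟩ hcont
  have hmax' : ∀ y : Cn n, ‖y‖ ≤ 1 → (1 - ‖y‖) * ‖fderiv ℝ (hessPi u) y‖
      ≤ (1 - ‖x₁‖) * ‖fderiv ℝ (hessPi u) x₁‖ := fun y hy => hmax (mem_closedBall_zero_iff.2 hy)
  have hx₁' : ‖x₁‖ ≤ 1 := mem_closedBall_zero_iff.1 hx₁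
  set N := ‖fderiv ℝ (hessPi u) x₁‖ with hN
  have hδN : 1 < (1 - ‖x₁‖) * N := by
    have := hmax' 0 (by simp)
    rw [norm_zero, sub_zero, one_mul] at this
    exact h0.trans_le this
  have hN0 : 0 ≤ N := norm_nonneg _
  have hδ : 0 < 1 - ‖x₁‖ := by
    by_contra! hc
    linarith [mul_nonpos_of_nonpos_of_nonneg hc hN0]
  have hN1 : 1 < N := by nlinarith [norm_nonneg x₁]
  set R := (4 * N)⁻¹ with hR
  have hR0 : 0 < R := by positivity
  have hRN : R * N = 1 / 4 := by rw [hR]; field_simp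
  have hRδ : 4 * R < 1 - ‖x₁‖ := by nlinarith
  have hnorm : ∀ y ∈ ball x₁ (2 * R), ‖y‖ < 1 - (1 - ‖x₁‖) / 2 := fun y hy => by
    rw [mem_ball, dist_eq_norm] at hy
    linarith [norm_le_norm_add_norm_sub' y x₁]
  have hsub1 : ball x₁ (2 * R) ⊆ ball 0 1 := fun y hy =>
    mem_ball_zero_iff.2 (by linarith [hnorm y hy])
  have hsub : ball x₁ (2 * R) ⊆ ball 0 2 := hsub1.trans (ball_subset_ball one_le_two)
  have hle : ∀ y ∈ ball x₁ (2 * R), ‖fderiv ℝ (hessPi u) y‖ ≤ 2 * N := fun y hy => by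
    have h1 := hnorm y hy
    have h2 := hmax' y (by linarith)
    have h3 := norm_nonneg (fderiv ℝ (hessPi u) y)
    by_contra! hc
    nlinarith
  have hb : ∀ {x : Cn n}, x ∈ ball (0 : Cn n) 1 → x₁ + R • x ∈ ball x₁ (2 * R) := fun hx =>
    add_smul_mem_ball hR0 (ball_subset_ball one_le_two hx)
  have key := hgrad _ _ _ (h.rescale hR0 hsub) (by nlinarith [h.bound_nonneg]) (fun x hx => by
      rw [norm_fderiv_hessPi_rescale x₁ hR0]
      nlinarith [hle _ (hb hx)]) (fun x hx y hy => by
      rw [complexHessian_rescale x₁ hR0.ne', complexHessian_rescale x₁ hR0.ne']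
      exact hosc _ (hsub (hb hx)) _ (hsub (hb hy)))
  rw [norm_fderiv_hessPi_rescale x₁ hR0, smul_zero, add_zero, ← hN, hRN] at key
  norm_num at key

/-- The real Laplacian as a functional of the complex Hessian. -/
def lapCLM (n : ℕ) : (Fin n → Fin n → ℂ) →L[ℝ] ℝ :=
  ∑ k, (4 : ℝ) • (Complex.reCLM.comp
    ((ContinuousLinearMap.proj (R := ℝ) (φ := fun _ : Fin n => ℂ) k).comp
      (ContinuousLinearMap.proj (R := ℝ) (φ := fun _ : Fin n => Fin n → ℂ) k)))

lemma lapCLM_apply (A : Fin n → Fin n → ℂ) : lapCLM n A = 4 * (Matrix.trace A).re := by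
  simp [lapCLM, Matrix.trace, Finset.mul_sum, _root_.sum_apply]
  rfl

lemma lap_eq (u : Cn n → ℝ) (z : Cn n) : lap u z = 4 * (complexHessian u z).trace.re := by
  simp only [lap, Matrix.trace, Matrix.diag_apply, re_sum, Finset.mul_sum]
  refine Finset.sum_congr rfl fun k _ => ?_
  simp [complexHessian]

lemma norm_fderiv_lap_le {u : Cn n → ℝ} {z : Cn n} (hu : DifferentiableAt ℝ (hessPi u) z) :
    ‖fderiv ℝ (lap u) z‖ ≤ ‖lapCLM n‖ * ‖fderiv ℝ (hessPi u) z‖ := by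
  have h1 : lap u = lapCLM n ∘ hessPi u := funext fun y => by
    rw [Function.comp_apply, lapCLM_apply, lap_eq]
    rfl
  rw [h1, ((lapCLM n).hasFDerivAt.comp z hu.hasFDerivAt).fderiv]
  exact ContinuousLinearMap.opNorm_comp_le _ _

/-- A radius satisfying finitely many smallness conditions. -/
lemma exists_small_radius (M₃ M₄ : ℝ) {d κ : ℝ} (hd : 0 < d) (hκ : 0 < κ) :
    ∃ R, 0 < R ∧ 2 * R ≤ d ∧ R * M₃ ≤ κ ∧ R ^ 2 * M₄ ≤ κ ^ 2 := by
  set B := 1 + |M₃| + |M₄| with hB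
  have h3 := abs_nonneg M₃
  have h4 := abs_nonneg M₄
  have hB1 : 1 ≤ B := by linarith
  have hB0 : 0 < B := by linarith
  refine ⟨min (d / 2) (κ / B), by positivity, by linarith [min_le_left (d / 2) (κ / B)], ?_, ?_⟩
  all_goals
    set R := min (d / 2) (κ / B) with hR
    have hR0 : 0 < R := by positivity
    have hRB : R * B ≤ κ := (le_div_iff₀ hB0).1 (min_le_right _ _)
  · exact (mul_le_mul_of_nonneg_left (by linarith [le_abs_self M₃]) hR0.le).trans hRB
  · calc R ^ 2 * M₄ ≤ R ^ 2 * B ^ 2 := by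
          refine mul_le_mul_of_nonneg_left ?_ (by positivity)
          nlinarith [le_abs_self M₄]
      _ = (R * B) ^ 2 := by ring
      _ ≤ κ ^ 2 := pow_le_pow_left₀ (by positivity) hRB 2

end InteriorEstimate

/-- **Riebesehl–Schulz interior third order estimate for the complex Monge–Ampère
equation.** For all bounds `M₁` (on `|∇u|`), `M₂` (on `|Δu|`), `λ > 0` (lower bound
for `f`), `M₃` (on `|Df|`), `M₄` (on `|D²f|`) and `d > 0`, there is a constant `C`,
depending only on these quantities and `n`, such that: if `u` is plurisubharmonic of
class `C⁴` on a domain `Ω ⊆ ℂⁿ` with `det(u_{i j̄}) = f` in `Ω`, `f` of class `C²`,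
and `Ω'` is a subset of `Ω` at distance at least `d` from `∂Ω`, then
`sup_{Ω'} |∇Δu| ≤ C`. -/
theorem riebesehl_schulz_interior_third_order_estimate
    (n : ℕ) (M₁ M₂ M₃ M₄ lam d : ℝ) (hlam : 0 < lam) (hd : 0 < d) :
    ∃ C : ℝ, 0 < C ∧
      ∀ (Ω Ω' : Set (Cn n)) (u f : Cn n → ℝ),
        IsOpen Ω → IsConnected Ω →
        ContDiffOn ℝ 4 u Ω → ContDiffOn ℝ 2 f Ω →
        (∀ z ∈ Ω, (complexHessian u z).PosSemidef) →
        (∀ z ∈ Ω, (complexHessian u z).det = (f z : ℂ)) →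
        (∀ z ∈ Ω, lam ≤ f z) →
        (∀ z ∈ Ω, ‖fderiv ℝ u z‖ ≤ M₁ ∧ |lap u z| ≤ M₂ ∧
          ‖fderiv ℝ f z‖ ≤ M₃ ∧ ‖fderiv ℝ (fderiv ℝ f) z‖ ≤ M₄) →
        Ω' ⊆ Ω → (∀ x ∈ Ω', ball x d ⊆ Ω) →
        ∀ x ∈ Ω', ‖fderiv ℝ (lap u) x‖ ≤ C := by
  rcases eq_or_ne n 0 with rfl | hn
  · refine ⟨1, one_pos, fun Ω Ω' u f _ _ _ _ _ _ _ _ _ _ x _ => ?_⟩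
    rw [show lap u = fun _ => 0 from funext fun y => by simp [lap], fderiv_const_apply, norm_zero]
    exact zero_le_one
  obtain ⟨θ, hθ, hgrad⟩ := exists_norm_fderiv_hessian_le_one n hlam (M₂ / 4)
  obtain ⟨ρ, κ₀, hρ, hρ1, hκ₀, hosc⟩ := exists_oscillation_le hn hlam (M₂ / 4) hθ
  obtain ⟨R, hR, hRd, hR3, hR4⟩ := exists_small_radius M₃ M₄ hd (lt_min one_pos hκ₀)
  refine ⟨‖lapCLM n‖ * (R * ρ)⁻¹ + 1, by positivity, ?_⟩
  intro Ω Ω' u f hΩ _ hu hf hpsd hdet hlamf hbd hΩ' hdist x hx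
  have hmem : ∀ z ∈ Ω, complexHessian u z ∈ admissible n lam (M₂ / 4) := fun z hz => by
    refine ⟨hpsd z hz, ?_, ?_⟩
    · have h1 := (le_abs_self _).trans (hbd z hz).2.1
      rw [lap_eq] at h1
      linarith
    · rw [hdet z hz, Complex.ofReal_re]
      exact hlamf z hz
  have h := IsMASolution.of_bounds hu hf hmem hdet (fun z hz => (hbd z hz).2.2.1)
    (fun z hz => (hbd z hz).2.2.2) hR hR3 hR4
    ((ball_subset_ball hRd).trans (hdist x hx))
  have hsub : ball (0 : Cn n) (2 * ρ) ⊆ ball 0 2 := ball_subset_ball (by linarith)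
  have hb : ∀ {y : Cn n}, y ∈ ball (0 : Cn n) 2 → 0 + ρ • y ∈ ball (0 : Cn n) (2 * ρ) :=
    fun hy => add_smul_mem_ball hρ hy
  have key := hgrad _ _ _ (h.rescale hρ hsub)
    (mul_le_one₀ hρ1 h.bound_nonneg (min_le_left _ _)) (fun y hy z hz => by
      rw [complexHessian_rescale 0 hρ.ne', complexHessian_rescale 0 hρ.ne']
      exact hosc _ _ _ h (min_le_right _ _) _ (hb hy) _ (hb hz))
  rw [norm_fderiv_hessPi_rescale 0 hρ, norm_fderiv_hessPi_rescale x hR, smul_zero, add_zero,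
    smul_zero, add_zero] at key
  have hC2 : ContDiffOn ℝ 2 (hessPi u) Ω := contDiffOn_complexHessian hΩ (by norm_num) hu
  have hdiff : DifferentiableAt ℝ (hessPi u) x :=
    differentiableAt_of_contDiffOn hΩ one_le_two hC2 (hΩ' hx)
  have hle : ‖fderiv ℝ (hessPi u) x‖ ≤ (R * ρ)⁻¹ := by
    rw [← one_div, le_div_iff₀ (by positivity)]
    linarith
  have h1 := norm_fderiv_lap_le hdiff
  have h2 := mul_le_mul_of_nonneg_left hle (norm_nonneg (lapCLM n))
  linarith
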